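/- arXiv:1908.10724 — 3 statements merged into one kernel-verified Lean document; each statement's English description precedes it below -/
import Mathlib

section
/- If Z : Conv_sc(ℝⁿ) → ℝ is a continuous and epi-translation invariant valuation that is epi-homogeneous of degree 1, then Z is epi-additive, i.e. Z(α ⊡ u □ β ⊡ v) = α Z(u) + β Z(v) for all α, β > 0 and all u, v ∈ Conv_sc(ℝⁿ). -/
open Filter Topology MeasureTheory

noncomputable section

/-- Euclidean space `ℝⁿ`. -/
abbrev Vn (n : ℕ) := EuclideanSpace ℝ (Fin n)

/-- `u : ℝⁿ → ℝ ∪ {+∞}` (represented as an `EReal`-valued function that never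
takes the value `⊥ = -∞`) is convex. -/
def IsConvexFn {n : ℕ} (u : Vn n → EReal) : Prop :=
  ∀ x y : Vn n, ∀ t : ℝ, 0 < t → t < 1 →
    u (t • x + (1 - t) • y) ≤ (t : EReal) * u x + ((1 - t : ℝ) : EReal) * u y

/-- `Conv(ℝⁿ)`: convex, lower semicontinuous, proper functions
`ℝⁿ → ℝ ∪ {+∞}`. -/
def ConvSet (n : ℕ) : Set (Vn n → EReal) :=
  {u | IsConvexFn u ∧ LowerSemicontinuous u ∧ (∀ x, u x ≠ ⊥) ∧ (∃ x, u x ≠ ⊤)}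

/-- `Conv_sc(ℝⁿ)`: super-coercive elements of `Conv(ℝⁿ)`, i.e.
`u(x)/|x| → +∞` as `|x| → +∞`. -/
def ConvSc (n : ℕ) : Set (Vn n → EReal) :=
  {u | u ∈ ConvSet n ∧
    ∀ M : ℝ, ∃ R : ℝ, ∀ x : Vn n, R ≤ ‖x‖ → ((M * ‖x‖ : ℝ) : EReal) ≤ u x}

/-- Epi-convergence of a sequence `uk` to `u`. -/
def EpiConverges {n : ℕ} (uk : ℕ → Vn n → EReal) (u : Vn n → EReal) : Prop :=
  ∀ x : Vn n,
    (∀ xk : ℕ → Vn n, Tendsto xk atTop (𝓝 x) →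
      u x ≤ liminf (fun k => uk k (xk k)) atTop) ∧
    (∃ xk : ℕ → Vn n, Tendsto xk atTop (𝓝 x) ∧
      Tendsto (fun k => uk k (xk k)) atTop (𝓝 (u x)))

/-- Continuity (with respect to epi-convergence) of a functional on a class `X`. -/
def ContinuousVal {n : ℕ} (X : Set (Vn n → EReal)) (Z : (Vn n → EReal) → ℝ) : Prop :=
  ∀ (uk : ℕ → Vn n → EReal) (u : Vn n → EReal),
    (∀ k, uk k ∈ X) → u ∈ X → EpiConverges uk u →
      Tendsto (fun k => Z (uk k)) atTop (𝓝 (Z u))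

/-- The valuation property on a class `X` (here `⊔`, `⊓` are the pointwise
maximum and minimum). -/
def IsValuation {n : ℕ} (X : Set (Vn n → EReal)) (Z : (Vn n → EReal) → ℝ) : Prop :=
  ∀ u v : Vn n → EReal, u ∈ X → v ∈ X → u ⊔ v ∈ X → u ⊓ v ∈ X →
    Z (u ⊔ v) + Z (u ⊓ v) = Z u + Z v

/-- Epi-translation invariance: invariance under `u ↦ u(· - x₀) + c`. -/
def EpiTranslationInvariant {n : ℕ} (X : Set (Vn n → EReal)) (Z : (Vn n → EReal) → ℝ) : Prop :=
  ∀ u ∈ X, ∀ x₀ : Vn n, ∀ c : ℝ, Z (fun x => u (x - x₀) + (c : EReal)) = Z u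

-- Epi-multiplication `λ ⊡ u`; for `λ = 0` it is the indicator of `{0}`.
open Classical in
def epiMul {n : ℕ} (l : ℝ) (u : Vn n → EReal) : Vn n → EReal :=
  if l = 0 then (fun x => if x = 0 then (0 : EReal) else ⊤)
  else fun x => (l : EReal) * u (l⁻¹ • x)

/-- `Z` is epi-homogeneous of degree `α`: `Z(λ ⊡ u) = λ^α Z(u)` for `λ > 0`. -/
def EpiHomogeneous {n : ℕ} (X : Set (Vn n → EReal)) (Z : (Vn n → EReal) → ℝ) (α : ℝ) : Prop :=
  ∀ u ∈ X, ∀ l : ℝ, 0 < l → Z (epiMul l u) = l ^ α * Z u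

/-- Inf-convolution of two functions. -/
def infConv {n : ℕ} (u v : Vn n → EReal) : Vn n → EReal :=
  fun z => ⨅ x : Vn n, (u x + v (z - x))

/-- Convex conjugate of a finite function. -/
def cj {n : ℕ} (f : Vn n → ℝ) : Vn n → EReal :=
  fun x => ⨆ p : Vn n, ((inner ℝ x p - f p : ℝ) : EReal)

lemma cj_le_iff {n : ℕ} (f : Vn n → ℝ) (x : Vn n) (c : ℝ) :
    cj f x ≤ (c : EReal) ↔ ∀ p, inner ℝ x p - f p ≤ c := by
  simp only [cj, iSup_le_iff, EReal.coe_le_coe_iff]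

lemma le_cj {n : ℕ} (f : Vn n → ℝ) (x p : Vn n) :
    ((inner ℝ x p - f p : ℝ) : EReal) ≤ cj f x :=
  le_iSup (fun p : Vn n => ((inner ℝ x p - f p : ℝ) : EReal)) p

lemma cj_ne_bot {n : ℕ} (f : Vn n → ℝ) (x : Vn n) : cj f x ≠ ⊥ := by
  intro h
  have := le_cj f x 0
  rw [h] at this
  exact EReal.coe_ne_bot _ (le_bot_iff.1 this)

lemma cvx_cont {n : ℕ} {f : Vn n → ℝ} (hf : ConvexOn ℝ Set.univ f) : Continuous f :=
  hf.locallyLipschitz.continuous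

lemma sandwich {n : ℕ} {f h : Vn n → ℝ} (hf : ConvexOn ℝ Set.univ f)
    (hh : ConcaveOn ℝ Set.univ h) (hle : ∀ p, h p ≤ f p) :
    ∃ (x : Vn n) (c : ℝ), ∀ p, h p ≤ inner ℝ x p - c ∧ inner ℝ x p - c ≤ f p := by
  have hs := hf.convex_strict_epigraph
  have ht := hh.convex_hypograph
  have ho : IsOpen {p : Vn n × ℝ | p.1 ∈ Set.univ ∧ f p.1 < p.2} := by
    simp only [Set.mem_univ, true_and]
    exact isOpen_lt ((cvx_cont hf).comp continuous_fst) continuous_snd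
  have hd : Disjoint {p : Vn n × ℝ | p.1 ∈ Set.univ ∧ f p.1 < p.2}
      {p : Vn n × ℝ | p.1 ∈ Set.univ ∧ p.2 ≤ h p.1} := by
    rw [Set.disjoint_left]
    rintro ⟨p, t⟩ ⟨_, h1⟩ ⟨_, h2⟩
    have := hle p
    simp only at h1 h2
    linarith
  obtain ⟨φ, s, h1, h2⟩ := geometric_hahn_banach_open hs ho ht hd
  set φ₁ : Vn n →L[ℝ] ℝ := φ.comp (ContinuousLinearMap.inl ℝ (Vn n) ℝ) with hφ₁
  set β : ℝ := φ (0, 1) with hβ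
  have hφ : ∀ p t, φ (p, t) = φ₁ p + t * β := by
    intro p t
    have : ((p, t) : Vn n × ℝ) = (p, 0) + t • (0, 1) := by simp
    rw [this, map_add, map_smul]
    simp [hφ₁, hβ]
  have h1' : ∀ p t, f p < t → φ₁ p + t * β < s := fun p t hpt => by
    rw [← hφ]; exact h1 (p, t) ⟨trivial, hpt⟩
  have h2' : ∀ p, s ≤ φ₁ p + h p * β := fun p => by
    rw [← hφ]; exact h2 (p, h p) ⟨trivial, le_rfl⟩
  have hβneg : β < 0 := by
    have a := h1' 0 (f 0 + 1) (by linarith)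
    have b := h2' 0
    have c := hle 0
    by_contra hcon
    push Not at hcon
    nlinarith
  have h3 : ∀ p, φ₁ p + f p * β ≤ s := by
    intro p
    by_contra hcon
    push Not at hcon
    have := h1' p (f p + (φ₁ p + f p * β - s) / (-β)) (by
      have : 0 < (φ₁ p + f p * β - s) / (-β) := div_pos (by linarith) (by linarith)
      linarith)
    have e : (f p + (φ₁ p + f p * β - s) / (-β)) * β = f p * β - (φ₁ p + f p * β - s) := by
      have : β ≠ 0 := hβneg.ne
      field_simp
      ring
    rw [e] at this
    linarith
  refine ⟨(InnerProductSpace.toDual ℝ (Vn n)).symm ((-β)⁻¹ • φ₁), (-β)⁻¹ * s, fun p => ?_⟩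
  rw [InnerProductSpace.toDual_symm_apply]
  have hb : 0 < (-β)⁻¹ := inv_pos.2 (by linarith)
  have e : ((-β)⁻¹ • φ₁) p - (-β)⁻¹ * s = (-β)⁻¹ * (φ₁ p - s) := by
    simp; ring
  rw [e]
  have key : ∀ r, (-β)⁻¹ * (r * (-β)) = r := by
    intro r
    have : β ≠ 0 := hβneg.ne
    field_simp
  constructor
  · rw [← key (h p)]
    exact mul_le_mul_of_nonneg_left (by linarith [h2' p]) hb.le
  · rw [← key (f p)]
    exact mul_le_mul_of_nonneg_left (by linarith [h3 p]) hb.le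

lemma exists_subgrad {n : ℕ} {f : Vn n → ℝ} (hf : ConvexOn ℝ Set.univ f) (q : Vn n) :
    ∃ x : Vn n, ∀ p, f q + inner ℝ x (p - q) ≤ f p := by
  -- translate the minorant through the minimum-point trick: use concave -> sandwich
  have ho := hf.convex_strict_epigraph
  have hop : IsOpen {p : Vn n × ℝ | p.1 ∈ Set.univ ∧ f p.1 < p.2} := by
    simp only [Set.mem_univ, true_and]
    exact isOpen_lt ((cvx_cont hf).comp continuous_fst) continuous_snd
  obtain ⟨φ, h1⟩ := geometric_hahn_banach_open_point (x := (q, f q)) ho hop (by simp)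
  set φ₁ : Vn n →L[ℝ] ℝ := φ.comp (ContinuousLinearMap.inl ℝ (Vn n) ℝ) with hφ₁
  set β : ℝ := φ (0, 1) with hβ
  have hφ : ∀ p t, φ (p, t) = φ₁ p + t * β := by
    intro p t
    have : ((p, t) : Vn n × ℝ) = (p, 0) + t • (0, 1) := by simp
    rw [this, map_add, map_smul]
    simp [hφ₁, hβ]
  have h1' : ∀ p t, f p < t → φ₁ p + t * β < φ₁ q + f q * β := fun p t hpt => by
    rw [← hφ, ← hφ]; exact h1 (p, t) ⟨trivial, hpt⟩
  have hβneg : β < 0 := by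
    have a := h1' q (f q + 1) (by linarith)
    nlinarith
  have h3 : ∀ p, φ₁ p + f p * β ≤ φ₁ q + f q * β := by
    intro p
    refine le_of_forall_pos_lt_add fun ε hε => ?_
    have := h1' p (f p + ε / (-β)) (by have := div_pos hε (neg_pos.2 hβneg); linarith)
    have e : (f p + ε / (-β)) * β = f p * β - ε := by
      have : β ≠ 0 := hβneg.ne
      field_simp
      ring
    rw [e] at this
    linarith
  refine ⟨(InnerProductSpace.toDual ℝ (Vn n)).symm ((-β)⁻¹ • φ₁), fun p => ?_⟩
  rw [InnerProductSpace.toDual_symm_apply]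
  have hb : 0 < (-β)⁻¹ := inv_pos.2 (by linarith)
  have h4 : φ₁ (p - q) ≤ (f p - f q) * (-β) := by
    rw [map_sub]; linarith [h3 p]
  have h5 : (-β)⁻¹ * φ₁ (p - q) ≤ (-β)⁻¹ * ((f p - f q) * (-β)) :=
    mul_le_mul_of_nonneg_left h4 hb.le
  have h6 : (-β)⁻¹ * ((f p - f q) * (-β)) = f p - f q := by
    have : β ≠ 0 := hβneg.ne
    field_simp
  simp only [smul_apply, smul_eq_mul]
  linarith

lemma cvx_bdd {n : ℕ} {f : Vn n → ℝ} (hf : ConvexOn ℝ Set.univ f) (R : ℝ) :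
    ∃ C : ℝ, 0 ≤ C ∧ ∀ p, ‖p‖ ≤ R → |f p| ≤ C := by
  obtain ⟨C, hC⟩ := (isCompact_closedBall (0 : Vn n) R).exists_bound_of_continuousOn
    (cvx_cont hf).continuousOn
  refine ⟨max C 0, le_max_right _ _, fun p hp => le_max_of_le_left ?_⟩
  exact hC p (by simpa using hp)

lemma cj_mem {n : ℕ} {f : Vn n → ℝ} (hf : ConvexOn ℝ Set.univ f) : cj f ∈ ConvSc n := by
  refine ⟨⟨?_, ?_, cj_ne_bot f, ?_⟩, ?_⟩
  · intro x y t ht ht1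
    refine iSup_le fun p => ?_
    have e : inner ℝ (t • x + (1 - t) • y) p - f p
        = t * (inner ℝ x p - f p) + (1 - t) * (inner ℝ y p - f p) := by
      rw [inner_add_left, real_inner_smul_left, real_inner_smul_left]; ring
    rw [e, EReal.coe_add, EReal.coe_mul, EReal.coe_mul]
    exact add_le_add
      (mul_le_mul_of_nonneg_left (le_cj f x p) (by exact_mod_cast ht.le))
      (mul_le_mul_of_nonneg_left (le_cj f y p) (by exact_mod_cast (by linarith : (0:ℝ) ≤ 1 - t)))
  · refine lowerSemicontinuous_iSup fun p => Continuous.lowerSemicontinuous ?_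
    exact continuous_coe_real_ereal.comp (by fun_prop)
  · obtain ⟨x, hx⟩ := exists_subgrad hf 0
    refine ⟨x, fun htop => ?_⟩
    have : cj f x ≤ ((- f 0 : ℝ) : EReal) := by
      rw [cj_le_iff]
      intro p
      have := hx p
      rw [sub_zero] at this
      linarith
    rw [htop] at this
    exact EReal.coe_ne_top _ (top_le_iff.1 this)
  · intro M
    obtain ⟨C, hC0, hC⟩ := cvx_bdd hf (|M| + 1)
    refine ⟨C + 1, fun x hx => le_trans ?_ (le_cj f x (((|M| + 1) / ‖x‖) • x))⟩
    have hxp : 0 < ‖x‖ := by linarith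
    have hn : ‖((|M| + 1) / ‖x‖) • x‖ ≤ |M| + 1 := by
      rw [norm_smul, Real.norm_of_nonneg (by positivity)]
      field_simp
      exact le_rfl
    have := (abs_le.1 (hC _ hn)).2
    rw [EReal.coe_le_coe_iff, real_inner_smul_right, real_inner_self_eq_norm_sq]
    have e : (|M| + 1) / ‖x‖ * ‖x‖ ^ 2 = (|M| + 1) * ‖x‖ := by field_simp
    rw [e]
    have := le_abs_self M
    nlinarith

lemma ereal_cases_real {a : EReal} (h1 : a ≠ ⊥) (h2 : a ≠ ⊤) : ∃ r : ℝ, a = (r : EReal) :=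
  ⟨a.toReal, (EReal.coe_toReal h2 h1).symm⟩

lemma cj_infConv {n : ℕ} {f g : Vn n → ℝ} (hf : ConvexOn ℝ Set.univ f)
    (hg : ConvexOn ℝ Set.univ g) :
    infConv (cj f) (cj g) = cj (fun p => f p + g p) := by
  funext z
  apply le_antisymm
  · by_cases htop : cj (fun p => f p + g p) z = ⊤
    · rw [htop]; exact le_top
    obtain ⟨c, hc⟩ := ereal_cases_real (cj_ne_bot _ z) htop
    rw [hc]
    have h1 := (cj_le_iff _ z c).1 hc.le
    have hh : ConcaveOn ℝ Set.univ (fun p => inner ℝ z p - c - g p) := by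
      refine ConcaveOn.sub ?_ hg
      refine ⟨convex_univ, fun x _ y _ a b _ _ hab => le_of_eq ?_⟩
      simp only [inner_add_right, real_inner_smul_right, smul_eq_mul]
      linear_combination (-c) * hab
    obtain ⟨x, d, hx⟩ := sandwich hf hh (fun p => by linarith [h1 p])
    refine (iInf_le _ x).trans ?_
    have e : (c : EReal) = (d : EReal) + ((c - d : ℝ) : EReal) := by
      rw [← EReal.coe_add]; congr 1; ring
    rw [e]
    refine add_le_add ((cj_le_iff _ _ _).2 fun p => by linarith [(hx p).2])
      ((cj_le_iff _ _ _).2 fun p => ?_)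
    rw [inner_sub_left]
    linarith [(hx p).1]
  · refine le_iInf fun x => iSup_le fun p => ?_
    have e : inner ℝ z p - (f p + g p) = (inner ℝ x p - f p) + (inner ℝ (z - x) p - g p) := by
      rw [inner_sub_left]; ring
    rw [e, EReal.coe_add]
    exact add_le_add (le_cj _ _ _) (le_cj _ _ _)

lemma cj_epiMul {n : ℕ} (f : Vn n → ℝ) {l : ℝ} (hl : 0 < l) :
    epiMul l (cj f) = cj (fun p => l * f p) := by
  rw [epiMul, if_neg hl.ne']
  funext x
  have key : ∀ p, inner ℝ x p - l * f p = l * (inner ℝ (l⁻¹ • x) p - f p) := by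
    intro p
    rw [real_inner_smul_left]
    field_simp
  apply le_antisymm
  · by_cases htop : cj (fun p => l * f p) x = ⊤
    · rw [htop]; exact le_top
    obtain ⟨c, hc⟩ := ereal_cases_real (cj_ne_bot _ x) htop
    rw [hc]
    have h1 := (cj_le_iff _ x c).1 hc.le
    have h2 : cj f (l⁻¹ • x) ≤ ((l⁻¹ * c : ℝ) : EReal) := by
      rw [cj_le_iff]
      intro p
      have := h1 p
      rw [key p] at this
      rw [inv_mul_eq_div, le_div_iff₀ hl]
      linarith
    refine (mul_le_mul_of_nonneg_left h2 (by exact_mod_cast hl.le)).trans ?_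
    rw [← EReal.coe_mul]
    apply le_of_eq
    congr 1
    field_simp
  · refine iSup_le fun p => ?_
    rw [key p, EReal.coe_mul]
    exact mul_le_mul_of_nonneg_left (le_cj _ _ _) (by exact_mod_cast hl.le)

lemma cj_add_affine {n : ℕ} (f : Vn n → ℝ) (a : Vn n) (b : ℝ) :
    (fun x => cj f (x - a) + ((-b : ℝ) : EReal)) = cj (fun p => f p + (inner ℝ a p + b)) := by
  funext x
  have key : ∀ p, inner ℝ x p - (f p + (inner ℝ a p + b))
      = (inner ℝ (x - a) p - f p) + (-b) := by
    intro p
    rw [inner_sub_left]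
    ring
  apply le_antisymm
  · by_cases htop : cj (fun p => f p + (inner ℝ a p + b)) x = ⊤
    · rw [htop]; exact le_top
    obtain ⟨c, hc⟩ := ereal_cases_real (cj_ne_bot _ x) htop
    rw [hc]
    have h1 := (cj_le_iff _ x c).1 hc.le
    have h2 : cj f (x - a) ≤ ((c + b : ℝ) : EReal) := by
      rw [cj_le_iff]
      intro p
      have := h1 p
      rw [key p] at this
      linarith
    refine (add_le_add h2 le_rfl).trans ?_
    rw [← EReal.coe_add]
    apply le_of_eq
    congr 1
    ring
  · refine iSup_le fun p => ?_
    rw [key p, EReal.coe_add]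
    exact add_le_add (le_cj _ _ _) le_rfl

lemma cj_sup {n : ℕ} (f g : Vn n → ℝ) : cj f ⊔ cj g = cj (fun p => min (f p) (g p)) := by
  funext x
  apply le_antisymm
  · refine sup_le (iSup_le fun p => ?_) (iSup_le fun p => ?_)
    · refine le_trans ?_ (le_cj _ x p)
      rw [EReal.coe_le_coe_iff]
      linarith [min_le_left (f p) (g p)]
    · refine le_trans ?_ (le_cj _ x p)
      rw [EReal.coe_le_coe_iff]
      linarith [min_le_right (f p) (g p)]
  · refine iSup_le fun p => ?_
    simp only
    rcases le_total (f p) (g p) with h | h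
    · rw [min_eq_left h]; exact (le_cj f x p).trans le_sup_left
    · rw [min_eq_right h]; exact (le_cj g x p).trans le_sup_right

/-- the key computation with a ridge `ℓ⁺`. -/
lemma cj_inf_ridge {n : ℕ} {g : Vn n → ℝ} (hg : ConvexOn ℝ Set.univ g) (a : Vn n) (b : ℝ) :
    cj (fun p => g p + max (inner ℝ a p + b) 0) ⊓
      cj (fun p => g p + max (inner ℝ a p + b) 0 + (inner ℝ a p + b)) =
    cj (fun p => g p + 2 * max (inner ℝ a p + b) 0) := by
  set ℓ : Vn n → ℝ := fun p => inner ℝ a p + b with hℓ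
  funext x
  apply le_antisymm
  · by_cases htop : cj (fun p => g p + 2 * max (ℓ p) 0) x = ⊤
    · exact le_of_le_of_eq le_top htop.symm
    obtain ⟨c, hc⟩ := ereal_cases_real (cj_ne_bot _ x) htop
    refine le_of_le_of_eq ?_ hc.symm
    have h1 := (cj_le_iff _ x c).1 hc.le
    rw [Pi.inf_apply, inf_le_iff]
    by_contra hcon
    push Not at hcon
    obtain ⟨hp, hq⟩ := hcon
    have hp' := mt (cj_le_iff _ x c).2 hp.not_ge
    have hq' := mt (cj_le_iff _ x c).2 hq.not_ge
    push Not at hp' hq'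
    obtain ⟨p, hp⟩ := hp'
    obtain ⟨q, hq⟩ := hq'
    change c < inner ℝ x p - (g p + max (ℓ p) 0) at hp
    change c < inner ℝ x q - (g q + max (ℓ q) 0 + ℓ q) at hq
    have hlp : 0 < ℓ p := by
      by_contra hneg
      push Not at hneg
      have := h1 p
      rw [max_eq_right hneg] at hp this
      linarith
    have hlq : ℓ q < 0 := by
      by_contra hneg
      push Not at hneg
      have := h1 q
      rw [max_eq_left hneg] at hq this
      linarith
    rw [max_eq_left hlp.le] at hp
    rw [max_eq_right hlq.le] at hq
    set s : ℝ := -ℓ q / (ℓ p - ℓ q) with hs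
    set t : ℝ := ℓ p / (ℓ p - ℓ q) with ht
    have hD : 0 < ℓ p - ℓ q := by linarith
    have hs0 : 0 < s := div_pos (by linarith) hD
    have ht0 : 0 < t := div_pos (by linarith) hD
    have hst : s + t = 1 := by rw [hs, ht]; field_simp; ring
    have hz : s * ℓ p + t * ℓ q = 0 := by rw [hs, ht]; field_simp; ring
    have hlr : ℓ (s • p + t • q) = 0 := by
      rw [← hz]
      simp only [hℓ, inner_add_right, real_inner_smul_right]
      linear_combination (-b) * hst
    have hcv := hg.2 (Set.mem_univ p) (Set.mem_univ q) hs0.le ht0.le hst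
    have hr := h1 (s • p + t • q)
    rw [hlr] at hr
    simp only [max_self, mul_zero, add_zero, inner_add_right, real_inner_smul_right,
      smul_eq_mul] at hr hcv
    have e1 := mul_lt_mul_of_pos_left hp hs0
    have e2 := mul_lt_mul_of_pos_left hq ht0
    have : c = s * c + t * c := by rw [← add_mul, hst, one_mul]
    nlinarith
  · refine le_inf (iSup_le fun p => ?_) (iSup_le fun p => ?_)
    · refine le_trans ?_ (le_cj _ x p)
      rw [EReal.coe_le_coe_iff]
      linarith [le_max_right (ℓ p) 0]
    · refine le_trans ?_ (le_cj _ x p)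
      rw [EReal.coe_le_coe_iff]
      change inner ℝ x p - (g p + 2 * max (ℓ p) 0) ≤ inner ℝ x p - (g p + max (ℓ p) 0 + ℓ p)
      linarith [le_max_left (ℓ p) 0]

/-- min of `u + λ|·-x₀|²` exists -/
lemma exists_prox {n : ℕ} {u : Vn n → EReal} (hu : u ∈ ConvSc n) (x₀ : Vn n) (l : ℝ)
    (hl : 0 < l) :
    ∃ (y₀ : Vn n) (a : ℝ), u y₀ = (a : EReal) ∧
      ∀ (y : Vn n) (b : ℝ), u y = (b : EReal) →
        a + l * ‖y₀ - x₀‖ ^ 2 ≤ b + l * ‖y - x₀‖ ^ 2 := by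
  obtain ⟨⟨hconv, hlsc, hbot, y₁, hy₁⟩, hsc⟩ := hu
  obtain ⟨a₁, ha₁⟩ := ereal_cases_real (hbot y₁) hy₁
  set A : ℝ := a₁ + l * ‖y₁ - x₀‖ ^ 2 with hA
  obtain ⟨R, hR⟩ := hsc |A|
  set R' : ℝ := max (max R 1) ‖y₁‖ with hR'
  set Φ : Vn n → EReal := fun y => u y + ((l * ‖y - x₀‖ ^ 2 : ℝ) : EReal) with hΦ
  have hΦlsc : LowerSemicontinuous Φ := by
    refine LowerSemicontinuous.add' hlsc ?_ ?_
    · apply Continuous.lowerSemicontinuous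
      exact continuous_coe_real_ereal.comp (by fun_prop)
    · intro x
      exact EReal.continuousAt_add (Or.inr (EReal.coe_ne_bot _)) (Or.inr (EReal.coe_ne_top _))
  obtain ⟨y₀, hy₀, hmin⟩ := LowerSemicontinuousOn.exists_isMinOn
    (s := Metric.closedBall (0 : Vn n) R') ⟨y₁, by simp [hR']⟩
    (isCompact_closedBall _ _) (hΦlsc.lowerSemicontinuousOn _)
  have h1 : Φ y₀ ≤ (A : EReal) := by
    have := hmin (show y₁ ∈ Metric.closedBall (0 : Vn n) R' by simp [hR'])
    simp only [Set.mem_ofPred_eq] at this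
    refine this.trans (le_of_eq ?_)
    simp only [hΦ, ha₁, hA, EReal.coe_add]
  have htop : u y₀ ≠ ⊤ := by
    intro h
    simp only [hΦ, h, EReal.top_add_coe, top_le_iff] at h1
    exact EReal.coe_ne_top _ h1
  obtain ⟨a, ha⟩ := ereal_cases_real (hbot y₀) htop
  refine ⟨y₀, a, ha, fun y b hb => ?_⟩
  by_cases hy : ‖y‖ ≤ R'
  · have := hmin (show y ∈ Metric.closedBall (0 : Vn n) R' by simpa using hy)
    simp only [Set.mem_ofPred_eq, hΦ, ha, hb, ← EReal.coe_add, EReal.coe_le_coe_iff] at this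
    exact this
  · push Not at hy
    simp only [hΦ, ha, ← EReal.coe_add, EReal.coe_le_coe_iff] at h1
    have hyR : R ≤ ‖y‖ := le_trans (le_trans (le_max_left _ _) (le_max_left _ _)) hy.le
    have hy1 : 1 ≤ ‖y‖ := le_trans (le_trans (le_max_right _ _) (le_max_left _ _)) hy.le
    have h2 := hR y hyR
    rw [hb, EReal.coe_le_coe_iff] at h2
    have h3 : A ≤ |A| * ‖y‖ := (le_abs_self A).trans (le_mul_of_one_le_right (abs_nonneg _) hy1)
    have h4 : 0 ≤ l * ‖y - x₀‖ ^ 2 := by positivity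
    linarith

lemma prox_subgrad {n : ℕ} {u : Vn n → EReal} (hu : u ∈ ConvSc n) (x₀ : Vn n) (l : ℝ)
    (hl : 0 < l) :
    ∃ (y₀ : Vn n) (a : ℝ), u y₀ = (a : EReal) ∧
      ∀ (y : Vn n) (b : ℝ), u y = (b : EReal) →
        a + inner ℝ ((2 * l) • (x₀ - y₀)) (y - y₀) ≤ b := by
  obtain ⟨y₀, a, ha, hmin⟩ := exists_prox hu x₀ l hl
  refine ⟨y₀, a, ha, fun y b hb => ?_⟩
  have key : ∀ t : ℝ, 0 < t → t < 1 →
      a + inner ℝ ((2 * l) • (x₀ - y₀)) (y - y₀) ≤ b + t * (l * ‖y - y₀‖ ^ 2) := by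
    intro t ht ht1
    have hc := hu.1.1 y y₀ t ht ht1
    rw [ha, hb, ← EReal.coe_mul, ← EReal.coe_mul, ← EReal.coe_add] at hc
    have hne : u (t • y + (1 - t) • y₀) ≠ ⊤ := by
      intro h
      rw [h] at hc
      exact EReal.coe_ne_top _ (top_le_iff.1 hc)
    obtain ⟨r, hr⟩ := ereal_cases_real (hu.1.2.2.1 _) hne
    rw [hr, EReal.coe_le_coe_iff] at hc
    have h1 := hmin _ r hr
    have e : t • y + (1 - t) • y₀ - x₀ = t • (y - y₀) - (x₀ - y₀) := by module
    have e' : ‖y₀ - x₀‖ = ‖x₀ - y₀‖ := norm_sub_rev _ _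
    rw [e, e', norm_sub_sq_real (t • (y - y₀)), norm_smul, Real.norm_of_nonneg ht.le, real_inner_smul_left] at h1
    rw [real_inner_smul_left, real_inner_comm]
    have h2 : t * (a + 2 * l * inner ℝ (y - y₀) (x₀ - y₀)) ≤ t * (b + t * (l * ‖y - y₀‖ ^ 2)) := by
      nlinarith
    exact le_of_mul_le_mul_left h2 ht
  have hlim : Tendsto (fun t : ℝ => b + t * (l * ‖y - y₀‖ ^ 2)) (𝓝[>] 0)
      (𝓝 (b + 0 * (l * ‖y - y₀‖ ^ 2))) := by
    apply Tendsto.mono_left _ nhdsWithin_le_nhds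
    exact (Continuous.tendsto (by fun_prop) 0)
  rw [zero_mul, add_zero] at hlim
  refine ge_of_tendsto hlim ?_
  filter_upwards [Ioo_mem_nhdsGT (show (0 : ℝ) < 1 by norm_num)] with t ht
  exact key t ht.1 ht.2

lemma sc_lower {n : ℕ} {u : Vn n → EReal} (hu : u ∈ ConvSc n) (p : Vn n) :
    ∃ C : ℝ, ∀ (x : Vn n) (b : ℝ), u x = (b : EReal) → inner ℝ x p - b ≤ C := by
  obtain ⟨⟨hconv, hlsc, hbot, y₁, hy₁⟩, hsc⟩ := hu
  obtain ⟨R, hR⟩ := hsc ‖p‖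
  obtain ⟨y₀, hy₀, hmin⟩ := LowerSemicontinuousOn.exists_isMinOn
    (s := Metric.closedBall (0 : Vn n) (max R 0)) ⟨0, by simp⟩
    (isCompact_closedBall _ _) (hlsc.lowerSemicontinuousOn _)
  refine ⟨max R 0 * ‖p‖ + |(u y₀).toReal|, fun x b hb => ?_⟩
  have hi : inner ℝ x p ≤ ‖x‖ * ‖p‖ := real_inner_le_norm x p
  by_cases hx : ‖x‖ ≤ max R 0
  · have h1 := hmin (show x ∈ Metric.closedBall (0 : Vn n) (max R 0) by simpa using hx)
    simp only [Set.mem_ofPred_eq, hb] at h1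
    have hne : u y₀ ≠ ⊤ := by
      intro h
      rw [h] at h1
      exact EReal.coe_ne_top _ (top_le_iff.1 h1)
    obtain ⟨a, ha⟩ := ereal_cases_real (hbot y₀) hne
    rw [ha, EReal.coe_le_coe_iff] at h1
    rw [ha, EReal.toReal_coe]
    have := neg_abs_le a
    have := mul_le_mul_of_nonneg_right hx (norm_nonneg p)
    linarith
  · push Not at hx
    have h1 := hR x ((le_max_left _ _).trans hx.le)
    rw [hb, EReal.coe_le_coe_iff] at h1
    have : 0 ≤ max R 0 * ‖p‖ := mul_nonneg (le_max_right _ _) (norm_nonneg _)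
    have := abs_nonneg (u y₀).toReal
    linarith

lemma convexOn_iSup_affine {n : ℕ} {ι : Type*} [Nonempty ι] (a : ι → Vn n) (b : ι → ℝ)
    (hb : ∀ p, BddAbove (Set.range fun i => inner ℝ (a i) p - b i)) :
    ConvexOn ℝ Set.univ (fun p => ⨆ i, (inner ℝ (a i) p - b i)) := by
  refine ⟨convex_univ, fun x _ y _ s t hs ht hst => ciSup_le fun i => ?_⟩
  have h1 := le_ciSup (hb x) i
  have h2 := le_ciSup (hb y) i
  simp only [inner_add_right, real_inner_smul_right, smul_eq_mul]
  have h3 := mul_le_mul_of_nonneg_left h1 hs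
  have h4 := mul_le_mul_of_nonneg_left h2 ht
  have : b i = s * b i + t * b i := by rw [← add_mul, hst, one_mul]
  linarith

lemma exists_eq_cj {n : ℕ} {u : Vn n → EReal} (hu : u ∈ ConvSc n) :
    ∃ f : Vn n → ℝ, ConvexOn ℝ Set.univ f ∧ cj f = u := by
  have hbot := hu.1.2.2.1
  obtain ⟨y₁, hy₁⟩ := hu.1.2.2.2
  let D := {x : Vn n // u x ≠ ⊤}
  have : Nonempty D := ⟨⟨y₁, hy₁⟩⟩
  have hreal : ∀ i : D, u i.1 = ((u i.1).toReal : EReal) := fun i =>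
    (EReal.coe_toReal i.2 (hbot _)).symm
  have hb : ∀ p, BddAbove (Set.range fun i : D => inner ℝ i.1 p - (u i.1).toReal) := by
    intro p
    obtain ⟨C, hC⟩ := sc_lower hu p
    refine ⟨C, ?_⟩
    rintro _ ⟨i, rfl⟩
    exact hC _ _ (hreal i)
  refine ⟨fun p => ⨆ i : D, (inner ℝ i.1 p - (u i.1).toReal),
    convexOn_iSup_affine (fun i : D => i.1) (fun i : D => (u i.1).toReal) hb, ?_⟩
  funext x₀
  apply le_antisymm
  · refine iSup_le fun p => ?_
    by_cases hx : u x₀ = ⊤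
    · rw [hx]; exact le_top
    rw [hreal ⟨x₀, hx⟩, EReal.coe_le_coe_iff]
    have := le_ciSup (hb p) ⟨x₀, hx⟩
    simp only at this ⊢
    linarith
  · refine EReal.ge_of_forall_gt_iff_ge.1 fun c hc => ?_
    -- c real below u x₀
    have hev := hu.1.2.1 x₀ (c : EReal) hc
    obtain ⟨r, hr, hball⟩ := Metric.eventually_nhds_iff.1 hev
    obtain ⟨C, hC⟩ := sc_lower hu 0
    set l : ℝ := (|c| + |C| + 1) / r ^ 2 with hl
    have hlpos : 0 < l := by positivity
    obtain ⟨y₀, a, ha, hsub⟩ := prox_subgrad hu x₀ l hlpos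
    set p : Vn n := (2 * l) • (x₀ - y₀) with hp
    have hfp : (⨆ i : D, (inner ℝ i.1 p - (u i.1).toReal)) ≤ inner ℝ y₀ p - a := by
      refine ciSup_le fun i => ?_
      have := hsub i.1 _ (hreal i)
      rw [inner_sub_right, real_inner_comm i.1 p, real_inner_comm y₀ p] at this
      linarith
    refine le_trans ?_ (le_cj _ x₀ p)
    rw [EReal.coe_le_coe_iff]
    have hip : inner ℝ x₀ p - inner ℝ y₀ p = 2 * l * ‖x₀ - y₀‖ ^ 2 := by
      rw [← inner_sub_left, hp, real_inner_smul_right, real_inner_self_eq_norm_sq]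
    have hnn : 0 ≤ l * ‖x₀ - y₀‖ ^ 2 := by positivity
    by_cases hd : ‖x₀ - y₀‖ < r
    · have h1 : (c : EReal) < u y₀ := hball (y := y₀) (by rw [dist_comm, dist_eq_norm]; exact hd)
      rw [ha, EReal.coe_lt_coe_iff] at h1
      linarith
    · push Not at hd
      have h1 := hC y₀ a ha
      rw [inner_zero_right] at h1
      have h2 : l * r ^ 2 ≤ l * ‖x₀ - y₀‖ ^ 2 := by gcongr
      have h3 : l * r ^ 2 = |c| + |C| + 1 := by rw [hl]; field_simp
      have := le_abs_self c
      have := le_abs_self C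
      linarith

/-- Uniform convergence on balls. -/
def LUC {n : ℕ} (fk : ℕ → Vn n → ℝ) (f : Vn n → ℝ) : Prop :=
  ∀ R ε : ℝ, 0 < ε → ∀ᶠ k in atTop, ∀ p : Vn n, ‖p‖ ≤ R → |fk k p - f p| ≤ ε

lemma concave_cone {n : ℕ} (x : Vn n) (c ε : ℝ) (hε : 0 ≤ ε) :
    ConcaveOn ℝ Set.univ (fun p : Vn n => inner ℝ x p - c - ε * ‖p‖) := by
  refine ⟨convex_univ, fun p _ q _ a b ha hb hab => ?_⟩
  have h1 : ‖a • p + b • q‖ ≤ a * ‖p‖ + b * ‖q‖ := by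
    refine (norm_add_le _ _).trans ?_
    rw [norm_smul, norm_smul, Real.norm_of_nonneg ha, Real.norm_of_nonneg hb]
  have h2 := mul_le_mul_of_nonneg_left h1 hε
  simp only [inner_add_right, real_inner_smul_right, smul_eq_mul]
  have : c = a * c + b * c := by rw [← add_mul, hab, one_mul]
  linarith

lemma recovery {n : ℕ} {fk : ℕ → Vn n → ℝ} {f : Vn n → ℝ}
    (hfk : ∀ k, ConvexOn ℝ Set.univ (fk k)) (h : LUC fk f) {x : Vn n} {c : ℝ}
    (hc : cj f x ≤ (c : EReal)) {ε : ℝ} (hε : 0 < ε) :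
    ∀ᶠ k in atTop, ∃ y : Vn n, ‖y - x‖ ≤ ε ∧ cj (fk k) y ≤ ((c + ε : ℝ) : EReal) := by
  rw [cj_le_iff] at hc
  set M : ℝ := |f 0| + |c| + 1 with hM
  have hMpos : 0 < M := by positivity
  set R : ℝ := (M + 1) / ε with hR
  have hRpos : 0 < R := by positivity
  filter_upwards [h R (min ε 1) (by positivity)] with k hk
  have hball : ∀ p, ‖p‖ ≤ R → inner ℝ x p - c - min ε 1 ≤ fk k p := by
    intro p hp
    have := (abs_le.1 (hk p hp)).1
    linarith [hc p]
  have h0 : fk k 0 + c ≤ M := by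
    have := (abs_le.1 (hk 0 (by simpa using hRpos.le))).2
    have := min_le_right ε 1
    have := le_abs_self (f 0)
    have := le_abs_self c
    linarith
  have hle : ∀ p, inner ℝ x p - (c + ε) - ε * ‖p‖ ≤ fk k p := by
    intro p
    by_cases hp : ‖p‖ ≤ R
    · have := hball p hp
      have := min_le_left ε 1
      have : 0 ≤ ε * ‖p‖ := by positivity
      linarith
    push Not at hp
    have hpp : 0 < ‖p‖ := hRpos.trans hp
    set s : ℝ := R / ‖p‖ with hs
    have hs0 : 0 < s := by positivity
    have hs1 : s < 1 := by rw [hs, div_lt_one hpp]; exact hp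
    have hcv := (hfk k).2 (Set.mem_univ 0) (Set.mem_univ p) (by linarith : 0 ≤ 1 - s) hs0.le
      (by ring)
    have hq : ‖s • p‖ = R := by
      rw [norm_smul, Real.norm_of_nonneg hs0.le, hs]; field_simp
    have hb := hball (s • p) hq.le
    simp only [smul_zero, zero_add, smul_eq_mul] at hcv
    rw [real_inner_smul_right] at hb
    have hsp : s * ‖p‖ = R := by rw [hs]; field_simp
    have hεR : ε * R = M + 1 := by rw [hR]; field_simp
    have := min_le_right ε 1
    by_contra hcon
    push Not at hcon
    have e1 := mul_lt_mul_of_pos_left hcon hs0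
    have e2 : (1 - s) * fk k 0 ≤ (1 - s) * (M - c) :=
      mul_le_mul_of_nonneg_left (by linarith) (by linarith)
    have e3 : s * (ε * ‖p‖) = M + 1 := by rw [← hεR, ← hsp]; ring
    nlinarith [mul_pos hs0 hε, mul_pos hs0 hMpos]
  obtain ⟨y, d, hy⟩ := sandwich (hfk k) (concave_cone x (c + ε) ε hε.le) hle
  refine ⟨y, ?_, ?_⟩
  · by_contra hcon
    push Not at hcon
    rw [norm_sub_rev] at hcon
    set w := x - y with hw
    have hwp : 0 < ‖w‖ := hε.trans hcon
    have hprod : 0 < ‖w‖ * (‖w‖ - ε) := mul_pos hwp (by linarith)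
    set t : ℝ := (|c + ε - d| + 1) / (‖w‖ * (‖w‖ - ε)) with ht
    have ht0 : 0 < t := by positivity
    have h1 := (hy (t • w)).1
    have e : inner ℝ x (t • w) - inner ℝ y (t • w) = t * ‖w‖ ^ 2 := by
      rw [← inner_sub_left, ← hw, real_inner_smul_right, real_inner_self_eq_norm_sq]
    simp only [norm_smul, Real.norm_of_nonneg ht0.le] at h1
    have e2 : t * (‖w‖ * (‖w‖ - ε)) = |c + ε - d| + 1 := by rw [ht]; field_simp
    have := le_abs_self (c + ε - d)
    nlinarith
  · rw [cj_le_iff]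
    intro p
    have h1 := (hy p).2
    have h2 := (hy 0).1
    simp only [inner_zero_right, norm_zero] at h2
    linarith

lemma diag_lemma (P : ℕ → ℕ → Prop) (h : ∀ m, ∀ᶠ k in atTop, P m k) :
    ∃ m : ℕ → ℕ, Tendsto m atTop atTop ∧ ∀ᶠ k in atTop, P (m k) k := by
  classical
  have h' : ∀ m, ∃ N, ∀ k ≥ N, P m k := fun m => eventually_atTop.1 (h m)
  choose N hN using h'
  refine ⟨fun k => Nat.findGreatest (fun m => N m ≤ k) k, ?_, ?_⟩
  · rw [tendsto_atTop]
    intro b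
    filter_upwards [eventually_ge_atTop (max b (N b))] with k hk
    exact Nat.le_findGreatest ((le_max_left _ _).trans hk) ((le_max_right _ _).trans hk)
  · filter_upwards [eventually_ge_atTop (N 0)] with k hk
    apply hN
    exact Nat.findGreatest_spec (P := fun m => N m ≤ k) (Nat.zero_le k) hk

lemma LUC.tendsto {n : ℕ} {fk : ℕ → Vn n → ℝ} {f : Vn n → ℝ} (h : LUC fk f) (p : Vn n) :
    Tendsto (fun k => fk k p) atTop (𝓝 (f p)) := by
  rw [Metric.tendsto_nhds]
  intro ε hε
  filter_upwards [h ‖p‖ (ε / 2) (by positivity)] with k hk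
  rw [Real.dist_eq]
  linarith [hk p le_rfl]

lemma epi_of_LUC {n : ℕ} {fk : ℕ → Vn n → ℝ} {f : Vn n → ℝ}
    (hfk : ∀ k, ConvexOn ℝ Set.univ (fk k)) (h : LUC fk f) :
    EpiConverges (fun k => cj (fk k)) (cj f) := by
  intro x
  have hinf : ∀ xk : ℕ → Vn n, Tendsto xk atTop (𝓝 x) →
      cj f x ≤ liminf (fun k => cj (fk k) (xk k)) atTop := by
    intro xk hxk
    refine iSup_le fun p => ?_
    have ht : Tendsto (fun k => ((inner ℝ (xk k) p - fk k p : ℝ) : EReal)) atTop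
        (𝓝 ((inner ℝ x p - f p : ℝ) : EReal)) := by
      refine (continuous_coe_real_ereal.tendsto _).comp ?_
      exact (hxk.inner tendsto_const_nhds).sub (h.tendsto p)
    rw [← ht.liminf_eq]
    exact liminf_le_liminf (Eventually.of_forall fun k => le_cj (fk k) (xk k) p)
  refine ⟨hinf, ?_⟩
  by_cases htop : cj f x = ⊤
  · refine ⟨fun _ => x, tendsto_const_nhds, ?_⟩
    refine tendsto_of_le_liminf_of_limsup_le (hinf _ tendsto_const_nhds) ?_
    rw [htop]
    exact le_top
  · obtain ⟨c, hc⟩ := ereal_cases_real (cj_ne_bot f x) htop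
    obtain ⟨m, hm, hP⟩ := diag_lemma
      (fun m k => ∃ y : Vn n, ‖y - x‖ ≤ 1 / ((m : ℝ) + 1) ∧
        cj (fk k) y ≤ ((c + 1 / ((m : ℝ) + 1) : ℝ) : EReal))
      (fun m => recovery hfk h hc.le (by positivity))
    have hP' : ∀ k, ∃ y : Vn n, (∃ y : Vn n, ‖y - x‖ ≤ 1 / ((m k : ℝ) + 1) ∧
        cj (fk k) y ≤ ((c + 1 / ((m k : ℝ) + 1) : ℝ) : EReal)) → ‖y - x‖ ≤ 1 / ((m k : ℝ) + 1) ∧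
        cj (fk k) y ≤ ((c + 1 / ((m k : ℝ) + 1) : ℝ) : EReal) := by
      intro k
      by_cases hk : ∃ y : Vn n, ‖y - x‖ ≤ 1 / ((m k : ℝ) + 1) ∧
        cj (fk k) y ≤ ((c + 1 / ((m k : ℝ) + 1) : ℝ) : EReal)
      · obtain ⟨y, hy⟩ := hk
        exact ⟨y, fun _ => hy⟩
      · exact ⟨0, fun h => absurd h hk⟩
    choose y hy using hP'
    have hz : Tendsto (fun k => 1 / ((m k : ℝ) + 1)) atTop (𝓝 0) :=
      (tendsto_one_div_add_atTop_nhds_zero_nat (𝕜 := ℝ)).comp hm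
    have hyx : Tendsto y atTop (𝓝 x) := by
      rw [tendsto_iff_norm_sub_tendsto_zero]
      refine squeeze_zero' (Eventually.of_forall fun k => norm_nonneg _) ?_ hz
      filter_upwards [hP] with k hk
      exact (hy k hk).1
    refine ⟨y, hyx, ?_⟩
    refine tendsto_of_le_liminf_of_limsup_le (hinf _ hyx) ?_
    have ht : Tendsto (fun k => ((c + 1 / ((m k : ℝ) + 1) : ℝ) : EReal)) atTop
        (𝓝 (c : EReal)) := by
      refine (continuous_coe_real_ereal.tendsto _).comp ?_
      simpa using tendsto_const_nhds.add hz
    rw [hc, ← ht.limsup_eq]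
    refine limsup_le_limsup ?_
    filter_upwards [hP] with k hk
    exact (hy k hk).2

section
variable {n : ℕ} {Y : (Vn n → ℝ) → ℝ}
/-- The dual properties of the functional. -/
structure GoodZ {n : ℕ} (Y : (Vn n → ℝ) → ℝ) : Prop where
  mid : ∀ g, ConvexOn ℝ Set.univ g → ∀ (a : Vn n) (b : ℝ),
    Y (fun p => g p + 2 * max (inner ℝ a p + b) 0) + Y g
      = 2 * Y (fun p => g p + max (inner ℝ a p + b) 0)
  aff : ∀ g, ConvexOn ℝ Set.univ g → ∀ (a : Vn n) (b : ℝ),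
    Y (fun p => g p + (inner ℝ a p + b)) = Y g
  cont : ∀ (fk : ℕ → Vn n → ℝ) (f : Vn n → ℝ), (∀ k, ConvexOn ℝ Set.univ (fk k)) →
    ConvexOn ℝ Set.univ f → LUC fk f → Tendsto (fun k => Y (fk k)) atTop (𝓝 (Y f))
  hom : ∀ g, ConvexOn ℝ Set.univ g → ∀ l : ℝ, 0 < l → Y (fun p => l * g p) = l * Y g

/-- Functions that split off additively. -/
def KK {n : ℕ} (Y : (Vn n → ℝ) → ℝ) (B : Vn n → ℝ) : Prop :=
  ConvexOn ℝ Set.univ B ∧ ∀ f, ConvexOn ℝ Set.univ f → Y (fun p => f p + B p) = Y f + Y B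

lemma cvx_add {n : ℕ} {f g : Vn n → ℝ} (hf : ConvexOn ℝ Set.univ f)
    (hg : ConvexOn ℝ Set.univ g) : ConvexOn ℝ Set.univ (fun p => f p + g p) := hf.add hg

lemma cvx_smul {n : ℕ} {f : Vn n → ℝ} (hf : ConvexOn ℝ Set.univ f) {c : ℝ} (hc : 0 ≤ c) :
    ConvexOn ℝ Set.univ (fun p => c * f p) := hf.smul hc

lemma cvx_aff {n : ℕ} (a : Vn n) (b : ℝ) :
    ConvexOn ℝ Set.univ (fun p : Vn n => inner ℝ a p + b) := by
  refine ⟨convex_univ, fun x _ y _ s t _ _ hst => le_of_eq ?_⟩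
  simp only [inner_add_right, real_inner_smul_right, smul_eq_mul]
  linear_combination (-b) * hst

lemma cvx_ridge {n : ℕ} (a : Vn n) (b : ℝ) :
    ConvexOn ℝ Set.univ (fun p : Vn n => max (inner ℝ a p + b) 0) :=
  (cvx_aff a b).sup (convexOn_const 0 convex_univ)

lemma cvx_zero {n : ℕ} : ConvexOn ℝ Set.univ (fun _ : Vn n => (0 : ℝ)) :=
  convexOn_const 0 convex_univ


lemma GoodZ.zero (hY : GoodZ Y) : Y (fun _ => 0) = 0 := by
  have := hY.hom _ cvx_zero 2 (by norm_num)
  simp only [mul_zero] at this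
  linarith

lemma GoodZ.K_aff (hY : GoodZ Y) (a : Vn n) (b : ℝ) : KK Y (fun p => inner ℝ a p + b) := by
  refine ⟨cvx_aff a b, fun f hf => ?_⟩
  rw [hY.aff f hf a b]
  have := hY.aff _ cvx_zero a b
  rw [hY.zero] at this
  simp only [zero_add] at this
  rw [this, add_zero]

lemma GoodZ.K_add (_hY : GoodZ Y) {A B : Vn n → ℝ} (hA : KK Y A) (hB : KK Y B) :
    KK Y (fun p => A p + B p) := by
  refine ⟨cvx_add hA.1 hB.1, fun f hf => ?_⟩
  have h1 := hB.2 _ (cvx_add hf hA.1)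
  have h2 := hA.2 f hf
  have h3 := hB.2 _ hA.1
  have e : (fun p => f p + (A p + B p)) = fun p => (f p + A p) + B p := by
    funext p; ring
  rw [e, h1, h2, h3]; ring

lemma GoodZ.K_smul (hY : GoodZ Y) {A : Vn n → ℝ} (hA : KK Y A) {c : ℝ} (hc : 0 ≤ c) :
    KK Y (fun p => c * A p) := by
  refine ⟨cvx_smul hA.1 hc, fun f hf => ?_⟩
  rcases hc.eq_or_lt with rfl | hc
  · simp [hY.zero]
  · have h1 := hA.2 _ (cvx_smul hf (inv_pos.2 hc).le)
    have h2 := hY.hom _ (cvx_add (cvx_smul hf (inv_pos.2 hc).le) hA.1) c hc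
    have h3 := hY.hom _ hA.1 c hc
    have h4 := hY.hom _ hf c⁻¹ (inv_pos.2 hc)
    have e : (fun p => c * (c⁻¹ * f p + A p)) = fun p => f p + c * A p := by
      funext p; field_simp
    rw [e] at h2
    rw [h2, h1, h3, h4]
    field_simp

lemma GoodZ.K_sat (_hY : GoodZ Y) {f B : Vn n → ℝ} (hf : ConvexOn ℝ Set.univ f)
    (hB : KK Y B) (hfB : KK Y (fun p => f p + B p)) : KK Y f := by
  refine ⟨hf, fun g hg => ?_⟩
  have h1 := hfB.2 g hg
  have h2 := hB.2 _ (cvx_add hg hf)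
  have h3 := hB.2 f hf
  have e : (fun p => g p + (f p + B p)) = fun p => (g p + f p) + B p := by
    funext p; ring
  rw [e] at h1
  linarith

lemma GoodZ.K_lim (hY : GoodZ Y) {f : Vn n → ℝ} (hf : ConvexOn ℝ Set.univ f)
    (h : ∀ R ε : ℝ, 0 < ε → ∃ B, KK Y B ∧ ∀ p, ‖p‖ ≤ R → |B p - f p| ≤ ε) : KK Y f := by
  have h' : ∀ k : ℕ, ∃ B, KK Y B ∧ ∀ p, ‖p‖ ≤ (k : ℝ) → |B p - f p| ≤ 1 / ((k : ℝ) + 1) :=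
    fun k => h k _ (by positivity)
  choose B hB hBf using h'
  have hL : ∀ g : Vn n → ℝ, LUC (fun k p => g p + B k p) (fun p => g p + f p) := by
    intro g R ε hε
    have hz := (tendsto_one_div_add_atTop_nhds_zero_nat (𝕜 := ℝ)).eventually (gt_mem_nhds hε)
    filter_upwards [hz, eventually_ge_atTop ⌈R⌉₊] with k hk hkR p hp
    have hkR' : R ≤ (k : ℝ) := (Nat.le_ceil R).trans (by exact_mod_cast hkR)
    have := hBf k p (hp.trans hkR')
    have e : g p + B k p - (g p + f p) = B k p - f p := by ring
    rw [e]
    linarith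
  refine ⟨hf, fun g hg => ?_⟩
  have h1 := hY.cont _ _ (fun k => cvx_add hg (hB k).1) (cvx_add hg hf) (hL g)
  have h2 := hY.cont _ _ (fun k => cvx_add cvx_zero (hB k).1) (cvx_add cvx_zero hf)
    (hL fun _ => 0)
  simp only [zero_add] at h2
  have h3 : Tendsto (fun k => Y (fun p => g p + B k p)) atTop (𝓝 (Y g + Y f)) := by
    have : (fun k => Y (fun p => g p + B k p)) = fun k => Y g + Y (B k) := by
      funext k; exact (hB k).2 g hg
    rw [this]
    exact tendsto_const_nhds.add h2
  exact tendsto_nhds_unique h1 h3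

lemma GoodZ.K_ridge (hY : GoodZ Y) (a : Vn n) (b : ℝ) :
    KK Y (fun p => max (inner ℝ a p + b) 0) := by
  refine ⟨cvx_ridge a b, fun f hf => ?_⟩
  set φ : Vn n → ℝ := fun p => max (inner ℝ a p + b) 0 with hφ
  have hφc : ConvexOn ℝ Set.univ φ := cvx_ridge a b
  set s : ℕ → ℝ := fun k => Y (fun p => f p + (k : ℝ) * φ p) with hs
  have hstep : ∀ k, s (k + 2) + s k = 2 * s (k + 1) := by
    intro k
    have h1 := hY.mid _ (cvx_add hf (cvx_smul hφc (Nat.cast_nonneg k))) a b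
    have e1 : (fun p => f p + (k : ℝ) * φ p + 2 * max (inner ℝ a p + b) 0)
        = fun p => f p + ((k + 2 : ℕ) : ℝ) * φ p := by
      funext p; simp only [hφ]; push_cast; ring
    have e2 : (fun p => f p + (k : ℝ) * φ p + max (inner ℝ a p + b) 0)
        = fun p => f p + ((k + 1 : ℕ) : ℝ) * φ p := by
      funext p; simp only [hφ]; push_cast; ring
    rw [e1, e2] at h1
    exact h1
  have hlin : ∀ k : ℕ, s k = s 0 + k * (s 1 - s 0) ∧
      s (k + 1) = s 0 + (k + 1) * (s 1 - s 0) := by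
    intro k
    induction k with
    | zero => constructor <;> simp
    | succ k ih =>
      refine ⟨by push_cast; exact ih.2, ?_⟩
      have := hstep k
      push_cast
      have e : s (k + 1 + 1) = s (k + 2) := rfl
      rw [e]
      linarith [ih.1, ih.2]
  have hs0 : s 0 = Y f := by simp [hs]
  have hs1 : s 1 = Y (fun p => f p + φ p) := by simp [hs]
  have hL : LUC (fun (k : ℕ) p => (1 / ((k : ℝ) + 1)) * f p + φ p) φ := by
    intro R ε hε
    obtain ⟨C, hC0, hC⟩ := cvx_bdd hf R
    have hz : Tendsto (fun k : ℕ => (1 / ((k : ℝ) + 1)) * C) atTop (𝓝 (0 * C)) :=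
      (tendsto_one_div_add_atTop_nhds_zero_nat (𝕜 := ℝ)).mul_const C
    rw [zero_mul] at hz
    filter_upwards [hz.eventually (gt_mem_nhds hε)] with k hk p hp
    rw [add_sub_cancel_right, abs_mul, abs_of_nonneg (by positivity : (0:ℝ) ≤ 1 / ((k : ℝ) + 1))]
    exact (mul_le_mul_of_nonneg_left (hC p hp) (by positivity)).trans hk.le
  have h1 := hY.cont _ _
    (fun k => cvx_add (cvx_smul hf (by positivity : (0:ℝ) ≤ 1 / ((k : ℝ) + 1))) hφc) hφc hL
  have h2 : (fun k : ℕ => Y (fun p => (1 / ((k : ℝ) + 1)) * f p + φ p))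
      = fun k : ℕ => (1 / ((k : ℝ) + 1)) * s 0 + (s 1 - s 0) := by
    funext k
    have e : (fun p => (1 / ((k : ℝ) + 1)) * f p + φ p)
        = fun p => (1 / ((k : ℝ) + 1)) * (f p + ((k + 1 : ℕ) : ℝ) * φ p) := by
      funext p; push_cast; field_simp
    rw [e, hY.hom _ (cvx_add hf (cvx_smul hφc (Nat.cast_nonneg _))) _ (by positivity)]
    change (1 / ((k : ℝ) + 1)) * s (k + 1) = _
    rw [(hlin k).2]
    field_simp
  rw [h2] at h1
  have h3 : Tendsto (fun k : ℕ => (1 / ((k : ℝ) + 1)) * s 0 + (s 1 - s 0)) atTop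
      (𝓝 (0 * s 0 + (s 1 - s 0))) :=
    ((tendsto_one_div_add_atTop_nhds_zero_nat (𝕜 := ℝ)).mul_const _).add_const _
  have h4 := tendsto_nhds_unique h1 h3
  rw [hs0, hs1] at h4
  linarith

lemma GoodZ.K_integral (hY : GoodZ Y) {Ω : Type*} [TopologicalSpace Ω]
    [SecondCountableTopology Ω] [MeasurableSpace Ω] [OpensMeasurableSpace Ω] (μ : Measure Ω)
    (h : Ω → Vn n → ℝ) (hc : Continuous (Function.uncurry h)) (hK : ∀ ω, KK Y (h ω))
    (hb : ∀ R : ℝ, ∃ G : Ω → ℝ, Integrable G μ ∧ ∀ ω p, ‖p‖ ≤ R → |h ω p| ≤ G ω) :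
    KK Y (fun p => ∫ ω, h ω p ∂μ) := by
  have hIntg : ∀ p, Integrable (fun ω => h ω p) μ := by
    intro p
    obtain ⟨G, hG, hGb⟩ := hb ‖p‖
    refine hG.mono' ?_ (Eventually.of_forall fun ω => hGb ω p le_rfl)
    exact (hc.comp (by fun_prop : Continuous fun ω => (ω, p))).aestronglyMeasurable
  refine hY.K_lim ?_ ?_
  · refine ⟨convex_univ, fun x _ y _ s t hs ht hst => ?_⟩
    simp only [smul_eq_mul]
    rw [← integral_const_mul, ← integral_const_mul,
      ← integral_add ((hIntg x).const_mul s) ((hIntg y).const_mul t)]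
    refine integral_mono (hIntg _) (((hIntg x).const_mul s).add ((hIntg y).const_mul t)) fun ω => ?_
    exact (hK ω).1.2 (Set.mem_univ x) (Set.mem_univ y) hs ht hst
  · intro R ε hε
    obtain ⟨G, hG, hGb⟩ := hb R
    let X := Metric.closedBall (0 : Vn n) R
    have : CompactSpace X := isCompact_iff_compactSpace.1 (isCompact_closedBall _ _)
    let H : C(Ω, C(X, ℝ)) := ContinuousMap.curry
      ⟨fun q : Ω × X => h q.1 q.2.1, hc.comp (by fun_prop : Continuous fun q : Ω × X => (q.1, q.2.1))⟩
    have hH : ∀ ω (x : X), H ω x = h ω x.1 := fun ω x => rfl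
    have hHi : Integrable H μ := by
      refine hG.abs.mono' H.continuous.aestronglyMeasurable (Eventually.of_forall fun ω => ?_)
      refine (ContinuousMap.norm_le _ (abs_nonneg _)).2 fun x => ?_
      rw [hH, Real.norm_eq_abs]
      exact (hGb ω x.1 (mem_closedBall_zero_iff.1 x.2)).trans (le_abs_self _)
    let S : Set C(X, ℝ) := {b | ∃ B, KK Y B ∧ ∀ x : X, b x = B x.1}
    have hSadd : ∀ b₁ ∈ S, ∀ b₂ ∈ S, b₁ + b₂ ∈ S := by
      rintro b₁ ⟨B₁, h₁, e₁⟩ b₂ ⟨B₂, h₂, e₂⟩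
      exact ⟨_, hY.K_add h₁ h₂, fun x => by simp [e₁, e₂]⟩
    have hSsmul : ∀ b ∈ S, ∀ c : ℝ, 0 ≤ c → c • b ∈ S := by
      rintro b ⟨B, h₁, e₁⟩ c hc
      exact ⟨_, hY.K_smul h₁ hc, fun x => by simp [e₁]⟩
    have hSconv : Convex ℝ S := by
      intro b₁ h₁ b₂ h₂ s t hs ht _
      exact hSadd _ (hSsmul _ h₁ s hs) _ (hSsmul _ h₂ t ht)
    have hHS : ∀ ω, H ω ∈ S := fun ω => ⟨h ω, hK ω, hH ω⟩
    have hmem : (∫ ω, H ω ∂μ) ∈ closure S := by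
      by_contra hcon
      obtain ⟨φ, u, hφ, hu⟩ := geometric_hahn_banach_closed_point hSconv.closure isClosed_closure hcon
      have hS0 : (0 : C(X, ℝ)) ∈ S := by
        refine ⟨_, hY.K_aff 0 0, fun x => by simp⟩
      have hu0 : 0 < u := by simpa using hφ 0 (subset_closure hS0)
      have hneg : ∀ b ∈ S, φ b ≤ 0 := by
        intro b hb
        by_contra hpos
        push Not at hpos
        have := hφ _ (subset_closure (hSsmul b hb (u / φ b) (by positivity)))
        rw [map_smul, smul_eq_mul, div_mul_cancel₀ _ hpos.ne'] at this
        exact lt_irrefl _ this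
      rw [← φ.integral_comp_comm hHi] at hu
      have := integral_nonpos (μ := μ) (f := fun ω => φ (H ω)) fun ω => hneg _ (hHS ω)
      linarith
    obtain ⟨b, ⟨B, hBK, hBe⟩, hd⟩ := Metric.mem_closure_iff.1 hmem ε hε
    refine ⟨B, hBK, fun p hp => ?_⟩
    let x : X := ⟨p, by simpa [X] using hp⟩
    have h1 : (∫ ω, H ω ∂μ) x = ∫ ω, h ω p ∂μ := by
      have := (ContinuousMap.evalCLM ℝ x).integral_comp_comm hHi
      exact this.symm
    have h2 := ContinuousMap.dist_apply_le_dist (f := ∫ ω, H ω ∂μ) (g := b) x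
    rw [h1, hBe x, Real.dist_eq, abs_sub_comm] at h2
    exact h2.trans hd.le
end

section
variable {n : ℕ} {Y : (Vn n → ℝ) → ℝ}
lemma taylor_ridge {φ φ' φ'' : ℝ → ℝ} (h1 : ∀ s, HasDerivAt φ (φ' s) s)
    (h2 : ∀ s, HasDerivAt φ' (φ'' s) s) (hc : Continuous φ'') {T s : ℝ} (hs : |s| ≤ T) :
    φ s = φ (-T) + φ' (-T) * (s + T) + ∫ t in Set.Ioc (-T) T, max (s - t) 0 * φ'' t := by
  have hT : -T ≤ s := (abs_le.1 hs).1
  have hT' : s ≤ T := (abs_le.1 hs).2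
  have hcm : Continuous fun t => max (s - t) 0 * φ'' t := by fun_prop
  rw [← intervalIntegral.integral_of_le (hT.trans hT'),
    ← intervalIntegral.integral_add_adjacent_intervals (b := s)
      (hcm.intervalIntegrable _ _) (hcm.intervalIntegrable _ _)]
  have e2 : ∫ t in s..T, max (s - t) 0 * φ'' t = 0 := by
    rw [intervalIntegral.integral_congr (g := fun _ => 0)]
    · simp
    · intro t ht
      rw [Set.uIcc_of_le hT'] at ht
      simp only
      rw [max_eq_right (by linarith [ht.1]), zero_mul]
  have e1 : ∫ t in (-T)..s, max (s - t) 0 * φ'' t = ∫ t in (-T)..s, (s - t) * φ'' t := by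
    apply intervalIntegral.integral_congr
    intro t ht
    rw [Set.uIcc_of_le hT] at ht
    simp only
    rw [max_eq_left (by linarith [ht.2])]
  have e3 := intervalIntegral.integral_eq_sub_of_hasDerivAt (a := -T) (b := s)
    (f := fun t => (s - t) * φ' t + φ t) (f' := fun t => (s - t) * φ'' t)
    (fun t _ => by
      have := (((hasDerivAt_id t).const_sub s).mul (h2 t)).add (h1 t)
      refine this.congr_deriv ?_
      simp only [id]
      ring) ((by fun_prop : Continuous fun t => (s - t) * φ'' t).intervalIntegrable _ _)
  rw [e1, e2, e3]
  ring

lemma GoodZ.K_phi (hY : GoodZ Y) {φ φ' φ'' : ℝ → ℝ} (h1 : ∀ s, HasDerivAt φ (φ' s) s)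
    (h2 : ∀ s, HasDerivAt φ' (φ'' s) s) (hc : Continuous φ'') (h0 : ∀ s, 0 ≤ φ'' s)
    (a : Vn n) (b : ℝ) : KK Y (fun p => φ (inner ℝ a p + b)) := by
  have hφ : ConvexOn ℝ Set.univ φ := by
    apply convexOn_univ_of_deriv2_nonneg (fun s => (h1 s).differentiableAt)
    · rw [show deriv φ = φ' from funext fun s => (h1 s).deriv]
      exact fun s => (h2 s).differentiableAt
    · intro s
      simp only [Function.iterate_succ, Function.iterate_zero, Function.comp, id]
      rw [show deriv φ = φ' from funext fun s => (h1 s).deriv, (h2 s).deriv]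
      exact h0 s
  refine hY.K_lim ?_ ?_
  · refine ⟨convex_univ, fun x _ y _ s t hs ht hst => ?_⟩
    have := hφ.2 (Set.mem_univ (inner ℝ a x + b)) (Set.mem_univ (inner ℝ a y + b)) hs ht hst
    refine le_trans (le_of_eq ?_) this
    refine congrArg φ ?_
    simp only [inner_add_right, real_inner_smul_right, smul_eq_mul]
    linear_combination (-b) * hst
  · intro R ε hε
    set T : ℝ := ‖a‖ * R + |b| with hT
    refine ⟨fun p => (inner ℝ (φ' (-T) • a) p + (φ (-T) + φ' (-T) * (b + T))) +
      ∫ t in Set.Ioc (-T) T, φ'' t * max (inner ℝ a p + (b - t)) 0, ?_, ?_⟩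
    · refine hY.K_add (hY.K_aff _ _) (hY.K_integral _
        (fun t p => φ'' t * max (inner ℝ a p + (b - t)) 0) ?_ ?_ ?_)
      · change Continuous fun q : ℝ × Vn n => φ'' q.1 * max (inner ℝ a q.2 + (b - q.1)) 0
        fun_prop
      · exact fun t => hY.K_smul (hY.K_ridge a (b - t)) (h0 t)
      · intro r
        refine ⟨fun t => φ'' t * (‖a‖ * r + |b| + |t|), ?_, ?_⟩
        · exact ((by fun_prop : Continuous fun t => φ'' t * (‖a‖ * r + |b| + |t|)).integrableOn_Icc
            (a := -T) (b := T)).mono_set Set.Ioc_subset_Icc_self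
        · intro t p hp
          have i1 : |inner ℝ a p| ≤ ‖a‖ * r :=
            (abs_real_inner_le_norm a p).trans (mul_le_mul_of_nonneg_left hp (norm_nonneg _))
          rw [abs_mul, abs_of_nonneg (h0 t)]
          refine mul_le_mul_of_nonneg_left ?_ (h0 t)
          rw [abs_of_nonneg (le_max_right _ _)]
          refine max_le ?_ ?_
          · linarith [le_abs_self (inner ℝ a p), le_abs_self b, neg_abs_le t]
          · linarith [abs_nonneg (inner ℝ a p), abs_nonneg b, abs_nonneg t]
    · intro p hp
      have i1 : |inner ℝ a p| ≤ ‖a‖ * R :=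
        (abs_real_inner_le_norm a p).trans (mul_le_mul_of_nonneg_left hp (norm_nonneg _))
      have i2 : |inner ℝ a p + b| ≤ T := (abs_add_le _ _).trans (by linarith)
      rw [taylor_ridge h1 h2 hc i2]
      have e : ∀ t, φ'' t * max (inner ℝ a p + (b - t)) 0
          = max (inner ℝ a p + b - t) 0 * φ'' t := fun t => by
        rw [mul_comm, add_sub_assoc]
      simp only [e, real_inner_smul_left]
      rw [show ∀ I : ℝ, φ' (-T) * inner ℝ a p + (φ (-T) + φ' (-T) * (b + T)) + I
        - (φ (-T) + φ' (-T) * (inner ℝ a p + b + T) + I) = 0 from fun I => by ring]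
      simpa using hε.le

lemma GoodZ.K_exp (hY : GoodZ Y) (a : Vn n) : KK Y (fun p => Real.exp (inner ℝ a p)) := by
  have := hY.K_phi (φ := Real.exp) Real.hasDerivAt_exp Real.hasDerivAt_exp Real.continuous_exp
    (fun s => (Real.exp_pos s).le) a 0
  simpa using this

lemma GoodZ.K_sq (hY : GoodZ Y) (a : Vn n) (b : ℝ) :
    KK Y (fun p => (inner ℝ a p + b) ^ 2 / 2) := by
  refine hY.K_phi (φ := fun s => s ^ 2 / 2) (φ' := fun s => s) (φ'' := fun _ => 1)
    (fun s => ?_) (fun s => hasDerivAt_id s) continuous_const (fun _ => zero_le_one) a b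
  have := ((hasDerivAt_id s).pow 2).div_const 2
  refine this.congr_deriv ?_
  simp

lemma GoodZ.K_cos (hY : GoodZ Y) (a : Vn n) (b : ℝ) :
    KK Y (fun p => Real.cos (inner ℝ a p + b) + (inner ℝ a p + b) ^ 2 / 2) := by
  refine hY.K_phi (φ := fun s => Real.cos s + s ^ 2 / 2) (φ' := fun s => - Real.sin s + s)
    (φ'' := fun s => - Real.cos s + 1)
    (fun s => ?_) (fun s => ?_) (by fun_prop) (fun s => by linarith [Real.cos_le_one s]) a b
  · have := (Real.hasDerivAt_cos s).add (((hasDerivAt_id s).pow 2).div_const 2)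
    refine this.congr_deriv ?_
    simp
  · exact (Real.hasDerivAt_sin s).neg.add (hasDerivAt_id s)
end

section
variable {n : ℕ} {Y : (Vn n → ℝ) → ℝ}
lemma gauss_int {c : ℝ} (hc : 0 < c) : Integrable (fun ξ : Vn n => Real.exp (-c * ‖ξ‖ ^ 2)) := by
  have := (GaussianFourier.integrable_cexp_neg_mul_sq_norm_add (b := (c : ℂ)) (by simpa using hc) 0 (0 : Vn n)).norm
  refine this.congr (Eventually.of_forall fun ξ => ?_)
  simp only [Complex.norm_exp]
  congr 1
  simp [← Complex.ofReal_pow]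

lemma gauss_pos {c : ℝ} (hc : 0 < c) : 0 < ∫ ξ : Vn n, Real.exp (-c * ‖ξ‖ ^ 2) := by
  rw [GaussianFourier.integral_rexp_neg_mul_sq_norm hc]
  positivity

lemma sq_mul_exp_le {c : ℝ} (hc : 0 < c) (s : ℝ) :
    s ^ 2 * Real.exp (-c * s ^ 2) ≤ (2 / c) * Real.exp (-(c / 2) * s ^ 2) := by
  have h1 := Real.add_one_le_exp ((c / 2) * s ^ 2)
  have h2 : Real.exp (-(c / 2) * s ^ 2) = Real.exp ((c / 2) * s ^ 2) * Real.exp (-c * s ^ 2) := by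
    rw [← Real.exp_add]; congr 1; ring
  rw [h2, ← mul_assoc]
  refine mul_le_mul_of_nonneg_right ?_ (Real.exp_pos _).le
  have h3 : (c / 2) * s ^ 2 ≤ Real.exp ((c / 2) * s ^ 2) := by linarith
  calc s ^ 2 = (2 / c) * ((c / 2) * s ^ 2) := by field_simp
    _ ≤ _ := mul_le_mul_of_nonneg_left h3 (by positivity)

lemma gauss_sq_int {c : ℝ} (hc : 0 < c) :
    Integrable (fun ξ : Vn n => ‖ξ‖ ^ 2 * Real.exp (-c * ‖ξ‖ ^ 2)) := by
  refine ((gauss_int (n := n) (half_pos hc)).const_mul (2 / c)).mono'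
    (by fun_prop : Continuous fun ξ : Vn n =>
      ‖ξ‖ ^ 2 * Real.exp (-c * ‖ξ‖ ^ 2)).aestronglyMeasurable
    (Eventually.of_forall fun ξ => ?_)
  rw [Real.norm_of_nonneg (by positivity)]
  exact sq_mul_exp_le hc _

lemma gauss_sq_le {c : ℝ} (hc : 0 < c) :
    ∫ ξ : Vn n, ‖ξ‖ ^ 2 * Real.exp (-c * ‖ξ‖ ^ 2) ≤
      (2 / c) * (2 ^ ((n : ℝ) / 2) * ∫ ξ : Vn n, Real.exp (-c * ‖ξ‖ ^ 2)) := by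
  have h1 : ∫ ξ : Vn n, ‖ξ‖ ^ 2 * Real.exp (-c * ‖ξ‖ ^ 2) ≤
      ∫ ξ : Vn n, (2 / c) * Real.exp (-(c / 2) * ‖ξ‖ ^ 2) :=
    integral_mono (gauss_sq_int hc) ((gauss_int (half_pos hc)).const_mul _)
      fun ξ => sq_mul_exp_le hc _
  refine h1.trans (le_of_eq ?_)
  rw [integral_const_mul, GaussianFourier.integral_rexp_neg_mul_sq_norm hc,
    GaussianFourier.integral_rexp_neg_mul_sq_norm (half_pos hc)]
  simp only [finrank_euclideanSpace, Fintype.card_fin]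
  rw [← Real.mul_rpow (by norm_num) (by positivity)]
  congr 2
  field_simp

lemma gauss_exp_int {c : ℝ} (hc : 0 < c) (w : Vn n) :
    ∫ ξ : Vn n, Real.exp (-c * ‖ξ‖ ^ 2) * Real.exp (inner ℝ ξ w) =
      (∫ ξ : Vn n, Real.exp (-c * ‖ξ‖ ^ 2)) * Real.exp (‖w‖ ^ 2 / (4 * c)) := by
  have h := GaussianFourier.integral_cexp_neg_mul_sq_norm_add (b := (c : ℂ)) (by simpa using hc) 1 w
  have h' := GaussianFourier.integral_cexp_neg_mul_sq_norm (V := Vn n) (b := (c : ℂ)) (by simpa using hc)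
  rw [← h'] at h
  have e1 : ∀ ξ : Vn n, Complex.exp (-(c : ℂ) * ‖ξ‖ ^ 2 + 1 * (inner ℝ w ξ : ℝ))
      = ((Real.exp (-c * ‖ξ‖ ^ 2) * Real.exp (inner ℝ ξ w) : ℝ) : ℂ) := by
    intro ξ
    rw [← Real.exp_add, real_inner_comm]
    push_cast
    simp
  have e2 : ∀ ξ : Vn n, Complex.exp (-(c : ℂ) * ‖ξ‖ ^ 2)
      = ((Real.exp (-c * ‖ξ‖ ^ 2) : ℝ) : ℂ) := by
    intro ξ
    push_cast
    simp
  have e3 : Complex.exp (1 ^ 2 * ‖w‖ ^ 2 / (4 * (c : ℂ)))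
      = ((Real.exp (‖w‖ ^ 2 / (4 * c)) : ℝ) : ℂ) := by
    push_cast
    simp
  simp only [e1, e2] at h
  rw [e3, integral_complex_ofReal, integral_complex_ofReal] at h
  exact_mod_cast h

lemma gauss_cos_int {c : ℝ} (hc : 0 < c) (w : Vn n) :
    ∫ ξ : Vn n, Real.exp (-c * ‖ξ‖ ^ 2) * Real.cos (inner ℝ ξ w) =
      (∫ ξ : Vn n, Real.exp (-c * ‖ξ‖ ^ 2)) * Real.exp (-(‖w‖ ^ 2 / (4 * c))) := by
  have h := GaussianFourier.integral_cexp_neg_mul_sq_norm_add (b := (c : ℂ)) (by simpa using hc)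
    Complex.I w
  have hi := GaussianFourier.integrable_cexp_neg_mul_sq_norm_add (b := (c : ℂ)) (by simpa using hc)
    Complex.I w
  have h' := GaussianFourier.integral_cexp_neg_mul_sq_norm (V := Vn n) (b := (c : ℂ)) (by simpa using hc)
  rw [← h'] at h
  have e1 : ∀ ξ : Vn n, (Complex.exp (-(c : ℂ) * ‖ξ‖ ^ 2 + Complex.I * (inner ℝ w ξ : ℝ))).re
      = Real.exp (-c * ‖ξ‖ ^ 2) * Real.cos (inner ℝ ξ w) := by
    intro ξ
    rw [Complex.exp_re, real_inner_comm]
    simp [← Complex.ofReal_pow]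
  have e2 : ∀ ξ : Vn n, Complex.exp (-(c : ℂ) * ‖ξ‖ ^ 2)
      = ((Real.exp (-c * ‖ξ‖ ^ 2) : ℝ) : ℂ) := by
    intro ξ
    push_cast
    simp
  have e3 : Complex.exp (Complex.I ^ 2 * ‖w‖ ^ 2 / (4 * (c : ℂ)))
      = ((Real.exp (-(‖w‖ ^ 2 / (4 * c))) : ℝ) : ℂ) := by
    push_cast
    simp [neg_div]
  simp only [e2] at h
  rw [e3, integral_complex_ofReal] at h
  have h2 := congrArg Complex.re h
  have h3 := Complex.reCLM.integral_comp_comm hi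
  simp only [Complex.reCLM_apply] at h3
  rw [← h3] at h2
  simp only [e1] at h2
  rw [h2, ← Complex.ofReal_mul, Complex.ofReal_re]

lemma GoodZ.K_Psi (hY : GoodZ Y) {b : ℝ} (hb : 0 < b) :
    KK Y (fun p => Real.exp (b * ‖p‖ ^ 2)) := by
  set c : ℝ := 1 / (4 * b) with hcdef
  have hc : 0 < c := by positivity
  have hκ := gauss_pos (n := n) hc
  set κ := ∫ ξ : Vn n, Real.exp (-c * ‖ξ‖ ^ 2) with hκd
  have h1 : KK Y (fun p => ∫ ξ : Vn n, Real.exp (-c * ‖ξ‖ ^ 2) * Real.exp (inner ℝ ξ p)) := by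
    refine hY.K_integral volume
      (fun ξ p => Real.exp (-c * ‖ξ‖ ^ 2) * Real.exp (inner ℝ ξ p)) ?_ ?_ ?_
    · change Continuous fun q : Vn n × Vn n =>
        Real.exp (-c * ‖q.1‖ ^ 2) * Real.exp (inner ℝ q.1 q.2)
      fun_prop
    · exact fun ξ => hY.K_smul (hY.K_exp ξ) (Real.exp_pos _).le
    · intro R
      refine ⟨fun ξ => Real.exp (R ^ 2 / (2 * c)) * Real.exp (-(c / 2) * ‖ξ‖ ^ 2),
        (gauss_int (half_pos hc)).const_mul _, fun ξ p hp => ?_⟩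
      rw [abs_of_pos (by positivity), ← Real.exp_add]
      simp only
      rw [← Real.exp_add]
      apply Real.exp_le_exp.2
      have i1 : inner ℝ ξ p ≤ ‖ξ‖ * R :=
        (real_inner_le_norm ξ p).trans (mul_le_mul_of_nonneg_left hp (norm_nonneg _))
      have i2 : ‖ξ‖ * R ≤ R ^ 2 / (2 * c) + (c / 2) * ‖ξ‖ ^ 2 := by
        have : R ^ 2 / (2 * c) + (c / 2) * ‖ξ‖ ^ 2 - ‖ξ‖ * R = (R - c * ‖ξ‖) ^ 2 / (2 * c) := by
          field_simp; ring
        have h0 : 0 ≤ (R - c * ‖ξ‖) ^ 2 / (2 * c) := by positivity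
        linarith
      linarith
  have h2 := hY.K_smul h1 (inv_pos.2 hκ).le
  convert h2 using 2 with p
  rw [gauss_exp_int hc p, ← hκd, ← mul_assoc, inv_mul_cancel₀ hκ.ne', one_mul]
  congr 1
  rw [hcdef]
  field_simp

lemma gauss_conv1 {a0 a1 d0 d1 g C : ℝ} (hg : 0 ≤ g) (hC : 0 ≤ C)
    (h : ∀ t : ℝ, Real.exp (-(a0 + a1 * t + g * t ^ 2)) ≤ C * Real.exp (d0 + d1 * t + g * t ^ 2)) :
    ConvexOn ℝ Set.univ (fun t : ℝ => Real.exp (-(a0 + a1 * t + g * t ^ 2))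
      + C * Real.exp (d0 + d1 * t + g * t ^ 2)) := by
  set F : ℝ → ℝ := fun t => Real.exp (-(a0 + a1 * t + g * t ^ 2))
      + C * Real.exp (d0 + d1 * t + g * t ^ 2) with hF
  set F' : ℝ → ℝ := fun t => Real.exp (-(a0 + a1 * t + g * t ^ 2)) * (-(a1 + 2 * g * t))
      + C * (Real.exp (d0 + d1 * t + g * t ^ 2) * (d1 + 2 * g * t)) with hF'
  have q : ∀ a0 a1 t : ℝ, HasDerivAt (fun t => a0 + a1 * t + g * t ^ 2) (a1 + 2 * g * t) t := by
    intro a0 a1 t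
    have := (((hasDerivAt_id t).const_mul a1).const_add a0).add
      (((hasDerivAt_id t).pow 2).const_mul g)
    refine this.congr_deriv ?_
    simp only [id]
    norm_num
    ring
  have q' : ∀ a1 t : ℝ, HasDerivAt (fun t => a1 + 2 * g * t) (2 * g) t := by
    intro a1 t
    have := ((hasDerivAt_id t).const_mul (2 * g)).const_add a1
    refine this.congr_deriv ?_
    simp
  have h1 : ∀ t, HasDerivAt F (F' t) t := fun t =>
    ((q a0 a1 t).neg.exp).add (((q d0 d1 t).exp).const_mul C)
  have h2 : ∀ t, HasDerivAt F' (Real.exp (-(a0 + a1 * t + g * t ^ 2)) * ((a1 + 2 * g * t) ^ 2 - 2 * g)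
      + C * (Real.exp (d0 + d1 * t + g * t ^ 2) * ((d1 + 2 * g * t) ^ 2 + 2 * g))) t := fun t => by
    have := (((q a0 a1 t).neg.exp).mul (q' a1 t).neg).add
      ((((q d0 d1 t).exp).mul (q' d1 t)).const_mul C)
    refine this.congr_deriv ?_
    simp only [Pi.neg_apply]
    ring
  apply convexOn_univ_of_deriv2_nonneg (fun s => (h1 s).differentiableAt)
  · rw [show deriv F = F' from funext fun s => (h1 s).deriv]
    exact fun s => (h2 s).differentiableAt
  · intro t
    simp only [Function.iterate_succ, Function.iterate_zero, Function.comp, id]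
    rw [show deriv F = F' from funext fun s => (h1 s).deriv, (h2 t).deriv]
    have i := mul_le_mul_of_nonneg_left (h t) hg
    have i1 : 0 ≤ Real.exp (-(a0 + a1 * t + g * t ^ 2)) * (a1 + 2 * g * t) ^ 2 := by positivity
    have i2 : 0 ≤ C * (Real.exp (d0 + d1 * t + g * t ^ 2) * (d1 + 2 * g * t) ^ 2) := by positivity
    nlinarith

lemma norm_ineq (p y : Vn n) : ‖y‖ ^ 2 / 2 ≤ ‖p‖ ^ 2 + ‖p - y‖ ^ 2 := by
  have h : ‖y‖ ≤ ‖p‖ + ‖p - y‖ := by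
    have := norm_sub_le p (p - y)
    simpa using this
  nlinarith [norm_nonneg y, norm_nonneg p, norm_nonneg (p - y), sq_nonneg (‖p‖ - ‖p - y‖)]

/-- The basic building block. -/
def AA (b : ℝ) (y p : Vn n) : ℝ :=
  Real.exp (-b * ‖p - y‖ ^ 2) + Real.exp (-b * ‖y‖ ^ 2 / 2) * Real.exp (b * ‖p‖ ^ 2)

lemma norm_add_smul_sq (x v : Vn n) (t : ℝ) :
    ‖x + t • v‖ ^ 2 = ‖x‖ ^ 2 + 2 * inner ℝ x v * t + ‖v‖ ^ 2 * t ^ 2 := by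
  rw [norm_add_sq_real, real_inner_smul_right, norm_smul, mul_pow, Real.norm_eq_abs, sq_abs]
  ring

lemma AA_convex {b : ℝ} (hb : 0 < b) (y : Vn n) : ConvexOn ℝ Set.univ (AA b y) := by
  refine ⟨convex_univ, fun x _ z _ s t hs ht hst => ?_⟩
  set v := z - x with hv
  have e : ∀ t : ℝ, AA b y (x + t • v) =
      Real.exp (-(b * ‖x - y‖ ^ 2 + (b * (2 * inner ℝ (x - y) v)) * t + (b * ‖v‖ ^ 2) * t ^ 2))
      + Real.exp (-b * ‖y‖ ^ 2 / 2) *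
        Real.exp (b * ‖x‖ ^ 2 + (b * (2 * inner ℝ x v)) * t + (b * ‖v‖ ^ 2) * t ^ 2) := by
    intro t
    rw [AA, show x + t • v - y = (x - y) + t • v by abel, norm_add_smul_sq, norm_add_smul_sq]
    congr 2
    · ring
    · congr 1; ring
  have hc := gauss_conv1 (a0 := b * ‖x - y‖ ^ 2) (a1 := b * (2 * inner ℝ (x - y) v))
    (d0 := b * ‖x‖ ^ 2) (d1 := b * (2 * inner ℝ x v)) (g := b * ‖v‖ ^ 2)
    (C := Real.exp (-b * ‖y‖ ^ 2 / 2)) (by positivity) (Real.exp_pos _).le (by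
      intro t
      have h1 := norm_ineq (x + t • v) y
      rw [show x + t • v - y = (x - y) + t • v by abel, norm_add_smul_sq, norm_add_smul_sq] at h1
      rw [← Real.exp_add]
      apply Real.exp_le_exp.2
      have := mul_le_mul_of_nonneg_left h1 hb.le
      linarith)
  have := hc.2 (Set.mem_univ 0) (Set.mem_univ 1) hs ht hst
  simp only [← e] at this
  have e3 : s • x + t • z = x + (s • (0 : ℝ) + t • (1 : ℝ)) • v := by
    rw [hv, show s = 1 - t by linarith]
    simp only [smul_eq_mul, mul_zero, mul_one, zero_add]
    module
  rw [e3]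
  refine this.trans (le_of_eq ?_)
  simp [hv]

lemma GoodZ.K_AA (hY : GoodZ Y) {b : ℝ} (hb : 0 < b) (y : Vn n) : KK Y (AA b y) := by
  set c : ℝ := 1 / (4 * b) with hcdef
  have hc : 0 < c := by positivity
  have hκ := gauss_pos (n := n) hc
  set κ := ∫ ξ : Vn n, Real.exp (-c * ‖ξ‖ ^ 2) with hκd
  have hsq : ∀ R : ℝ, ∀ ξ p : Vn n, ‖p‖ ≤ R →
      (inner ℝ ξ p + -inner ℝ ξ y) ^ 2 / 2 ≤ ‖ξ‖ ^ 2 * ((R + ‖y‖) ^ 2 / 2) := by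
    intro R ξ p hp
    rw [← sub_eq_add_neg, ← inner_sub_right]
    have i1 : |inner ℝ ξ (p - y)| ≤ ‖ξ‖ * (R + ‖y‖) :=
      (abs_real_inner_le_norm _ _).trans (mul_le_mul_of_nonneg_left
        ((norm_sub_le _ _).trans (by linarith)) (norm_nonneg _))
    have := pow_le_pow_left₀ (abs_nonneg _) i1 2
    rw [sq_abs, mul_pow] at this
    linarith
  have hbd : ∀ R : ℝ, Integrable (fun ξ : Vn n => Real.exp (-c * ‖ξ‖ ^ 2) +
      ((R + ‖y‖) ^ 2 / 2) * (‖ξ‖ ^ 2 * Real.exp (-c * ‖ξ‖ ^ 2))) := fun R =>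
    (gauss_int hc).add ((gauss_sq_int hc).const_mul _)
  have h1 : KK Y (fun p => ∫ ξ : Vn n, Real.exp (-c * ‖ξ‖ ^ 2) *
      (Real.cos (inner ℝ ξ p + -inner ℝ ξ y) + (inner ℝ ξ p + -inner ℝ ξ y) ^ 2 / 2)) := by
    refine hY.K_integral volume
      (fun ξ p => Real.exp (-c * ‖ξ‖ ^ 2) *
      (Real.cos (inner ℝ ξ p + -inner ℝ ξ y) + (inner ℝ ξ p + -inner ℝ ξ y) ^ 2 / 2)) ?_ ?_ ?_
    · change Continuous fun q : Vn n × Vn n =>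
        Real.exp (-c * ‖q.1‖ ^ 2) * (Real.cos (inner ℝ q.1 q.2 + -inner ℝ q.1 y)
          + (inner ℝ q.1 q.2 + -inner ℝ q.1 y) ^ 2 / 2)
      fun_prop
    · exact fun ξ => hY.K_smul (hY.K_cos ξ _) (Real.exp_pos _).le
    · intro R
      refine ⟨_, hbd R, fun ξ p hp => ?_⟩
      rw [abs_mul, abs_of_pos (Real.exp_pos _)]
      have i1 := hsq R ξ p hp
      have i2 : |Real.cos (inner ℝ ξ p + -inner ℝ ξ y) + (inner ℝ ξ p + -inner ℝ ξ y) ^ 2 / 2|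
          ≤ 1 + ‖ξ‖ ^ 2 * ((R + ‖y‖) ^ 2 / 2) := by
        refine (abs_add_le _ _).trans (add_le_add (Real.abs_cos_le_one _) ?_)
        rw [abs_of_nonneg (by positivity)]
        exact i1
      refine (mul_le_mul_of_nonneg_left i2 (Real.exp_pos _).le).trans (le_of_eq ?_)
      ring
  have h2 : KK Y (fun p => ∫ ξ : Vn n, Real.exp (-c * ‖ξ‖ ^ 2) *
      ((inner ℝ ξ p + -inner ℝ ξ y) ^ 2 / 2)) := by
    refine hY.K_integral volume
      (fun ξ p => Real.exp (-c * ‖ξ‖ ^ 2) * ((inner ℝ ξ p + -inner ℝ ξ y) ^ 2 / 2)) ?_ ?_ ?_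
    · change Continuous fun q : Vn n × Vn n =>
        Real.exp (-c * ‖q.1‖ ^ 2) * ((inner ℝ q.1 q.2 + -inner ℝ q.1 y) ^ 2 / 2)
      fun_prop
    · exact fun ξ => hY.K_smul (hY.K_sq ξ _) (Real.exp_pos _).le
    · intro R
      refine ⟨_, hbd R, fun ξ p hp => ?_⟩
      rw [abs_of_nonneg (by positivity)]
      have i1 := mul_le_mul_of_nonneg_left (hsq R ξ p hp) (Real.exp_pos (-c * ‖ξ‖ ^ 2)).le
      linarith [Real.exp_pos (-c * ‖ξ‖ ^ 2)]
  have hi2 : ∀ p : Vn n, Integrable (fun ξ : Vn n => Real.exp (-c * ‖ξ‖ ^ 2) *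
      ((inner ℝ ξ p + -inner ℝ ξ y) ^ 2 / 2)) := by
    intro p
    refine (hbd ‖p‖).mono' (by fun_prop : Continuous fun ξ : Vn n => Real.exp (-c * ‖ξ‖ ^ 2) *
      ((inner ℝ ξ p + -inner ℝ ξ y) ^ 2 / 2)).aestronglyMeasurable
      (Eventually.of_forall fun ξ => ?_)
    rw [Real.norm_of_nonneg (by positivity)]
    have i1 := mul_le_mul_of_nonneg_left (hsq ‖p‖ ξ p le_rfl) (Real.exp_pos (-c * ‖ξ‖ ^ 2)).le
    linarith [Real.exp_pos (-c * ‖ξ‖ ^ 2)]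
  have hi1 : ∀ p : Vn n, Integrable (fun ξ : Vn n => Real.exp (-c * ‖ξ‖ ^ 2) *
      Real.cos (inner ℝ ξ (p - y))) := by
    intro p
    refine (gauss_int hc).mono' (by fun_prop : Continuous fun ξ : Vn n => Real.exp (-c * ‖ξ‖ ^ 2) *
      Real.cos (inner ℝ ξ (p - y))).aestronglyMeasurable (Eventually.of_forall fun ξ => ?_)
    rw [Real.norm_eq_abs, abs_mul, abs_of_pos (Real.exp_pos _)]
    exact mul_le_of_le_one_right (Real.exp_pos _).le (Real.abs_cos_le_one _)
  refine hY.K_sat (AA_convex hb y) (hY.K_smul h2 (inv_pos.2 hκ).le) ?_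
  have h3 := hY.K_add (hY.K_smul h1 (inv_pos.2 hκ).le)
    (hY.K_smul (hY.K_Psi hb) (Real.exp_pos (-b * ‖y‖ ^ 2 / 2)).le)
  convert h3 using 2 with p
  have e : ∫ ξ : Vn n, Real.exp (-c * ‖ξ‖ ^ 2) *
      (Real.cos (inner ℝ ξ p + -inner ℝ ξ y) + (inner ℝ ξ p + -inner ℝ ξ y) ^ 2 / 2)
      = κ * Real.exp (-b * ‖p - y‖ ^ 2) + ∫ ξ : Vn n, Real.exp (-c * ‖ξ‖ ^ 2) *
      ((inner ℝ ξ p + -inner ℝ ξ y) ^ 2 / 2) := by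
    have g := gauss_cos_int hc (p - y)
    rw [show -(‖p - y‖ ^ 2 / (4 * c)) = -b * ‖p - y‖ ^ 2 by rw [hcdef]; field_simp] at g
    rw [hκd, ← g, ← integral_add (hi1 p) (hi2 p)]
    refine integral_congr_ae (Eventually.of_forall fun ξ => ?_)
    simp only [inner_sub_right]
    ring_nf
  rw [e, AA]
  field_simp
  ring
end

section
variable {n : ℕ} {Y : (Vn n → ℝ) → ℝ}
lemma GoodZ.K_lip (hY : GoodZ Y) {f : Vn n → ℝ} (hf : ConvexOn ℝ Set.univ f)
    (hf0 : ∀ p, 0 ≤ f p) {L : ℝ} (hL0 : 0 ≤ L) (hL : ∀ p q, |f p - f q| ≤ L * ‖p - q‖) :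
    KK Y f := by
  have hfc : Continuous f := cvx_cont hf
  have hgrow : ∀ y, f y ≤ (f 0 + L) + L * ‖y‖ ^ 2 := by
    intro y
    have h1 := (abs_le.1 (hL y 0)).2
    rw [sub_zero] at h1
    have h2 : ‖y‖ ≤ 1 + ‖y‖ ^ 2 := by nlinarith [sq_nonneg (‖y‖ - 1), norm_nonneg y]
    have := mul_le_mul_of_nonneg_left h2 hL0
    linarith
  have hbase : ∀ b : ℝ, 0 < b → Integrable (fun y : Vn n => f y * Real.exp (-b * ‖y‖ ^ 2)) := by
    intro b hb
    refine (((gauss_int hb).const_mul (f 0 + L)).add ((gauss_sq_int hb).const_mul L)).mono'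
      (by fun_prop : Continuous fun y : Vn n =>
        f y * Real.exp (-b * ‖y‖ ^ 2)).aestronglyMeasurable (Eventually.of_forall fun y => ?_)
    rw [Real.norm_of_nonneg (mul_nonneg (hf0 y) (Real.exp_pos _).le)]
    have := mul_le_mul_of_nonneg_right (hgrow y) (Real.exp_pos (-b * ‖y‖ ^ 2)).le
    refine this.trans (le_of_eq ?_)
    simp only [Pi.add_apply]
    ring
  have hexp : ∀ b : ℝ, 0 < b → ∀ R : ℝ, ∀ p y : Vn n, ‖p‖ ≤ R →
      Real.exp (-b * ‖p - y‖ ^ 2) ≤ Real.exp (b * R ^ 2) * Real.exp (-(b / 2) * ‖y‖ ^ 2) := by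
    intro b hb R p y hp
    rw [← Real.exp_add]
    apply Real.exp_le_exp.2
    have h1 := mul_le_mul_of_nonneg_left (norm_ineq p y) hb.le
    have h2 := mul_le_mul_of_nonneg_left (pow_le_pow_left₀ (norm_nonneg p) hp 2) hb.le
    linarith
  have hIntg : ∀ b : ℝ, 0 < b → ∀ p : Vn n,
      Integrable (fun y : Vn n => f y * Real.exp (-b * ‖p - y‖ ^ 2)) := by
    intro b hb p
    refine ((hbase (b / 2) (half_pos hb)).const_mul (Real.exp (b * ‖p‖ ^ 2))).mono'
      (by fun_prop : Continuous fun y : Vn n =>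
        f y * Real.exp (-b * ‖p - y‖ ^ 2)).aestronglyMeasurable (Eventually.of_forall fun y => ?_)
    rw [Real.norm_of_nonneg (mul_nonneg (hf0 y) (Real.exp_pos _).le)]
    have := mul_le_mul_of_nonneg_left (hexp b hb ‖p‖ p y le_rfl) (hf0 y)
    linarith
  have htr : ∀ b : ℝ, ∀ p : Vn n, ∫ y : Vn n, f y * Real.exp (-b * ‖p - y‖ ^ 2)
      = ∫ z : Vn n, f (p - z) * Real.exp (-b * ‖z‖ ^ 2) := by
    intro b p
    have := integral_sub_left_eq_self (fun y : Vn n => f y * Real.exp (-b * ‖p - y‖ ^ 2)) volume p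
    rw [← this]
    simp
  have hIntg2 : ∀ b : ℝ, 0 < b → ∀ p : Vn n,
      Integrable (fun z : Vn n => f (p - z) * Real.exp (-b * ‖z‖ ^ 2)) := by
    intro b hb p
    have := (hIntg b hb p).comp_sub_left p
    simpa using this
  have hconv : ∀ b : ℝ, 0 < b → ConvexOn ℝ Set.univ
      (fun p : Vn n => ∫ y : Vn n, f y * Real.exp (-b * ‖p - y‖ ^ 2)) := by
    intro b hb
    simp only [htr]
    refine ⟨convex_univ, fun x _ y _ s t hs ht hst => ?_⟩
    simp only [smul_eq_mul]
    rw [← integral_const_mul, ← integral_const_mul,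
      ← integral_add ((hIntg2 b hb x).const_mul s) ((hIntg2 b hb y).const_mul t)]
    refine integral_mono (hIntg2 b hb _)
      (((hIntg2 b hb x).const_mul s).add ((hIntg2 b hb y).const_mul t)) fun z => ?_
    have h1 := hf.2 (Set.mem_univ (x - z)) (Set.mem_univ (y - z)) hs ht hst
    have e : s • (x - z) + t • (y - z) = s • x + t • y - z := by
      rw [show s = 1 - t by linarith]; module
    rw [e] at h1
    have := mul_le_mul_of_nonneg_right h1 (Real.exp_pos (-b * ‖z‖ ^ 2)).le
    refine this.trans (le_of_eq ?_)
    simp only [smul_eq_mul]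
    ring
  have hKb : ∀ b : ℝ, 0 < b →
      KK Y (fun p : Vn n => ∫ y : Vn n, f y * Real.exp (-b * ‖p - y‖ ^ 2)) := by
    intro b hb
    have hD : 0 ≤ ∫ y : Vn n, f y * Real.exp (-(b / 2) * ‖y‖ ^ 2) :=
      integral_nonneg fun y => mul_nonneg (hf0 y) (Real.exp_pos _).le
    refine hY.K_sat (hconv b hb) (hY.K_smul (hY.K_Psi hb) hD) ?_
    have h1 : KK Y (fun p => ∫ y : Vn n, f y * AA b y p) := by
      refine hY.K_integral volume (fun y p => f y * AA b y p) ?_ ?_ ?_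
      · change Continuous fun q : Vn n × Vn n => f q.1 * (Real.exp (-b * ‖q.2 - q.1‖ ^ 2)
          + Real.exp (-b * ‖q.1‖ ^ 2 / 2) * Real.exp (b * ‖q.2‖ ^ 2))
        fun_prop
      · exact fun y => hY.K_smul (hY.K_AA hb y) (hf0 y)
      · intro R
        refine ⟨_, (hbase (b / 2) (half_pos hb)).const_mul (2 * Real.exp (b * R ^ 2)),
          fun y p hp => ?_⟩
        have i1 := hexp b hb R p y hp
        have i2 : Real.exp (b * ‖p‖ ^ 2) ≤ Real.exp (b * R ^ 2) := Real.exp_le_exp.2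
          (mul_le_mul_of_nonneg_left (pow_le_pow_left₀ (norm_nonneg p) hp 2) hb.le)
        have e : Real.exp (-b * ‖y‖ ^ 2 / 2) = Real.exp (-(b / 2) * ‖y‖ ^ 2) := by
          congr 1; ring
        have i3 : AA b y p ≤ 2 * Real.exp (b * R ^ 2) * Real.exp (-(b / 2) * ‖y‖ ^ 2) := by
          rw [AA, e]
          have := mul_le_mul_of_nonneg_left i2 (Real.exp_pos (-(b / 2) * ‖y‖ ^ 2)).le
          linarith
        have i4 : 0 ≤ AA b y p := by rw [AA]; positivity
        rw [abs_of_nonneg (mul_nonneg (hf0 y) i4)]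
        refine (mul_le_mul_of_nonneg_left i3 (hf0 y)).trans (le_of_eq ?_)
        ring
    convert h1 using 2 with p
    rw [mul_comm, ← integral_const_mul, ← integral_add (hIntg b hb p)
      ((hbase (b / 2) (half_pos hb)).const_mul _)]
    refine integral_congr_ae (Eventually.of_forall fun y => ?_)
    have e : Real.exp (-b * ‖y‖ ^ 2 / 2) = Real.exp (-(b / 2) * ‖y‖ ^ 2) := by
      congr 1; ring
    simp only [AA, e]
    ring
  refine hY.K_lim hf fun R ε hε => ?_
  set C : ℝ := 2 * 2 ^ ((n : ℝ) / 2) with hC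
  have hC0 : 0 < C := by positivity
  set d : ℝ := ε / ((L + 1) * (1 + C)) with hd
  have hd0 : 0 < d := by positivity
  set b : ℝ := 1 / d ^ 2 with hbdef
  have hb : 0 < b := by positivity
  have hN := gauss_pos (n := n) hb
  set N := ∫ z : Vn n, Real.exp (-b * ‖z‖ ^ 2) with hNd
  refine ⟨fun p => N⁻¹ * ∫ y : Vn n, f y * Real.exp (-b * ‖p - y‖ ^ 2),
    hY.K_smul (hKb b hb) (inv_pos.2 hN).le, fun p _ => ?_⟩
  simp only
  rw [htr]
  have hg1 := (gauss_int (n := n) hb).const_mul (f p)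
  have e1 : ∫ z : Vn n, (f (p - z) - f p) * Real.exp (-b * ‖z‖ ^ 2)
      = (∫ z : Vn n, f (p - z) * Real.exp (-b * ‖z‖ ^ 2)) - f p * N := by
    rw [hNd, ← integral_const_mul, ← integral_sub (hIntg2 b hb p) hg1]
    refine integral_congr_ae (Eventually.of_forall fun z => ?_)
    simp only
    ring
  have hi3 : Integrable fun z : Vn n => (L * d) * Real.exp (-b * ‖z‖ ^ 2) +
      (L / d) * (‖z‖ ^ 2 * Real.exp (-b * ‖z‖ ^ 2)) :=
    ((gauss_int hb).const_mul _).add ((gauss_sq_int hb).const_mul _)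
  have e2 : ‖∫ z : Vn n, (f (p - z) - f p) * Real.exp (-b * ‖z‖ ^ 2)‖ ≤
      ∫ z : Vn n, ((L * d) * Real.exp (-b * ‖z‖ ^ 2) +
      (L / d) * (‖z‖ ^ 2 * Real.exp (-b * ‖z‖ ^ 2))) := by
    refine norm_integral_le_of_norm_le hi3 (Eventually.of_forall fun z => ?_)
    rw [norm_mul, Real.norm_of_nonneg (Real.exp_pos _).le, Real.norm_eq_abs]
    have h1 := hL (p - z) p
    rw [sub_sub_cancel_left, norm_neg] at h1
    have h2 : ‖z‖ ≤ d + ‖z‖ ^ 2 / d := by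
      rw [← sub_nonneg]
      have : d + ‖z‖ ^ 2 / d - ‖z‖ = (d ^ 2 + ‖z‖ ^ 2 - d * ‖z‖) / d := by field_simp
      rw [this]
      refine div_nonneg ?_ hd0.le
      nlinarith [sq_nonneg (d - ‖z‖), sq_nonneg d, sq_nonneg ‖z‖]
    have h3 := h1.trans (mul_le_mul_of_nonneg_left h2 hL0)
    refine (mul_le_mul_of_nonneg_right h3 (Real.exp_pos _).le).trans (le_of_eq ?_)
    ring
  rw [integral_add ((gauss_int hb).const_mul _) ((gauss_sq_int hb).const_mul _),
    integral_const_mul, integral_const_mul, ← hNd, e1, Real.norm_eq_abs] at e2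
  have e3 := mul_le_mul_of_nonneg_left (gauss_sq_le (n := n) hb) (div_nonneg hL0 hd0.le)
  rw [← hNd] at e3
  have e4 : L / d * (2 / b * (2 ^ ((n : ℝ) / 2) * N)) = L * d * C * N := by
    rw [hbdef, hC]; field_simp
  rw [e4] at e3
  have e5 := e2.trans (add_le_add_right e3 _)
  have e6 : N⁻¹ * (∫ z : Vn n, f (p - z) * Real.exp (-b * ‖z‖ ^ 2)) - f p
      = N⁻¹ * ((∫ z : Vn n, f (p - z) * Real.exp (-b * ‖z‖ ^ 2)) - f p * N) := by
    field_simp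
  rw [e6, abs_mul, abs_of_pos (inv_pos.2 hN)]
  refine (mul_le_mul_of_nonneg_left e5 (inv_pos.2 hN).le).trans ?_
  have e7 : N⁻¹ * (L * d * N + L * d * C * N) = L * (d * (1 + C)) := by field_simp
  have e8 : d * (1 + C) = ε / (L + 1) := by rw [hd]; field_simp
  rw [e7, e8, mul_div_assoc', div_le_iff₀ (by positivity)]
  nlinarith
end

section
variable {n : ℕ} {Y : (Vn n → ℝ) → ℝ}
lemma GoodZ.K_all (hY : GoodZ Y) {f : Vn n → ℝ} (hf : ConvexOn ℝ Set.univ f) : KK Y f := by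
  refine hY.K_lim hf fun R ε hε => ?_
  set r := max R 0 with hr
  have hr0 : 0 ≤ r := le_max_right _ _
  obtain ⟨C, hC0, hC⟩ := cvx_bdd hf (r + 1)
  choose x hx using exists_subgrad hf
  let ι := {p : Vn n // ‖p‖ ≤ r}
  let i0 : ι := ⟨0, by simpa using hr0⟩
  have : Nonempty ι := ⟨i0⟩
  set L : ℝ := 2 * C with hLd
  have hL0 : 0 ≤ L := by positivity
  have hxL : ∀ i : ι, ‖x i.1‖ ≤ L := by
    intro i
    rcases eq_or_ne (x i.1) 0 with h0 | h0
    · rw [h0, norm_zero]; exact hL0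
    have hn : ‖x i.1‖ ≠ 0 := norm_ne_zero_iff.2 h0
    set v : Vn n := ‖x i.1‖⁻¹ • x i.1 with hv
    have hv1 : ‖v‖ = 1 := by
      rw [hv, norm_smul, norm_inv, norm_norm, inv_mul_cancel₀ hn]
    have h1 := hx i.1 (i.1 + v)
    rw [add_sub_cancel_left, hv, real_inner_smul_right, real_inner_self_eq_norm_sq, ← hv] at h1
    have h2 : ‖x i.1‖⁻¹ * ‖x i.1‖ ^ 2 = ‖x i.1‖ := by field_simp
    rw [h2] at h1
    have h3 := (abs_le.1 (hC (i.1 + v) ((norm_add_le _ _).trans (by rw [hv1]; linarith [i.2])))).2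
    have h4 := (abs_le.1 (hC i.1 (by linarith [i.2]))).1
    linarith
  let a : ι → Vn n := fun i => x i.1
  let b : ι → ℝ := fun i => inner ℝ (x i.1) i.1 - f i.1
  have hle : ∀ p (i : ι), inner ℝ (a i) p - b i ≤ f p := by
    intro p i
    have := hx i.1 p
    rw [inner_sub_right] at this
    simp only [a, b]
    linarith
  have hbdd : ∀ p, BddAbove (Set.range fun i => inner ℝ (a i) p - b i) := by
    rintro p
    refine ⟨f p, ?_⟩
    rintro _ ⟨i, rfl⟩
    exact hle p i
  set g : Vn n → ℝ := fun p => ⨆ i, (inner ℝ (a i) p - b i) with hg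
  have hgc : ConvexOn ℝ Set.univ g := convexOn_iSup_affine a b hbdd
  have hgle : ∀ p, g p ≤ f p := fun p => ciSup_le (hle p)
  have hgge : ∀ p i, inner ℝ (a i) p - b i ≤ g p := fun p i => le_ciSup (hbdd p) i
  have hglip : ∀ p q, g p - g q ≤ L * ‖p - q‖ := by
    intro p q
    rw [sub_le_iff_le_add]
    refine ciSup_le fun i => ?_
    have h1 := hgge q i
    have h2 : inner ℝ (a i) (p - q) ≤ L * ‖p - q‖ :=
      (real_inner_le_norm _ _).trans (mul_le_mul_of_nonneg_right (hxL i) (norm_nonneg _))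
    rw [inner_sub_right] at h2
    linarith
  set h : Vn n → ℝ := fun p => g p + (inner ℝ (-(a i0)) p + b i0) with hh
  have hhc : ConvexOn ℝ Set.univ h := cvx_add hgc (cvx_aff _ _)
  have hh0 : ∀ p, 0 ≤ h p := by
    intro p
    have := hgge p i0
    simp only [hh, inner_neg_left]
    linarith
  have hhl : ∀ p q, h p - h q ≤ (2 * L) * ‖p - q‖ := by
    intro p q
    have h1 := hglip p q
    have h2 : inner ℝ (-(a i0)) (p - q) ≤ L * ‖p - q‖ :=
      (real_inner_le_norm _ _).trans (mul_le_mul_of_nonneg_right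
        (by rw [norm_neg]; exact hxL i0) (norm_nonneg _))
    rw [inner_sub_right] at h2
    simp only [hh]
    linarith
  have hKh : KK Y h := hY.K_lip hhc hh0 (L := 2 * L) (by positivity) fun p q => by
    rw [abs_le]
    have h1 := hhl q p
    rw [norm_sub_rev] at h1
    exact ⟨by linarith, hhl p q⟩
  have hKg : KK Y g := by
    have := hY.K_add hKh (hY.K_aff (a i0) (-b i0))
    convert this using 2 with p
    simp only [hh, inner_neg_left]
    ring
  refine ⟨g, hKg, fun p hp => ?_⟩
  have h1 := hgge p ⟨p, hp.trans (le_max_left _ _)⟩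
  have h2 := hgle p
  simp only [a, b] at h1
  have : g p = f p := by linarith
  rw [this, sub_self, abs_zero]
  exact hε.le

lemma goodZ_of {Z : (Vn n → EReal) → ℝ}
    (hcont : ContinuousVal (ConvSc n) Z)
    (hval : IsValuation (ConvSc n) Z)
    (hinv : EpiTranslationInvariant (ConvSc n) Z)
    (hhom : EpiHomogeneous (ConvSc n) Z 1) : GoodZ (fun f : Vn n → ℝ => Z (cj f)) := by
  have haff : ∀ g : Vn n → ℝ, ConvexOn ℝ Set.univ g → ∀ (a : Vn n) (b : ℝ),
      Z (cj fun p => g p + (inner ℝ a p + b)) = Z (cj g) := by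
    intro g hg a b
    rw [← cj_add_affine]
    exact hinv _ (cj_mem hg) a (-b)
  refine ⟨?_, haff, ?_, ?_⟩
  · intro g hg a b
    have hc1 : ConvexOn ℝ Set.univ (fun p => g p + max (inner ℝ a p + b) 0) :=
      cvx_add hg (cvx_ridge a b)
    have hc2 : ConvexOn ℝ Set.univ (fun p => g p + 2 * max (inner ℝ a p + b) 0) :=
      cvx_add hg (cvx_smul (cvx_ridge a b) (by norm_num))
    have es := cj_sup (fun p => g p + max (inner ℝ a p + b) 0)
      (fun p => g p + max (inner ℝ a p + b) 0 + (inner ℝ a p + b))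
    have em : (fun p => min (g p + max (inner ℝ a p + b) 0)
        (g p + max (inner ℝ a p + b) 0 + (inner ℝ a p + b))) =
        fun p => g p + (inner ℝ a p + b) := by
      funext p
      rcases le_total 0 (inner ℝ a p + b) with h | h
      · rw [max_eq_left h, min_eq_left (by linarith)]
      · rw [max_eq_right h, min_eq_right (by linarith), add_zero]
    rw [em] at es
    have ei := cj_inf_ridge hg a b
    have hv := hval _ _ (cj_mem hc1) (cj_mem (cvx_add hc1 (cvx_aff a b)))
      (by rw [es]; exact cj_mem (cvx_add hg (cvx_aff a b)))
      (by rw [ei]; exact cj_mem hc2)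
    rw [es, ei, haff g hg, haff _ hc1] at hv
    linarith
  · intro fk f hfk hf h
    exact hcont _ _ (fun k => cj_mem (hfk k)) (cj_mem hf) (epi_of_LUC hfk h)
  · intro g hg l hl
    have := hhom _ (cj_mem hg) l hl
    rw [cj_epiMul g hl, Real.rpow_one] at this
    exact this
end

/-- **Epi-additivity of `1`-epi-homogeneous valuations** (Corollary 6.2): a
continuous and epi-translation invariant valuation on `Conv_sc(ℝⁿ)` that is
epi-homogeneous of degree `1` is epi-additive:
`Z(α ⊡ u □ β ⊡ v) = α Z(u) + β Z(v)` for `α, β > 0`. -/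
theorem epi_additivity (n : ℕ) (Z : (Vn n → EReal) → ℝ)
    (hcont : ContinuousVal (ConvSc n) Z)
    (hval : IsValuation (ConvSc n) Z)
    (hinv : EpiTranslationInvariant (ConvSc n) Z)
    (hhom : EpiHomogeneous (ConvSc n) Z 1) :
    ∀ α β : ℝ, 0 < α → 0 < β → ∀ u v : Vn n → EReal,
      u ∈ ConvSc n → v ∈ ConvSc n →
        Z (infConv (epiMul α u) (epiMul β v)) = α * Z u + β * Z v := by
  intro α β hα hβ u v hu hv
  obtain ⟨f, hf, rfl⟩ := exists_eq_cj hu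
  obtain ⟨g, hg, rfl⟩ := exists_eq_cj hv
  have hY := goodZ_of hcont hval hinv hhom
  have hfα := cvx_smul hf hα.le
  have hgβ := cvx_smul hg hβ.le
  rw [cj_epiMul f hα, cj_epiMul g hβ, cj_infConv hfα hgβ]
  have h1 := (hY.K_all hgβ).2 _ hfα
  have h2 := hY.hom f hf α hα
  have h3 := hY.hom g hg β hβ
  simp only at h1 h2 h3
  rw [h1, h2, h3]
end
end

section
/- Let Z : Conv(ℝⁿ;ℝ) → ℝ be a continuous and dually epi-translation invariant valuation that is homogeneous of degree m ∈ {1,…,n}. Then there exists a symmetric function Z̄ : (Conv(ℝⁿ;ℝ))^m → ℝ such that for every k ∈ ℕ, all v₁,…,v_k ∈ Conv(ℝⁿ;ℝ) and all λ₁,…,λ_k ≥ 0, Z(λ₁ v₁ + ⋯ + λ_k v_k) = Σ over all (i₁,…,i_k) with i_j ∈ {0,…,m} and i₁+⋯+i_k = m of the multinomial coefficient m!/(i₁!⋯i_k!) times λ₁^{i₁}⋯λ_k^{i_k} Z̄(v₁[i₁],…,v_k[i_k]), where v_j[i_j] means the argument v_j is repeated i_j times. Moreover, Z̄ is additive in each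 variable (i.e. Z̄(α v + β v', v₂,…,v_m) = α Z̄(v, v₂,…,v_m) + β Z̄(v', v₂,…,v_m) for all α, β ≥ 0), and for every i ∈ {1,…,m} and all fixed v_{i+1},…,v_m ∈ Conv(ℝⁿ;ℝ), the map v ↦ Z̄(v[i], v_{i+1},…,v_m) is a continuous and dually epi-translation invariant valuation on Conv(ℝⁿ;ℝ) that is homogeneous of degree i. -/
open Filter Topology MeasureTheory

noncomputable section

/-- `Conv(ℝⁿ;ℝ)`: finite-valued convex functions on `ℝⁿ`. -/
def ConvFin (n : ℕ) : Set (Vn n → ℝ) := {v | ConvexOn ℝ Set.univ v}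

/-- Epi-convergence of a sequence of real-valued functions
(the lower bound condition is stated in `EReal` so that the `liminf` is the
honest extended-real lower limit). -/
def EpiConvergesR {n : ℕ} (vk : ℕ → Vn n → ℝ) (v : Vn n → ℝ) : Prop :=
  ∀ x : Vn n,
    (∀ xk : ℕ → Vn n, Tendsto xk atTop (𝓝 x) →
      (v x : EReal) ≤ liminf (fun k => ((vk k (xk k) : ℝ) : EReal)) atTop) ∧
    (∃ xk : ℕ → Vn n, Tendsto xk atTop (𝓝 x) ∧
      Tendsto (fun k => vk k (xk k)) atTop (𝓝 (v x)))

/-- Continuity (with respect to epi-convergence) of a functional on a class `X`. -/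
def ContinuousValR {n : ℕ} (X : Set (Vn n → ℝ)) (Z : (Vn n → ℝ) → ℝ) : Prop :=
  ∀ (vk : ℕ → Vn n → ℝ) (v : Vn n → ℝ),
    (∀ k, vk k ∈ X) → v ∈ X → EpiConvergesR vk v →
      Tendsto (fun k => Z (vk k)) atTop (𝓝 (Z v))

/-- The valuation property on a class `X` (here `⊔`, `⊓` are the pointwise
maximum and minimum). -/
def IsValuationR {n : ℕ} (X : Set (Vn n → ℝ)) (Z : (Vn n → ℝ) → ℝ) : Prop :=
  ∀ u v : Vn n → ℝ, u ∈ X → v ∈ X → u ⊔ v ∈ X → u ⊓ v ∈ X →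
    Z (u ⊔ v) + Z (u ⊓ v) = Z u + Z v

/-- Dual epi-translation invariance: invariance under addition of affine
functions `v ↦ v + ℓ + c`. -/
def DuallyEpiTranslationInvariant {n : ℕ} (X : Set (Vn n → ℝ)) (Z : (Vn n → ℝ) → ℝ) : Prop :=
  ∀ v ∈ X, ∀ ℓ : Vn n →ₗ[ℝ] ℝ, ∀ c : ℝ, Z (fun x => v x + ℓ x + c) = Z v

/-- Dual translation invariance: invariance under addition of linear
functions `v ↦ v + ℓ`. -/
def DuallyTranslationInvariant {n : ℕ} (X : Set (Vn n → ℝ)) (Z : (Vn n → ℝ) → ℝ) : Prop :=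
  ∀ v ∈ X, ∀ ℓ : Vn n →ₗ[ℝ] ℝ, Z (fun x => v x + ℓ x) = Z v

/-- `Z` is homogeneous of degree `α`: `Z(λ v) = λ^α Z(v)` for `λ > 0`. -/
def HomogeneousR {n : ℕ} (X : Set (Vn n → ℝ)) (Z : (Vn n → ℝ) → ℝ) (α : ℝ) : Prop :=
  ∀ v ∈ X, ∀ l : ℝ, 0 < l → Z (fun x => l * v x) = l ^ α * Z v

/-- The `m`-tuple `(v₁[d₁], …, v_k[d_k])` in which the argument `v j` is
repeated `d j` times (assuming `∑ j, d j = m`). -/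
def repTupleR {n : ℕ} (k m : ℕ) (d : Fin k → ℕ) (v : Fin k → Vn n → ℝ) :
    Fin m → Vn n → ℝ :=
  fun x => ((List.finRange k).flatMap fun j => List.replicate (d j) (v j)).getD
    (x : ℕ) (fun _ => 0)

/-- The `m`-tuple `(v[i], w_{i+1}, …, w_m)` in which `v` is repeated `i`
times, followed by the entries of `rest`. -/
def repConcatR {n : ℕ} (m i : ℕ) (v : Vn n → ℝ)
    (rest : Fin (m - i) → Vn n → ℝ) : Fin m → Vn n → ℝ :=
  fun x => if h : (x : ℕ) < i then v
    else rest ⟨(x : ℕ) - i, by have := x.isLt; omega⟩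

section Abstract

variable {A : Type*} [AddCommMonoid A]

/-- linear extension of `z` to the monoid algebra -/
def Lf (z : A → ℝ) : AddMonoidAlgebra ℝ A →ₗ[ℝ] ℝ :=
  (Finsupp.linearCombination ℝ z).comp (AddMonoidAlgebra.coeffLinearEquiv ℝ).toLinearMap

/-- the monomial -/
def Xm (a : A) : AddMonoidAlgebra ℝ A := AddMonoidAlgebra.single a 1

lemma Lf_Xm (z : A → ℝ) (a : A) : Lf z (Xm a) = z a := by
  simp [Lf, Xm]

lemma Xm_mul (a b : A) : Xm a * Xm b = Xm (a + b) := by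
  simp [Xm, AddMonoidAlgebra.single_mul_single]

lemma Xm_zero : Xm (0 : A) = 1 := rfl

lemma Xm_sum {ι : Type*} (s : Finset ι) (u : ι → A) :
    ∏ i ∈ s, Xm (u i) = Xm (∑ i ∈ s, u i) := by
  classical
  induction s using Finset.induction_on with
  | empty => simp [Xm_zero]
  | insert a s ha ih => rw [Finset.prod_insert ha, Finset.sum_insert ha, ih, Xm_mul]

/-- annihilator -/
def Jf (z : A → ℝ) : Ideal (AddMonoidAlgebra ℝ A) where
  carrier := {x | ∀ y, Lf z (x * y) = 0}
  add_mem' := by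
    intro a b ha hb y
    rw [add_mul, map_add, ha y, hb y, add_zero]
  zero_mem' := by intro y; simp
  smul_mem' := by
    intro c x hx y
    rw [smul_eq_mul, mul_comm c x, mul_assoc]; exact hx _

lemma mem_Jf_of (z : A → ℝ) (x : AddMonoidAlgebra ℝ A)
    (h : ∀ a, Lf z (x * Xm a) = 0) : x ∈ Jf z := by
  intro y
  induction y using AddMonoidAlgebra.induction_linear with
  | zero => simp
  | add f g hf hg => rw [mul_add, map_add, hf, hg, add_zero]
  | single a r =>
    have : AddMonoidAlgebra.single a r = r • Xm a := by simp [Xm]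
    rw [this, mul_smul_comm, map_smul, h, smul_zero]

open MvPolynomial in
lemma mv_step {ι : Type*} (L : MvPolynomial ι ℝ →ₗ[ℝ] ℝ) (m M : ℕ) (hM : m < M)
    (φ : MvPolynomial ι ℝ →ₐ[ℝ] MvPolynomial ι ℝ) (hφ : ∀ i, φ (X i) = X i * X i)
    (hL : ∀ x, L (φ x) = 2 ^ m * L x)
    (I : Ideal (MvPolynomial ι ℝ)) (hI : I = Ideal.span (Set.range fun i => (X i - 1)))
    (h : ∀ x ∈ I ^ (M + 1), L x = 0) : ∀ x ∈ I ^ M, L x = 0 := by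
  have hX : ∀ i, (X i - 1 : MvPolynomial ι ℝ) ∈ I := fun i => by
    rw [hI]; exact Ideal.subset_span ⟨i, rfl⟩
  have h0 : ∀ y, φ y - y ∈ I := by
    intro y
    have : (Ideal.Quotient.mkₐ ℝ I).comp φ = Ideal.Quotient.mkₐ ℝ I := by
      apply MvPolynomial.algHom_ext
      intro i
      simp only [AlgHom.comp_apply, hφ, Ideal.Quotient.mkₐ_eq_mk]
      rw [Ideal.Quotient.eq]
      have : (X i * X i - X i : MvPolynomial ι ℝ) = X i * (X i - 1) := by ring
      rw [this]; exact I.mul_mem_left _ (hX i)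
    have := DFunLike.congr_fun this y
    simp only [AlgHom.comp_apply, Ideal.Quotient.mkₐ_eq_mk] at this
    rwa [Ideal.Quotient.eq] at this
  have h1 : ∀ y ∈ I, φ y - 2 * y ∈ I ^ 2 := by
    intro y hy
    rw [hI] at hy
    induction hy using Submodule.span_induction with
    | mem x hx =>
      obtain ⟨i, rfl⟩ := hx
      have : φ (X i - 1) - 2 * (X i - 1) = (X i - 1 : MvPolynomial ι ℝ) * (X i - 1) := by
        simp only [map_sub, hφ, map_one]; ring
      simp only [this, pow_two]
      exact Ideal.mul_mem_mul (hX i) (hX i)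
    | zero => simp
    | add x y _ _ hx hy =>
      have := Ideal.add_mem _ hx hy
      convert! this using 1
      rw [map_add]; ring
    | smul a x hx hx' =>
      have hxI : x ∈ I := by rw [hI]; exact hx
      have e : φ (a • x) - 2 * (a • x) = φ a * (φ x - 2 * x) + 2 * ((φ a - a) * x) := by
        simp only [smul_eq_mul, map_mul]; ring
      rw [e]
      refine Ideal.add_mem _ (Ideal.mul_mem_left _ _ hx') (Ideal.mul_mem_left _ _ ?_)
      rw [pow_two]; exact Ideal.mul_mem_mul (h0 a) hxI
  have h2 : ∀ N, ∀ y ∈ I ^ N, φ y - 2 ^ N * y ∈ I ^ (N + 1) := by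
    intro N
    induction N with
    | zero => intro y _; simpa using h0 y
    | succ N ih =>
      intro y hy
      rw [pow_succ] at hy
      induction hy using Submodule.mul_induction_on' with
      | mem_mul_mem x hx y hy =>
        have e : φ (x * y) - 2 ^ (N + 1) * (x * y) =
            (φ x - 2 ^ N * x) * (φ y - 2 * y) + (φ x - 2 ^ N * x) * (2 * y)
             + (2 ^ N * x) * (φ y - 2 * y) := by
          rw [map_mul]; ring
        rw [e]
        refine Ideal.add_mem _ (Ideal.add_mem _ ?_ ?_) ?_
        · have := Ideal.mul_mem_mul (ih x hx) (h1 y hy)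
          rw [← pow_add] at this
          exact Ideal.pow_le_pow_right (by omega) this
        · have := Ideal.mul_mem_mul (ih x hx) (I.mul_mem_left 2 hy)
          rwa [← pow_succ] at this
        · have := Ideal.mul_mem_mul (Ideal.mul_mem_left _ (2 ^ N) hx) (h1 y hy)
          rwa [← pow_add] at this
      | add x _ y _ hx hy =>
        have := Ideal.add_mem _ hx hy
        convert! this using 1
        rw [map_add]; ring
  intro x hx
  have e1 := h _ (h2 M x hx)
  have e2 : (2 ^ M * x : MvPolynomial ι ℝ) = (2 ^ M : ℝ) • x := by
    have h2 : (C (2 : ℝ) : MvPolynomial ι ℝ) = 2 := map_ofNat C 2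
    rw [MvPolynomial.smul_eq_C_mul, map_pow, h2]
  rw [map_sub, hL, e2, map_smul, smul_eq_mul] at e1
  have : (2 : ℝ) ^ m < 2 ^ M := pow_lt_pow_right₀ (by norm_num) hM
  have e3 : ((2 : ℝ) ^ m - 2 ^ M) * L x = 0 := by linarith
  rcases mul_eq_zero.1 e3 with h | h
  · linarith
  · exact h

open MvPolynomial in
lemma abstract_vanish (z : A → ℝ) (m : ℕ) (hz : ∀ a, z (a + a) = 2 ^ m * z a)
    {ι : Type*} [Fintype ι] (u : ι → A) (hu : ∀ i, Xm (u i) - 1 ∈ (Jf z).radical)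
    (hc : Fintype.card ι = m + 1) : Lf z (∏ i, (Xm (u i) - 1)) = 0 := by
  let ψ : MvPolynomial ι ℝ →ₐ[ℝ] AddMonoidAlgebra ℝ A := aeval (fun i => Xm (u i))
  let φ : MvPolynomial ι ℝ →ₐ[ℝ] MvPolynomial ι ℝ := aeval (fun i => X i * X i)
  let L : MvPolynomial ι ℝ →ₗ[ℝ] ℝ := (Lf z).comp ψ.toLinearMap
  let Φ : AddMonoidAlgebra ℝ A →ₐ[ℝ] AddMonoidAlgebra ℝ A :=
    AddMonoidAlgebra.mapDomainAlgHom ℝ ℝ (AddMonoidHom.id A + AddMonoidHom.id A)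
  have hΦ : ∀ a, Φ (Xm a) = Xm (a + a) := by
    intro a; simp [Φ, Xm]
  have hLΦ : ∀ x, Lf z (Φ x) = 2 ^ m * Lf z x := by
    intro x
    induction x using AddMonoidAlgebra.induction_linear with
    | zero => simp
    | add f g hf hg => rw [map_add, map_add, hf, hg, map_add, mul_add]
    | single a r =>
      have : AddMonoidAlgebra.single a r = r • Xm a := by simp [Xm]
      rw [this, map_smul, map_smul, hΦ, Lf_Xm, map_smul, Lf_Xm, hz]
      simp only [smul_eq_mul]; ring
  have hψφ : ∀ x, ψ (φ x) = Φ (ψ x) := by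
    intro x
    have : ψ.comp φ = Φ.comp ψ := by
      apply MvPolynomial.algHom_ext
      intro i
      simp [ψ, φ, hΦ, Xm_mul]
    exact DFunLike.congr_fun this x
  set I : Ideal (MvPolynomial ι ℝ) := Ideal.span (Set.range fun i => (X i - 1)) with hI
  have hrad : I ≤ (Ideal.comap ψ (Jf z)).radical := by
    rw [hI, Ideal.span_le]
    rintro _ ⟨i, rfl⟩
    obtain ⟨r, hr⟩ := hu i
    refine ⟨r, ?_⟩
    simpa [Ideal.mem_comap, ψ] using hr
  obtain ⟨N, hN⟩ := Ideal.exists_pow_le_of_le_radical_of_fg hrad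
    (Submodule.fg_span (Set.finite_range _))
  have hbase : ∀ x ∈ I ^ N, L x = 0 := by
    intro x hx
    have := hN hx
    rw [Ideal.mem_comap] at this
    have := this 1
    simpa [L] using this
  have hdesc : ∀ k M, N ≤ M + k → m < M → ∀ x ∈ I ^ M, L x = 0 := by
    intro k
    induction k with
    | zero => intro M hM _ x hx; exact hbase x (Ideal.pow_le_pow_right (by omega) hx)
    | succ k ih =>
      intro M hM hm
      refine mv_step L m M hm φ (by simp [φ]) ?_ I hI (ih (M + 1) (by omega) (by omega))
      intro x
      simp only [L, LinearMap.comp_apply, AlgHom.toLinearMap_apply, hψφ, hLΦ]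
  have := hdesc N (m + 1) (by omega) (by omega) (∏ i, (X i - 1)) ?_
  · simpa [L, ψ] using this
  · have h := Ideal.prod_mem_prod (s := Finset.univ) (I := fun _ : ι => I)
      (x := fun i => (X i - 1)) (fun i _ => Ideal.subset_span ⟨i, rfl⟩)
    simpa [hc] using h

lemma Lf_expand (z : A → ℝ) {ι : Type*} [Fintype ι] (u : ι → A) :
    Lf z (∏ i, (Xm (u i) - 1)) =
      ∑ s : Finset ι, (-1) ^ (Fintype.card ι - s.card) * z (∑ i ∈ s, u i) := by
  classical
  have : ∀ i, Xm (u i) - 1 = Xm (u i) + (-1) := fun i => sub_eq_add_neg _ _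
  simp_rw [this]
  rw [Fintype.prod_add, map_sum]
  refine Finset.sum_congr rfl fun s _ => ?_
  rw [Xm_sum, Finset.prod_const, Finset.card_compl]
  have : (Xm (∑ i ∈ s, u i) * (-1) ^ (Fintype.card ι - s.card) : AddMonoidAlgebra ℝ A)
     = ((-1 : ℝ) ^ (Fintype.card ι - s.card)) • Xm (∑ i ∈ s, u i) := by
    rcases neg_one_pow_eq_or ℝ (Fintype.card ι - s.card) with h | h
    · rcases Nat.even_or_odd (Fintype.card ι - s.card) with h' | h'
      · simp [h'.neg_one_pow]
      · simp [h'.neg_one_pow]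
    · rcases Nat.even_or_odd (Fintype.card ι - s.card) with h' | h'
      · simp [h'.neg_one_pow]
      · simp [h'.neg_one_pow]
  rw [this, map_smul, Lf_Xm, smul_eq_mul]

end Abstract

section ConvexPart

variable {n : ℕ}

/-- convex functions as an additive submonoid -/
def ConvS (n : ℕ) : AddSubmonoid (Vn n → ℝ) where
  carrier := ConvFin n
  add_mem' := fun ha hb => ConvexOn.add ha hb
  zero_mem' := convexOn_const 0 convex_univ

lemma convFin_smul {v : Vn n → ℝ} (hv : v ∈ ConvFin n) {c : ℝ} (hc : 0 ≤ c) :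
    (fun x => c * v x) ∈ ConvFin n := ConvexOn.smul hc hv

lemma convFin_add {v w : Vn n → ℝ} (hv : v ∈ ConvFin n) (hw : w ∈ ConvFin n) :
    (fun x => v x + w x) ∈ ConvFin n := ConvexOn.add hv hw

lemma convFin_zero : (fun _ => 0 : Vn n → ℝ) ∈ ConvFin n := convexOn_const 0 convex_univ

lemma convFin_sum {ι : Type*} (s : Finset ι) {v : ι → Vn n → ℝ} (hv : ∀ i ∈ s, v i ∈ ConvFin n) :
    (fun x => ∑ i ∈ s, v i x) ∈ ConvFin n := by
  have : (fun x => ∑ i ∈ s, v i x) = ∑ i ∈ s, v i := by ext x; simp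
  rw [this]
  exact (ConvS n).sum_mem hv

lemma convFin_aff (l : Vn n →L[ℝ] ℝ) (c : ℝ) : (fun x => l x + c) ∈ ConvFin n :=
  ConvexOn.add (l.toLinearMap.convexOn convex_univ) (convexOn_const c convex_univ)

lemma convFin_cont {v : Vn n → ℝ} (hv : v ∈ ConvFin n) : Continuous v :=
  (ConvexOn.locallyLipschitz hv).continuous

/-- restriction of `Z` -/
def zf (Z : (Vn n → ℝ) → ℝ) : ConvS n → ℝ := fun v => Z v.1

lemma rel_mem (Z : (Vn n → ℝ) → ℝ) (hval : IsValuationR (ConvFin n) Z)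
    (v v' a : ConvS n) (h : v.1 = v'.1 ⊔ a.1) :
    (Xm v - Xm v') * (Xm v - Xm a) ∈ Jf (zf Z) := by
  apply mem_Jf_of
  intro w
  have e : (Xm v - Xm v') * (Xm v - Xm a) * Xm w =
    Xm (v + v + w) - Xm (v + a + w) - Xm (v' + v + w) + Xm (v' + a + w) := by
    simp only [← Xm_mul]; ring
  rw [e, map_add, map_sub, map_sub, Lf_Xm, Lf_Xm, Lf_Xm, Lf_Xm]
  have hx : ∀ x, v.1 x = max (v'.1 x) (a.1 x) := fun x => by rw [h]; rfl
  have hs : (v + a + w).1 ⊔ (v' + v + w).1 = (v + v + w).1 := by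
    ext x
    simp only [AddSubmonoid.coe_add, Pi.sup_apply, Pi.add_apply, hx]
    rcases le_total (v'.1 x) (a.1 x) with h | h <;> simp [h] 
  have hi : (v + a + w).1 ⊓ (v' + v + w).1 = (v' + a + w).1 := by
    ext x
    simp only [AddSubmonoid.coe_add, Pi.inf_apply, Pi.add_apply, hx]
    rcases le_total (v'.1 x) (a.1 x) with h | h <;> simp [h]
  have := hval (v + a + w).1 (v' + v + w).1 (v + a + w).2 (v' + v + w).2
    (by rw [hs]; exact (v + v + w).2) (by rw [hi]; exact (v' + a + w).2)
  rw [hs, hi] at this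
  simp only [zf]
  linarith

lemma aff_mem (Z : (Vn n → ℝ) → ℝ) (hinv : DuallyEpiTranslationInvariant (ConvFin n) Z)
    (a : ConvS n) (l : Vn n →L[ℝ] ℝ) (c : ℝ) (h : a.1 = fun x => l x + c) :
    Xm a - 1 ∈ Jf (zf Z) := by
  apply mem_Jf_of
  intro w
  rw [sub_mul, one_mul, Xm_mul, map_sub, Lf_Xm, Lf_Xm]
  have := hinv w.1 w.2 l.toLinearMap c
  simp only [zf]
  rw [← this, sub_eq_zero]
  congr 1
  ext x
  simp only [AddSubmonoid.coe_add, Pi.add_apply, h]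
  simp; ring

/-- continuous convergence -/
def CC (V : ℕ → Vn n → ℝ) (v : Vn n → ℝ) : Prop :=
  ∀ (x : Vn n) (xk : ℕ → Vn n), Tendsto xk atTop (𝓝 x) →
    Tendsto (fun k => V k (xk k)) atTop (𝓝 (v x))

lemma CC.epi {V : ℕ → Vn n → ℝ} {v : Vn n → ℝ} (h : CC V v) : EpiConvergesR V v := by
  intro x
  refine ⟨fun xk hxk => ?_, fun _ => x, tendsto_const_nhds, h x _ tendsto_const_nhds⟩
  have := (continuous_coe_real_ereal.tendsto (v x)).comp (h x xk hxk)
  exact this.liminf_eq.ge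

lemma CC.sum {ι : Type*} (s : Finset ι) {V : ι → ℕ → Vn n → ℝ} {v : ι → Vn n → ℝ}
    (h : ∀ i ∈ s, CC (V i) (v i)) :
    CC (fun k x => ∑ i ∈ s, V i k x) (fun x => ∑ i ∈ s, v i x) := by
  intro x xk hxk
  exact tendsto_finsetSum s fun i hi => h i hi x xk hxk

/-- running maxima of affine functions -/
def pmax (l : ℕ → Vn n →L[ℝ] ℝ) (c : ℕ → ℝ) : ℕ → Vn n → ℝ
  | 0 => fun x => l 0 x + c 0
  | k + 1 => pmax l c k ⊔ fun x => l (k + 1) x + c (k + 1)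

lemma pmax_conv (l : ℕ → Vn n →L[ℝ] ℝ) (c : ℕ → ℝ) (k : ℕ) : pmax l c k ∈ ConvFin n := by
  induction k with
  | zero => exact convFin_aff _ _
  | succ k ih => exact ConvexOn.sup ih (convFin_aff _ _)

lemma pmax_rad (Z : (Vn n → ℝ) → ℝ) (hval : IsValuationR (ConvFin n) Z)
    (hinv : DuallyEpiTranslationInvariant (ConvFin n) Z)
    (l : ℕ → Vn n →L[ℝ] ℝ) (c : ℕ → ℝ) (k : ℕ) :
    Xm (⟨pmax l c k, pmax_conv l c k⟩ : ConvS n) - 1 ∈ (Jf (zf Z)).radical := by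
  induction k with
  | zero => exact Ideal.le_radical (aff_mem Z hinv _ (l 0) (c 0) rfl)
  | succ k ih =>
    set v : ConvS n := ⟨pmax l c (k + 1), pmax_conv l c (k + 1)⟩
    set v' : ConvS n := ⟨pmax l c k, pmax_conv l c k⟩
    let a : ConvS n := ⟨fun x => l (k + 1) x + c (k + 1), convFin_aff _ _⟩
    have h1 := Ideal.le_radical (rel_mem Z hval v v' a rfl)
    have h2 := Ideal.le_radical (aff_mem Z hinv a (l (k + 1)) (c (k + 1)) rfl)
    have e : (Xm v - 1) ^ 2 = (Xm v - Xm v') * (Xm v - Xm a) + (Xm v' - 1) * (Xm v - Xm a)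
      + (Xm v - 1) * (Xm a - 1) := by ring
    have h3 : (Xm v - 1) ^ 2 ∈ (Jf (zf Z)).radical := by
      rw [e]
      exact Ideal.add_mem _ (Ideal.add_mem _ h1 (Ideal.mul_mem_right _ _ ih))
        (Ideal.mul_mem_left _ _ h2)
    exact (Ideal.radical_isRadical _) ⟨2, h3⟩

lemma pmax_ge (l : ℕ → Vn n →L[ℝ] ℝ) (c : ℕ → ℝ) (i k : ℕ) (h : i ≤ k) (x : Vn n) :
    l i x + c i ≤ pmax l c k x := by
  induction k with
  | zero => obtain rfl : i = 0 := by omega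
            exact le_rfl
  | succ k ih =>
    rcases Nat.lt_or_ge k i with h' | h'
    · obtain rfl : i = k + 1 := by omega
      exact le_sup_right
    · exact (ih h').trans le_sup_left

lemma pmax_le (l : ℕ → Vn n →L[ℝ] ℝ) (c : ℕ → ℝ) (v : Vn n → ℝ)
    (h : ∀ i x, l i x + c i ≤ v x) (k : ℕ) (x : Vn n) : pmax l c k x ≤ v x := by
  induction k with
  | zero => exact h 0 x
  | succ k ih => exact sup_le ih (h _ x)

lemma exists_approx {v : Vn n → ℝ} (hv : v ∈ ConvFin n) :
    ∃ (l : ℕ → Vn n →L[ℝ] ℝ) (c : ℕ → ℝ), CC (pmax l c) v := by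
  have hc := convFin_cont hv
  obtain ⟨l, c, h1, h2⟩ := ConvexOn.real_univ_sSup_of_nat_affine_eq hc.lowerSemicontinuous hv
  have h1' : ∀ i x, l i x + c i ≤ v x := fun i x => h1 i x
  refine ⟨l, c, ?_⟩
  intro x xk hxk
  rw [tendsto_order]
  constructor
  · intro a ha
    have h3 : v x = ⨆ i, (l i x + c i) := by
      rw [← h2, iSup_apply]; rfl
    rw [h3] at ha
    obtain ⟨i, hi⟩ := exists_lt_of_lt_ciSup ha
    have ht : Tendsto (fun k => l i (xk k) + c i) atTop (𝓝 (l i x + c i)) :=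
      (((l i).continuous.tendsto x).comp hxk).add_const _
    filter_upwards [ht.eventually (lt_mem_nhds hi), eventually_ge_atTop i] with k hk hik
    exact hk.trans_le (pmax_ge l c i k hik _)
  · intro a ha
    have ht : Tendsto (fun k => v (xk k)) atTop (𝓝 (v x)) := (hc.tendsto x).comp hxk
    filter_upwards [ht.eventually (gt_mem_nhds ha)] with k hk
    exact (pmax_le l c v h1' k _).trans_lt hk

/-- alternating sum -/
def Dz (Z : (Vn n → ℝ) → ℝ) {ι : Type*} [Fintype ι] (w : ι → Vn n → ℝ) : ℝ :=
  ∑ s : Finset ι, (-1) ^ (Fintype.card ι - s.card) * Z (fun x => ∑ i ∈ s, w i x)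

lemma Dz_eq (Z : (Vn n → ℝ) → ℝ) {ι : Type*} [Fintype ι] (u : ι → ConvS n) :
    Dz Z (fun i => (u i).1) = Lf (zf Z) (∏ i, (Xm (u i) - 1)) := by
  rw [Lf_expand, Dz]
  refine Finset.sum_congr rfl fun s _ => ?_
  rw [zf]
  congr 2
  ext x
  simp

lemma Dz_tendsto (Z : (Vn n → ℝ) → ℝ) (hcont : ContinuousValR (ConvFin n) Z)
    {ι : Type*} [Fintype ι] (W : ℕ → ι → Vn n → ℝ) (w : ι → Vn n → ℝ)
    (hW : ∀ k i, W k i ∈ ConvFin n) (hw : ∀ i, w i ∈ ConvFin n)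
    (h : ∀ i, CC (fun k => W k i) (w i)) :
    Tendsto (fun k => Dz Z (W k)) atTop (𝓝 (Dz Z w)) := by
  unfold Dz
  refine tendsto_finsetSum _ fun s _ => ?_
  refine Tendsto.const_mul _ ?_
  refine hcont (fun k x => ∑ i ∈ s, W k i x) _ (fun k => convFin_sum s fun i _ => hW k i)
    (convFin_sum s fun i _ => hw i) ?_
  exact (CC.sum s (V := fun i k => W k i) fun i _ => h i).epi

lemma Dz_vanish (Z : (Vn n → ℝ) → ℝ)
    (hcont : ContinuousValR (ConvFin n) Z)
    (hval : IsValuationR (ConvFin n) Z)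
    (hinv : DuallyEpiTranslationInvariant (ConvFin n) Z)
    (m : ℕ) (hhom : HomogeneousR (ConvFin n) Z (m : ℝ))
    {ι : Type*} [Fintype ι] (hc : Fintype.card ι = m + 1)
    (w : ι → Vn n → ℝ) (hw : ∀ i, w i ∈ ConvFin n) : Dz Z w = 0 := by
  choose l c hlc using fun i => exists_approx (hw i)
  have ht := Dz_tendsto Z hcont (fun k i => pmax (l i) (c i) k) w
    (fun k i => pmax_conv _ _ _) hw hlc
  have h0 : ∀ k, Dz Z (fun i => pmax (l i) (c i) k) = 0 := by
    intro k
    have := Dz_eq Z (fun i => (⟨pmax (l i) (c i) k, pmax_conv _ _ _⟩ : ConvS n))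
    refine this.trans ?_
    refine abstract_vanish (zf Z) m ?_ _ (fun i => pmax_rad Z hval hinv _ _ _) hc
    intro a
    have := hhom a.1 a.2 2 (by norm_num)
    rw [Real.rpow_natCast] at this
    simp only [zf]
    rw [← this]
    congr 1
    ext x
    simp [two_mul]
  simp only [h0] at ht
  exact tendsto_nhds_unique ht tendsto_const_nhds |>.symm ▸ rfl

end ConvexPart

section Polar

variable {n : ℕ}

lemma Dz_perm (Z : (Vn n → ℝ) → ℝ) {ι : Type*} [Fintype ι] (σ : Equiv.Perm ι)
    (w : ι → Vn n → ℝ) : Dz Z (w ∘ σ) = Dz Z w := by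
  unfold Dz
  refine Fintype.sum_equiv σ.finsetCongr _ _ fun s => ?_
  simp [Equiv.finsetCongr_apply, Finset.sum_map]

lemma prod_upd {ι : Type*} [Fintype ι] [DecidableEq ι] (w : ι → ConvS n) (j : ι) (v : ConvS n) :
    ∏ i, (Xm (Function.update w j v i) - 1) =
      (Xm v - 1) * ∏ i ∈ Finset.univ.erase j, (Xm (w i) - 1) := by
  rw [← Finset.mul_prod_erase _ _ (Finset.mem_univ j), Function.update_self]
  congr 1
  refine Finset.prod_congr rfl fun i hi => ?_
  rw [Function.update_of_ne (Finset.ne_of_mem_erase hi)]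

lemma upd_val {ι : Type*} [DecidableEq ι] (w : ι → ConvS n) (j : ι) (v : ConvS n) :
    (fun i => (Function.update w j v i).1) = Function.update (fun i => (w i).1) j v.1 := by
  ext i x
  by_cases h : i = j
  · subst h; simp
  · simp [h]

/-- hypothesis: the `(m+1)`-st order differences vanish -/
def Van (n : ℕ) (Z : (Vn n → ℝ) → ℝ) (m : ℕ) : Prop :=
  ∀ w : Option (Fin m) → Vn n → ℝ, (∀ i, w i ∈ ConvFin n) → Dz Z w = 0

lemma Dz_add (Z : (Vn n → ℝ) → ℝ) (m : ℕ) (hV : Van n Z m)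
    (w : Fin m → Vn n → ℝ) (hw : ∀ i, w i ∈ ConvFin n) (j : Fin m) (v v' : Vn n → ℝ)
    (hv : v ∈ ConvFin n) (hv' : v' ∈ ConvFin n) :
    Dz Z (Function.update w j (fun x => v x + v' x)) =
      Dz Z (Function.update w j v) + Dz Z (Function.update w j v') := by
  let W : Fin m → ConvS n := fun i => ⟨w i, hw i⟩
  let a : ConvS n := ⟨v, hv⟩
  let b : ConvS n := ⟨v', hv'⟩
  have key : ∀ c : ConvS n, Dz Z (Function.update w j c.1) =
      Lf (zf Z) ((Xm c - 1) * ∏ i ∈ Finset.univ.erase j, (Xm (W i) - 1)) := by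
    intro c
    rw [← prod_upd, ← Dz_eq, upd_val]
  have h1 := key (a + b)
  have h2 := key a
  have h3 := key b
  have h4 := hV (fun i => ((i.elim b (Function.update W j a) : ConvS n)).1) (fun i => (i.elim b (Function.update W j a) : ConvS n).2)
  rw [Dz_eq, Fintype.prod_option] at h4
  simp only [Option.elim] at h4
  rw [prod_upd] at h4
  have e : (a + b).1 = fun x => v x + v' x := rfl
  rw [e] at h1
  rw [h1]
  change _ = Dz Z (Function.update w j a.1) + Dz Z (Function.update w j b.1)
  rw [h2, h3, ← map_add, ← sub_eq_zero, ← map_sub, ← h4]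
  congr 1
  rw [← Xm_mul]
  ring

lemma CC_smul {v : Vn n → ℝ} (hv : v ∈ ConvFin n) {t : ℕ → ℝ} {t₀ : ℝ}
    (ht : Tendsto t atTop (𝓝 t₀)) : CC (fun k x => t k * v x) (fun x => t₀ * v x) := by
  intro x xk hxk
  exact ht.mul (((convFin_cont hv).tendsto x).comp hxk)

lemma CC_const {v : Vn n → ℝ} (hv : v ∈ ConvFin n) : CC (fun _ => v) v := by
  intro x xk hxk
  exact (((convFin_cont hv).tendsto x).comp hxk)

lemma upd_conv {m : ℕ} {w : Fin m → Vn n → ℝ} (hw : ∀ i, w i ∈ ConvFin n) (j : Fin m)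
    {v : Vn n → ℝ} (hv : v ∈ ConvFin n) (i : Fin m) : Function.update w j v i ∈ ConvFin n := by
  by_cases h : i = j
  · subst h; simpa using hv
  · simpa [h] using hw i

/-- continuous additive functions on the half line are linear -/
lemma half_linear (g : ℝ → ℝ) (hadd : ∀ s t, 0 ≤ s → 0 ≤ t → g (s + t) = g s + g t)
    (hc : Continuous fun t => g (max t 0)) (t : ℝ) (ht : 0 ≤ t) : g t = t * g 1 := by
  have h0 : g 0 = 0 := by have := hadd 0 0 le_rfl le_rfl; simp at this; exact this
  let G : ℝ →+ ℝ :=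
    { toFun := fun t => g (max t 0) - g (max (-t) 0)
      map_zero' := by simp
      map_add' := by
        intro s t
        have e : max (s + t) 0 + (max (-s) 0 + max (-t) 0) =
            max (-(s + t)) 0 + (max s 0 + max t 0) := by
          rcases max_cases (s + t) 0 with h1 | h1 <;> rcases max_cases (-(s + t)) 0 with h2 | h2 <;>
          rcases max_cases s 0 with h3 | h3 <;> rcases max_cases (-s) 0 with h4 | h4 <;>
          rcases max_cases t 0 with h5 | h5 <;> rcases max_cases (-t) 0 with h6 | h6 <;> linarith
        have := congrArg g e
        rw [hadd _ _ (le_max_right _ _) (by positivity), hadd _ _ (le_max_right _ _) (le_max_right _ _),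
          hadd _ _ (le_max_right _ _) (by positivity), hadd _ _ (le_max_right _ _) (le_max_right _ _)] at this
        linarith }
  have hG : Continuous G := hc.sub (hc.comp continuous_neg)
  have h1 := map_real_smul G hG t 1
  have e1 : ∀ s, 0 ≤ s → G s = g s := by
    intro s hs
    change g (max s 0) - g (max (-s) 0) = g s
    rw [max_eq_left hs, max_eq_right (by linarith), h0, sub_zero]
  simp only [smul_eq_mul, mul_one] at h1
  rwa [e1 t ht, e1 1 zero_le_one] at h1

lemma Dz_smul (Z : (Vn n → ℝ) → ℝ) (hcont : ContinuousValR (ConvFin n) Z) (m : ℕ) (hV : Van n Z m)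
    (w : Fin m → Vn n → ℝ) (hw : ∀ i, w i ∈ ConvFin n) (j : Fin m) (v : Vn n → ℝ)
    (hv : v ∈ ConvFin n) (t : ℝ) (ht : 0 ≤ t) :
    Dz Z (Function.update w j (fun x => t * v x)) = t * Dz Z (Function.update w j v) := by
  have := half_linear (fun t => Dz Z (Function.update w j (fun x => t * v x))) ?_ ?_ t ht
  · simpa using this
  · intro a b ha hb
    have := Dz_add Z m hV w hw j _ _ (convFin_smul hv ha) (convFin_smul hv hb)
    simp only [← this, add_mul]
  · rw [continuous_iff_seqContinuous]
    intro s s₀ hs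
    have hs' : Tendsto (fun k => max (s k) 0) atTop (𝓝 (max s₀ 0)) :=
      ((continuous_id.max continuous_const).tendsto s₀).comp hs
    refine Dz_tendsto Z hcont _ _ (fun k i => upd_conv hw j (convFin_smul hv (le_max_right _ _)) i)
      (fun i => upd_conv hw j (convFin_smul hv (le_max_right _ _)) i) ?_
    intro i
    by_cases h : i = j
    · subst h; simpa using CC_smul hv hs'
    · simpa [h] using CC_const (hw i)

lemma Dz_lin (Z : (Vn n → ℝ) → ℝ) (hcont : ContinuousValR (ConvFin n) Z) (m : ℕ) (hV : Van n Z m)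
    (w : Fin m → Vn n → ℝ) (hw : ∀ i, w i ∈ ConvFin n) (j : Fin m) (v v' : Vn n → ℝ)
    (hv : v ∈ ConvFin n) (hv' : v' ∈ ConvFin n) (α β : ℝ) (hα : 0 ≤ α) (hβ : 0 ≤ β) :
    Dz Z (Function.update w j (fun x => α * v x + β * v' x)) =
      α * Dz Z (Function.update w j v) + β * Dz Z (Function.update w j v') := by
  rw [Dz_add Z m hV w hw j _ _ (convFin_smul hv hα) (convFin_smul hv' hβ),
    Dz_smul Z hcont m hV w hw j v hv α hα, Dz_smul Z hcont m hV w hw j v' hv' β hβ]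

def CML (n m : ℕ) (B : (Fin m → Vn n → ℝ) → ℝ) : Prop :=
  ∀ (w : Fin m → Vn n → ℝ), (∀ j, w j ∈ ConvFin n) →
        ∀ (j : Fin m) (v v' : Vn n → ℝ), v ∈ ConvFin n → v' ∈ ConvFin n →
          ∀ α β : ℝ, 0 ≤ α → 0 ≤ β →
            B (Function.update w j (fun x => α * v x + β * v' x)) =
              α * B (Function.update w j v) + β * B (Function.update w j v')

lemma CML.sum {m : ℕ} {B : (Fin m → Vn n → ℝ) → ℝ} (hB : CML n m B)
    (w : Fin m → Vn n → ℝ) (hw : ∀ j, w j ∈ ConvFin n) (j : Fin m)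
    {ι : Type*} (s : Finset ι) (v : ι → Vn n → ℝ) (hv : ∀ i, v i ∈ ConvFin n)
    (l : ι → ℝ) (hl : ∀ i, 0 ≤ l i) :
    B (Function.update w j (fun x => ∑ i ∈ s, l i * v i x)) =
      ∑ i ∈ s, l i * B (Function.update w j (v i)) := by
  classical
  induction s using Finset.induction_on with
  | empty =>
    have := hB w hw j (fun _ => 0) (fun _ => 0) convFin_zero convFin_zero 0 0 le_rfl le_rfl
    simpa using this
  | insert a s ha ih =>
    simp only [Finset.sum_insert ha]
    have := hB w hw j (v a) (fun x => ∑ i ∈ s, l i * v i x) (hv a)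
      (convFin_sum s fun i _ => convFin_smul (hv i) (hl i)) (l a) 1 (hl a) zero_le_one
    simp only [one_mul] at this
    rw [this, ih]

lemma CML.expand {ι : Type*} [Fintype ι] (v : ι → Vn n → ℝ) (hv : ∀ i, v i ∈ ConvFin n)
    (l : ι → ℝ) (hl : ∀ i, 0 ≤ l i) (m : ℕ) :
    ∀ {B : (Fin m → Vn n → ℝ) → ℝ}, CML n m B →
    B (fun _ => fun x => ∑ i, l i * v i x) =
      ∑ f : Fin m → ι, (∏ j, l (f j)) * B (fun j => v (f j)) := by
  induction m with
  | zero =>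
    intro B hB
    simp only [Finset.univ_unique, Finset.univ_eq_empty, Finset.prod_empty, one_mul, Finset.sum_singleton]
    congr 1
    ext j; exact j.elim0
  | succ m ih =>
    intro B hB
    set S : Vn n → ℝ := fun x => ∑ i, l i * v i x with hS
    have hSc : S ∈ ConvFin n := convFin_sum _ fun i _ => convFin_smul (hv i) (hl i)
    have h1 := hB.sum (fun _ => S) (fun _ => hSc) 0 Finset.univ v hv l hl
    have hu : ∀ u : Vn n → ℝ, Function.update (fun _ : Fin (m + 1) => S) 0 u = Fin.cons u (fun _ => S) := by
      intro u; ext i x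
      refine Fin.cases ?_ (fun i => ?_) i <;> simp
    have h2 : (fun _ : Fin (m + 1) => S) = Function.update (fun _ : Fin (m + 1) => S) 0 S := by simp
    rw [h2, h1]
    simp only [hu]
    have h3 : ∀ i, CML n m (fun w => B (Fin.cons (v i) w)) := by
      intro i w hw j a b ha hb α β hα hβ
      have := hB (Fin.cons (v i) w) (fun q => by
        refine Fin.cases ?_ (fun q => ?_) q
        · simpa using hv i
        · simpa using hw q) j.succ a b ha hb α β hα hβ
      simpa only [Fin.cons_update] using this
    have h4 : ∀ i, B (Fin.cons (v i) (fun _ => S)) = _ := fun i => ih (h3 i)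
    simp only [h4]
    rw [← (Fin.consEquiv (fun _ : Fin (m + 1) => ι)).sum_comp, Fintype.sum_prod_type]
    refine Finset.sum_congr rfl fun i _ => ?_
    rw [Finset.mul_sum]
    refine Finset.sum_congr rfl fun f _ => ?_
    simp only [Fin.consEquiv_apply, Fin.prod_univ_succ, Fin.cons_zero, Fin.cons_succ]
    rw [← mul_assoc]
    congr 2
    ext q x
    refine Fin.cases ?_ (fun q => ?_) q <;> simp

lemma CML.scale {m : ℕ} {B : (Fin m → Vn n → ℝ) → ℝ} (hB : CML n m B)
    (w : Fin m → Vn n → ℝ) (hw : ∀ j, w j ∈ ConvFin n) (t : ℝ) (ht : 0 ≤ t) (s : Finset (Fin m)) :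
    B (fun j => if j ∈ s then (fun x => t * w j x) else w j) = t ^ s.card * B w := by
  induction s using Finset.induction_on with
  | empty => simp
  | insert a s ha ih =>
    rw [Finset.card_insert_of_notMem ha, pow_succ, mul_comm _ t, mul_assoc, ← ih]
    set W : Fin m → Vn n → ℝ := fun j => if j ∈ s then (fun x => t * w j x) else w j with hW
    have hWc : ∀ j, W j ∈ ConvFin n := by
      intro j
      by_cases h : j ∈ s
      · simpa [hW, h] using convFin_smul (hw j) ht
      · simpa [hW, h] using hw j
    have := hB W hWc a (w a) (w a) (hw a) (hw a) t 0 ht le_rfl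
    have e : Function.update W a (w a) = W := by
      have : W a = w a := by simp [hW, ha]
      rw [← this, Function.update_eq_self]
    rw [e] at this
    simp only [zero_mul, add_zero] at this
    rw [← this]
    congr 1
    ext j x
    by_cases h : j = a
    · subst h; simp
    · simp [h, hW]

lemma Dz_diag (Z : (Vn n → ℝ) → ℝ) (m : ℕ) (hm : 1 ≤ m)
    (hhom : HomogeneousR (ConvFin n) Z (m : ℝ)) (v : Vn n → ℝ) (hv : v ∈ ConvFin n) :
    Dz Z (fun _ : Fin m => v) = m.factorial * Z v := by
  have hn : ∀ k : ℕ, Z (fun x => (k : ℝ) * v x) = (k : ℝ) ^ m * Z v := by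
    intro k
    rcases Nat.eq_zero_or_pos k with rfl | hk
    · have h := hhom (fun _ => 0) convFin_zero 2 (by norm_num)
      rw [Real.rpow_natCast] at h
      simp only [mul_zero] at h
      have h2 : (1 : ℝ) < 2 ^ m := one_lt_pow₀ (by norm_num) (by omega)
      have : Z (fun _ => 0) = 0 := by
        have : ((2 : ℝ) ^ m - 1) * Z (fun _ => 0) = 0 := by linarith
        rcases mul_eq_zero.1 this with h | h
        · linarith
        · exact h
      simp only [Nat.cast_zero, zero_mul, this]
      rw [zero_pow (by omega), zero_mul]
    · have h := hhom v hv k (by exact_mod_cast hk)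
      rwa [Real.rpow_natCast] at h
  unfold Dz
  simp only [Finset.sum_const, nsmul_eq_mul, hn, Fintype.card_fin]
  have h1 := congrFun (fwdDiff_iter_eq_factorial (R := ℝ) (n := m)) 0
  rw [fwdDiff_iter_eq_sum_shift] at h1
  have h2 := Finset.sum_powerset_apply_card (x := (Finset.univ : Finset (Fin m)))
    (fun k => (-1 : ℝ) ^ (m - k) * ((k : ℝ) ^ m * Z v))
  rw [Finset.powerset_univ] at h2
  rw [h2]
  simp only [Finset.card_univ, Fintype.card_fin]
  have h1' : (m.factorial : ℝ) =
      ∑ k ∈ Finset.range (m + 1), ((-1 : ℝ) ^ (m - k) * (m.choose k : ℝ)) * (k : ℝ) ^ m := by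
    have h0 : ((m.factorial : ℝ → ℝ)) 0 = (m.factorial : ℝ) := rfl
    rw [← h0, ← h1]
    refine Finset.sum_congr rfl fun k _ => ?_
    simp
  rw [h1', Finset.sum_mul]
  refine Finset.sum_congr rfl fun k _ => ?_
  rw [nsmul_eq_mul]
  ring

end Polar

section Comb

variable {n : ℕ}

/-- multiplicities of the values of `f` -/
def cnt {k m : ℕ} (f : Fin m → Fin k) : Fin k → ℕ := ∑ j, Pi.single (f j) 1

lemma cnt_apply {k m : ℕ} (f : Fin m → Fin k) (i : Fin k) :
    cnt f i = (Finset.univ.filter fun j => f j = i).card := by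
  simp only [cnt, Finset.sum_apply, Pi.single_apply, Finset.card_filter]
  refine Finset.sum_congr rfl fun j _ => ?_
  simp [eq_comm]

lemma cnt_sum {k m : ℕ} (f : Fin m → Fin k) : ∑ i, cnt f i = m := by
  simp only [cnt, Finset.sum_apply]
  rw [Finset.sum_comm]
  simp

lemma prod_cnt {k m : ℕ} (f : Fin m → Fin k) (l : Fin k → ℝ) :
    ∏ j, l (f j) = ∏ i, l i ^ cnt f i := by
  rw [← Finset.prod_fiberwise_of_maps_to (t := Finset.univ) (g := f) (fun _ _ => Finset.mem_univ _)]
  refine Finset.prod_congr rfl fun i _ => ?_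
  rw [cnt_apply, ← Finset.prod_const]
  refine Finset.prod_congr rfl fun j hj => ?_
  rw [(Finset.mem_filter.1 hj).2]

lemma sum_cnt {k m : ℕ} (z : (Fin k → ℕ) → ℝ) :
    ∑ f : Fin m → Fin k, z (cnt f) =
      ∑ d ∈ Finset.Nat.antidiagonalTuple k m, (Nat.multinomial Finset.univ d : ℝ) * z d := by
  let x : Fin k → AddMonoidAlgebra ℝ (Fin k → ℕ) := fun i => Xm (Pi.single i 1)
  have h1 : (∑ i, x i) ^ m = ∑ f : Fin m → Fin k, Xm (cnt f) := by
    rw [Fintype.sum_pow]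
    refine Finset.sum_congr rfl fun f _ => ?_
    rw [Xm_sum]; rfl
  have h2 := Finset.sum_pow_eq_sum_piAntidiag Finset.univ x m
  have hx : ∀ (i : Fin k) (e : ℕ), x i ^ e = Xm (Pi.single i e) := by
    intro i e
    induction e with
    | zero => simp [Xm_zero]
    | succ e ih => rw [pow_succ, ih, Xm_mul, ← Pi.single_add]
  have h3 : Finset.piAntidiag Finset.univ m = Finset.Nat.antidiagonalTuple k m := by
    ext d
    simp [Finset.mem_piAntidiag, Finset.Nat.mem_antidiagonalTuple]
  have h4 : ∀ d : Fin k → ℕ, ∏ i, x i ^ d i = Xm d := by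
    intro d
    simp only [hx]
    rw [Xm_sum, Finset.univ_sum_single]
  rw [h1, h3] at h2
  simp only [h4] at h2
  have h5 := congrArg (Lf z) h2
  rw [map_sum, map_sum] at h5
  simp only [Lf_Xm] at h5
  rw [h5]
  refine Finset.sum_congr rfl fun d _ => ?_
  rw [← nsmul_eq_mul, map_nsmul, Lf_Xm, nsmul_eq_mul]

lemma exists_perm {k m : ℕ} (f g : Fin m → Fin k) (h : cnt f = cnt g) :
    ∃ σ : Equiv.Perm (Fin m), g ∘ σ = f := by
  have e : ∀ i, Nonempty ({a // f a = i} ≃ {b // g b = i}) := by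
    intro i
    refine ⟨Fintype.equivOfCardEq ?_⟩
    rw [Fintype.card_subtype, Fintype.card_subtype, ← cnt_apply, ← cnt_apply, h]
  let e' : ∀ i, ({a // f a = i} ≃ {b // g b = i}) := fun i => (e i).some
  exact ⟨Equiv.ofFiberEquiv e', funext fun a => Equiv.ofFiberEquiv_map e' a⟩

lemma repTuple_eq {k m : ℕ} (d : Fin k → ℕ) (hd : ∑ i, d i = m) (v : Fin k → Vn n → ℝ) :
    ∃ g : Fin m → Fin k, cnt g = d ∧ repTupleR k m d v = fun j => v (g j) := by
  set L : List (Fin k) := (List.finRange k).flatMap fun j => List.replicate (d j) j with hL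
  have hlen : L.length = m := by
    rw [hL, List.length_flatMap, ← hd]
    simp [← List.ofFn_eq_map, List.sum_ofFn]
  have hcount : ∀ i, L.count i = d i := by
    intro i
    rw [hL, List.count_flatMap]
    have : (List.count i ∘ fun j => List.replicate (d j) j) = fun j => if j = i then d j else 0 := by
      ext j
      simp [List.count_replicate]
    rw [this, ← List.ofFn_eq_map, List.sum_ofFn]
    simp
  refine ⟨fun j => L.get (j.cast hlen.symm), ?_, ?_⟩
  · ext i
    rw [cnt_apply, ← hcount i]
    exact Fin.card_filter_univ_eq_vector_get_eq_count i ⟨L, hlen⟩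
  · funext x
    unfold repTupleR
    have : ((List.finRange k).flatMap fun j => List.replicate (d j) (v j)) = L.map v := by
      rw [hL, List.map_flatMap]
      simp
    rw [this]
    have hx : (x : ℕ) < (L.map v).length := by rw [List.length_map, hlen]; exact x.2
    rw [List.getD_eq_getElem _ _ hx]
    simp

end Comb

section Rest

variable {n : ℕ}

lemma repConcat_sum (m i : ℕ) (rest : Fin (m - i) → Vn n → ℝ) (hr : ∀ j, rest j ∈ ConvFin n)
    (s : Finset (Fin m)) : ∃ a : ℝ, 0 ≤ a ∧ ∃ C ∈ ConvFin n, ∀ v : Vn n → ℝ,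
      (fun x => ∑ j ∈ s, repConcatR m i v rest j x) = fun x => a * v x + C x := by
  induction s using Finset.induction_on with
  | empty => exact ⟨0, le_rfl, fun _ => 0, convFin_zero, fun v => by simp⟩
  | insert j s hj ih =>
    obtain ⟨a, ha, C, hC, h⟩ := ih
    by_cases hji : (j : ℕ) < i
    · refine ⟨a + 1, by positivity, C, hC, fun v => ?_⟩
      ext x
      rw [Finset.sum_insert hj, congrFun (h v) x]
      simp only [repConcatR, hji, dite_true]
      ring
    · refine ⟨a, ha, fun x => rest ⟨j - i, by have := j.isLt; omega⟩ x + C x,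
        convFin_add (hr _) hC, fun v => ?_⟩
      ext x
      rw [Finset.sum_insert hj, congrFun (h v) x]
      simp only [repConcatR, hji, dite_false]
      ring

lemma epi_aff {vk : ℕ → Vn n → ℝ} {v : Vn n → ℝ} (h : EpiConvergesR vk v) {a : ℝ} (ha : 0 ≤ a)
    {C : Vn n → ℝ} (hC : C ∈ ConvFin n) :
    EpiConvergesR (fun k x => a * vk k x + C x) (fun x => a * v x + C x) := by
  intro x
  obtain ⟨h1, xk, hxk, h2⟩ := h x
  have hCt : ∀ xk : ℕ → Vn n, Tendsto xk atTop (𝓝 x) →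
      Tendsto (fun k => C (xk k)) atTop (𝓝 (C x)) := fun xk hxk =>
    ((convFin_cont hC).tendsto x).comp hxk
  refine ⟨fun yk hyk => ?_, xk, hxk, (h2.const_mul a).add (hCt xk hxk)⟩
  have h3 := h1 yk hyk
  rw [le_liminf_iff] at h3 ⊢
  intro b hb
  obtain ⟨r, hr1, hr2⟩ := EReal.lt_iff_exists_real_btwn.1 hb
  have hr2' : r < a * v x + C x := by exact_mod_cast hr2
  set ε := a * v x + C x - r with hε
  have hεp : 0 < ε := by linarith
  have hδ : 0 < ε / (2 * (a + 1)) := by positivity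
  have e1 := h3 ((v x - ε / (2 * (a + 1)) : ℝ) : EReal) (by exact_mod_cast (by linarith))
  have e2 := (hCt yk hyk).eventually (lt_mem_nhds (show C x - ε / 2 < C x by linarith))
  filter_upwards [e1, e2] with k hk1 hk2
  refine hr1.trans ?_
  have hk1' : v x - ε / (2 * (a + 1)) < vk k (yk k) := by exact_mod_cast hk1
  have h5 : a * (v x - ε / (2 * (a + 1))) ≤ a * vk k (yk k) :=
    mul_le_mul_of_nonneg_left hk1'.le ha
  have h6 : a * (ε / (2 * (a + 1))) ≤ ε / 2 := by
    have : (a + 1) * (ε / (2 * (a + 1))) = ε / 2 := by field_simp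
    nlinarith
  have : r < a * vk k (yk k) + C (yk k) := by
    rw [mul_sub] at h5
    linarith
  exact_mod_cast this

lemma rest_cont (Z : (Vn n → ℝ) → ℝ) (hcont : ContinuousValR (ConvFin n) Z) (m i : ℕ)
    (rest : Fin (m - i) → Vn n → ℝ) (hr : ∀ j, rest j ∈ ConvFin n) :
    ContinuousValR (ConvFin n) (fun v => Dz Z (repConcatR m i v rest)) := by
  intro vk v hvk hv hepi
  unfold Dz
  refine tendsto_finsetSum _ fun s _ => Tendsto.const_mul _ ?_
  obtain ⟨a, ha, C, hC, h⟩ := repConcat_sum m i rest hr s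
  simp only [h]
  exact hcont _ _ (fun k => convFin_add (convFin_smul (hvk k) ha) hC)
    (convFin_add (convFin_smul hv ha) hC) (epi_aff hepi ha hC)

lemma rest_val (Z : (Vn n → ℝ) → ℝ) (hval : IsValuationR (ConvFin n) Z) (m i : ℕ)
    (rest : Fin (m - i) → Vn n → ℝ) (hr : ∀ j, rest j ∈ ConvFin n) :
    IsValuationR (ConvFin n) (fun v => Dz Z (repConcatR m i v rest)) := by
  intro u v hu hv hs hi
  simp only [Dz]
  rw [← Finset.sum_add_distrib, ← Finset.sum_add_distrib]
  refine Finset.sum_congr rfl fun s _ => ?_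
  rw [← mul_add, ← mul_add]
  congr 1
  obtain ⟨a, ha, C, hC, h⟩ := repConcat_sum m i rest hr s
  simp only [h]
  have e1 : (fun x => a * u x + C x) ⊔ (fun x => a * v x + C x) =
      fun x => a * (u ⊔ v) x + C x := by
    ext x
    simp only [Pi.sup_apply]
    rw [mul_max_of_nonneg _ _ ha, max_add_add_right]
  have e2 : (fun x => a * u x + C x) ⊓ (fun x => a * v x + C x) =
      fun x => a * (u ⊓ v) x + C x := by
    ext x
    simp only [Pi.inf_apply]
    rw [mul_min_of_nonneg _ _ ha, min_add_add_right]
  have := hval (fun x => a * u x + C x) (fun x => a * v x + C x)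
    (convFin_add (convFin_smul hu ha) hC) (convFin_add (convFin_smul hv ha) hC)
    (by rw [e1]; exact convFin_add (convFin_smul hs ha) hC)
    (by rw [e2]; exact convFin_add (convFin_smul hi ha) hC)
  rwa [e1, e2] at this

lemma rest_inv (Z : (Vn n → ℝ) → ℝ) (hinv : DuallyEpiTranslationInvariant (ConvFin n) Z) (m i : ℕ)
    (rest : Fin (m - i) → Vn n → ℝ) (hr : ∀ j, rest j ∈ ConvFin n) :
    DuallyEpiTranslationInvariant (ConvFin n) (fun v => Dz Z (repConcatR m i v rest)) := by
  intro v hv l c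
  simp only [Dz]
  refine Finset.sum_congr rfl fun s _ => ?_
  congr 1
  obtain ⟨a, ha, C, hC, h⟩ := repConcat_sum m i rest hr s
  simp only [h]
  rw [← hinv (fun x => a * v x + C x) (convFin_add (convFin_smul hv ha) hC) (a • l) (a * c)]
  congr 1
  ext x
  simp
  ring

end Rest

/-- **Polynomiality on `Conv(ℝⁿ;ℝ)`** (Theorem 6.3): a continuous, dually
epi-translation invariant valuation `Z` on `Conv(ℝⁿ;ℝ)` that is homogeneous
of degree `m ∈ {1,…,n}` admits a symmetric polarization `Z̄` such that
`Z(λ₁ v₁ + ⋯ + λ_k v_k)` expands as a homogeneous polynomial of degree `m` in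
`λ₁, …, λ_k` with coefficients `Z̄(v₁[i₁], …, v_k[i_k])`; moreover `Z̄` is
additive in each variable, and `v ↦ Z̄(v[i], v_{i+1}, …, v_m)` is a continuous
and dually epi-translation invariant valuation that is homogeneous of
degree `i`. -/
theorem polynomiality_finite (n : ℕ) (Z : (Vn n → ℝ) → ℝ)
    (hcont : ContinuousValR (ConvFin n) Z)
    (hval : IsValuationR (ConvFin n) Z)
    (hinv : DuallyEpiTranslationInvariant (ConvFin n) Z)
    (m : ℕ) (hm1 : 1 ≤ m) (hmn : m ≤ n)
    (hhom : HomogeneousR (ConvFin n) Z (m : ℝ)) :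
    ∃ Zb : (Fin m → Vn n → ℝ) → ℝ,
      -- symmetry
      (∀ (σ : Equiv.Perm (Fin m)) (w : Fin m → Vn n → ℝ),
        Zb (w ∘ σ) = Zb w) ∧
      -- polynomial expansion
      (∀ (k : ℕ) (v : Fin k → Vn n → ℝ), (∀ i, v i ∈ ConvFin n) →
        ∀ l : Fin k → ℝ, (∀ i, 0 ≤ l i) →
          Z (fun x => ∑ i, l i * v i x) =
            ∑ d ∈ Finset.Nat.antidiagonalTuple k m,
              (Nat.multinomial Finset.univ d : ℝ) * (∏ i, l i ^ d i) *
                Zb (repTupleR k m d v)) ∧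
      -- additivity in each variable
      (∀ (w : Fin m → Vn n → ℝ), (∀ j, w j ∈ ConvFin n) →
        ∀ (j : Fin m) (v v' : Vn n → ℝ), v ∈ ConvFin n → v' ∈ ConvFin n →
          ∀ α β : ℝ, 0 ≤ α → 0 ≤ β →
            Zb (Function.update w j (fun x => α * v x + β * v' x)) =
              α * Zb (Function.update w j v) + β * Zb (Function.update w j v')) ∧
      (∀ i : ℕ, 1 ≤ i → i ≤ m → ∀ rest : Fin (m - i) → Vn n → ℝ,
        (∀ j, rest j ∈ ConvFin n) →
          ContinuousValR (ConvFin n) (fun v => Zb (repConcatR m i v rest)) ∧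
          IsValuationR (ConvFin n) (fun v => Zb (repConcatR m i v rest)) ∧
          DuallyEpiTranslationInvariant (ConvFin n)
            (fun v => Zb (repConcatR m i v rest)) ∧
          HomogeneousR (ConvFin n) (fun v => Zb (repConcatR m i v rest)) (i : ℝ)) := by
  classical
  have hV : Van n Z m := fun w hw => Dz_vanish Z hcont hval hinv m hhom (by simp) w hw
  have hf : (m.factorial : ℝ) ≠ 0 := by exact_mod_cast m.factorial_ne_zero
  have hB : CML n m (fun w => (m.factorial : ℝ)⁻¹ * Dz Z w) := by
    intro w hw j v v' hv hv' α β hα hβ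
    simp only [Dz_lin Z hcont m hV w hw j v v' hv hv' α β hα hβ]
    ring
  have hsymm : ∀ (σ : Equiv.Perm (Fin m)) (w : Fin m → Vn n → ℝ),
      (m.factorial : ℝ)⁻¹ * Dz Z (w ∘ σ) = (m.factorial : ℝ)⁻¹ * Dz Z w := by
    intro σ w
    rw [Dz_perm]
  refine ⟨fun w => (m.factorial : ℝ)⁻¹ * Dz Z w, hsymm, ?_, hB, ?_⟩
  · intro k v hv l hl
    have h1 := hB.expand v hv l hl
    have h2 := Dz_diag Z m hm1 hhom (fun x => ∑ i, l i * v i x)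
      (convFin_sum _ fun i _ => convFin_smul (hv i) (hl i))
    rw [h2, inv_mul_cancel_left₀ hf] at h1
    rw [h1]
    have h3 := sum_cnt (m := m) (fun d : Fin k → ℕ => (∏ i, l i ^ d i) *
      ((m.factorial : ℝ)⁻¹ * Dz Z (repTupleR k m d v)))
    simp only [← mul_assoc] at h3 ⊢
    rw [← h3]
    refine Finset.sum_congr rfl fun f _ => ?_
    rw [prod_cnt, mul_assoc, mul_assoc]
    congr 1
    obtain ⟨g, hg, hgv⟩ := repTuple_eq (cnt f) (cnt_sum f) v
    obtain ⟨σ, hσ⟩ := exists_perm f g hg.symm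
    rw [hgv, ← hsymm σ (fun j => v (g j))]
    congr 2
    ext j
    rw [← hσ]
    rfl
  · intro i hi him rest hr
    refine ⟨?_, ?_, ?_, ?_⟩
    · intro vk v hvk hv hepi
      exact (rest_cont Z hcont m i rest hr vk v hvk hv hepi).const_mul _
    · intro u v hu hv hs hi
      have := rest_val Z hval m i rest hr u v hu hv hs hi
      simp only at this ⊢
      rw [← mul_add, this, mul_add]
    · intro v hv ℓ c
      have := rest_inv Z hinv m i rest hr v hv ℓ c
      simp only at this ⊢
      rw [this]
    · intro v hv t ht
      have hw : ∀ j, repConcatR m i v rest j ∈ ConvFin n := by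
        intro j
        unfold repConcatR
        split_ifs
        · exact hv
        · exact hr _
      have h1 := hB.scale _ hw t ht.le (Finset.univ.filter fun j : Fin m => (j : ℕ) < i)
      have hcard : (Finset.univ.filter fun j : Fin m => (j : ℕ) < i).card = i := by
        rw [Fin.card_filter_val_lt, min_eq_right him]
      rw [hcard] at h1
      simp only at h1 ⊢
      rw [Real.rpow_natCast, ← h1]
      congr 2
      ext j x
      by_cases hj : (j : ℕ) < i <;> simp [repConcatR, hj]
end
end

section
/- Every continuous and epi-translation invariant valuation Z : Conv_coe(ℝⁿ) → ℝ is constant. -/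
open Filter Topology MeasureTheory

noncomputable section

/-- `Conv_coe(ℝⁿ)`: coercive elements of `Conv(ℝⁿ)`, i.e.
`u(x) → +∞` as `|x| → +∞`. -/
def ConvCoe (n : ℕ) : Set (Vn n → EReal) :=
  {u | u ∈ ConvSet n ∧
    ∀ M : ℝ, ∃ R : ℝ, ∀ x : Vn n, R ≤ ‖x‖ → (M : EReal) ≤ u x}

/-! ### Helper lemmas -/

theorem add_le_iff' (v : EReal) (c a : ℝ) : v + (c : EReal) ≤ (a : EReal) ↔ v ≤ ((a - c : ℝ) : EReal) := by
  induction v using EReal.rec with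
  | bot => simp
  | top =>
    rw [EReal.top_add_coe, top_le_iff, top_le_iff]
    exact ⟨fun h => absurd h (EReal.coe_ne_top _), fun h => absurd h (EReal.coe_ne_top _)⟩
  | coe v =>
    norm_cast
    constructor <;> intro h <;> linarith

theorem ereal_ext_real {v w : EReal} (h : ∀ a : ℝ, v ≤ (a : EReal) ↔ w ≤ (a : EReal)) : v = w := by
  have key : ∀ v w : EReal, (∀ a : ℝ, v ≤ (a : EReal) → w ≤ (a : EReal)) → w ≤ v := by
    intro v w h
    exact EReal.le_of_forall_lt_iff_le.1 fun z hz => h z hz.le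
  exact le_antisymm (key _ _ fun a => (h a).2) (key _ _ fun a => (h a).1)

/-- Real-sublevel description of `ConvCoe`. -/
theorem mk_coe {n : ℕ} {u : Vn n → EReal}
    (hC : ∀ x y : Vn n, ∀ a b t : ℝ, 0 ≤ t → t ≤ 1 → u x ≤ (a : EReal) → u y ≤ (b : EReal) →
      u (t • x + (1 - t) • y) ≤ ((t * a + (1 - t) * b : ℝ) : EReal))
    (hL : ∀ a : ℝ, IsClosed {x | u x ≤ (a : EReal)})
    (hB : ∃ m : ℝ, ∀ x, (m : EReal) ≤ u x)
    (hP : ∃ x, ∃ a : ℝ, u x ≤ (a : EReal))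
    (hK : ∀ a : ℝ, ∃ R : ℝ, ∀ x, u x ≤ (a : EReal) → ‖x‖ ≤ R) : u ∈ ConvCoe n := by
  obtain ⟨m, hm⟩ := hB
  have hbot : ∀ x, u x ≠ ⊥ := fun x h => by
    have := hm x
    rw [h] at this
    simp at this
  refine ⟨⟨?_, ?_, hbot, ?_⟩, ?_⟩
  · intro x y t h0 h1
    have h1' : (0 : ℝ) < 1 - t := by linarith
    have hb1 := hbot x
    have hb2 := hbot y
    have key := hC x y
    generalize u x = p at *
    generalize u y = q at *
    induction p using EReal.rec with
    | bot => exact absurd rfl hb1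
    | top =>
      rw [EReal.coe_mul_top_of_pos h0, EReal.top_add_of_ne_bot]
      · exact le_top
      · induction q using EReal.rec with
        | bot => exact absurd rfl hb2
        | top => rw [EReal.coe_mul_top_of_pos h1']; simp
        | coe q => rw [← EReal.coe_mul]; exact EReal.coe_ne_bot _
    | coe p =>
      induction q using EReal.rec with
      | bot => exact absurd rfl hb2
      | top => 
        rw [EReal.coe_mul_top_of_pos h1', EReal.add_top_of_ne_bot]
        · exact le_top
        · rw [← EReal.coe_mul]; exact EReal.coe_ne_bot _
      | coe q =>
        have := key p q t h0.le h1.le le_rfl le_rfl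
        rw [← EReal.coe_mul, ← EReal.coe_mul, ← EReal.coe_add]
        exact this
  · rw [lowerSemicontinuous_iff_isClosed_preimage]
    intro y
    induction y using EReal.rec with
    | bot => 
      have : u ⁻¹' Set.Iic ⊥ = ∅ := by
        ext x; simp [hbot x]
      rw [this]; exact isClosed_empty
    | top => simp
    | coe y => exact hL y
  · obtain ⟨x, a, h⟩ := hP
    exact ⟨x, fun h' => by rw [h'] at h; simp at h⟩
  · intro M
    obtain ⟨R, hR⟩ := hK M
    refine ⟨R + 1, fun x hx => ?_⟩
    by_contra hcon
    have := hR x (not_le.1 hcon).le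
    linarith

section dest
variable {n : ℕ} {u : Vn n → EReal} (hu : u ∈ ConvCoe n)

theorem coe_conv (hu : u ∈ ConvCoe n) :
    ∀ x y : Vn n, ∀ a b t : ℝ, 0 ≤ t → t ≤ 1 → u x ≤ (a : EReal) → u y ≤ (b : EReal) →
      u (t • x + (1 - t) • y) ≤ ((t * a + (1 - t) * b : ℝ) : EReal) := by
  intro x y a b t h0 h1 hx hy
  rcases h0.eq_or_lt with rfl | h0
  · simpa using hy
  rcases h1.eq_or_lt with rfl | h1
  · simpa using hx
  refine (hu.1.1 x y t h0 h1).trans ?_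
  rw [EReal.coe_add, EReal.coe_mul, EReal.coe_mul]
  have h1' : (0 : ℝ) ≤ 1 - t := by linarith
  exact add_le_add (mul_le_mul_of_nonneg_left hx (by exact_mod_cast h0.le))
    (mul_le_mul_of_nonneg_left hy (by exact_mod_cast h1'))

theorem coe_epi (hu : u ∈ ConvCoe n) : IsClosed {p : Vn n × ℝ | u p.1 ≤ (p.2 : EReal)} := by
  have h := hu.1.2.1.isClosed_epigraph
  exact h.preimage (f := fun p : Vn n × ℝ => (p.1, (p.2 : EReal)))
    (continuous_fst.prodMk (continuous_coe_real_ereal.comp continuous_snd))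

theorem coe_proper (hu : u ∈ ConvCoe n) : ∃ x, ∃ a : ℝ, u x ≤ (a : EReal) := by
  obtain ⟨x, hx⟩ := hu.1.2.2.2
  exact ⟨x, (u x).toReal, EReal.le_coe_toReal hx⟩

theorem coe_bdd (hu : u ∈ ConvCoe n) (a : ℝ) : ∃ R : ℝ, ∀ x, u x ≤ (a : EReal) → ‖x‖ ≤ R := by
  obtain ⟨R, hR⟩ := hu.2 (a + 1)
  refine ⟨R, fun x hx => ?_⟩
  by_contra hcon
  have := (hR x (not_le.1 hcon).le).trans hx
  norm_cast at this
  linarith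

theorem coe_min (hu : u ∈ ConvCoe n) : ∃ x₀, ∃ c : ℝ, u x₀ = (c : EReal) ∧ ∀ x, (c : EReal) ≤ u x := by
  obtain ⟨x₁, a, ha⟩ := coe_proper hu
  obtain ⟨R, hR⟩ := coe_bdd hu a
  have hne : (Metric.closedBall (0 : Vn n) R).Nonempty := ⟨x₁, by simpa using hR x₁ ha⟩
  obtain ⟨x₀, hx₀, hmin⟩ := (hu.1.2.1.lowerSemicontinuousOn _).exists_isMinOn hne
    (isCompact_closedBall (0 : Vn n) R)
  have hx₁ : u x₀ ≤ u x₁ := hmin (by simpa using hR x₁ ha)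
  have htop : u x₀ ≠ ⊤ := fun h => by
    have := hx₁.trans ha
    rw [h] at this
    simp at this
  refine ⟨x₀, (u x₀).toReal, (EReal.coe_toReal htop (hu.1.2.2.1 x₀)).symm, fun x => ?_⟩
  rw [EReal.coe_toReal htop (hu.1.2.2.1 x₀)]
  by_cases h : u x ≤ a
  · exact hmin (by simpa using hR x h)
  · exact (hx₁.trans ha).trans (not_le.1 h).le

end dest

theorem trans_mem {n : ℕ} {u : Vn n → EReal} (hu : u ∈ ConvCoe n) (x₀ : Vn n) (c : ℝ) :
    (fun x => u (x - x₀) + (c : EReal)) ∈ ConvCoe n := by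
  apply mk_coe
  · intro x y a b t h0 h1 hx hy
    rw [add_le_iff'] at *
    have := coe_conv hu _ _ _ _ t h0 h1 hx hy
    convert this using 2
    · module
    · ring
  · intro a
    simp_rw [add_le_iff']
    exact (coe_epi hu).preimage (f := fun x : Vn n => (x - x₀, a - c)) (by fun_prop)
  · obtain ⟨_, m, -, hm⟩ := coe_min hu
    refine ⟨m + c, fun x => ?_⟩
    rw [EReal.coe_add]
    exact add_le_add (hm _) le_rfl
  · obtain ⟨x, a, h⟩ := coe_proper hu
    refine ⟨x + x₀, a + c, ?_⟩
    rw [add_le_iff']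
    simpa using h
  · intro a
    obtain ⟨R, hR⟩ := coe_bdd hu (a - c)
    refine ⟨R + ‖x₀‖, fun x hx => ?_⟩
    rw [add_le_iff'] at hx
    have h1 := hR _ hx
    have h2 := norm_add_le (x - x₀) x₀
    rw [sub_add_cancel] at h2
    linarith

theorem addnorm_mem {n : ℕ} {u : Vn n → EReal} (hu : u ∈ ConvCoe n) (s : ℝ) (hs : 0 ≤ s) :
    (fun x => u x + ((s * ‖x‖ : ℝ) : EReal)) ∈ ConvCoe n := by
  have hge : ∀ x, u x ≤ u x + ((s * ‖x‖ : ℝ) : EReal) := by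
    intro x
    apply le_add_of_nonneg_right
    have : 0 ≤ s * ‖x‖ := by positivity
    exact_mod_cast this
  apply mk_coe
  · intro x y a b t h0 h1 hx hy
    rw [add_le_iff'] at *
    have := coe_conv hu _ _ _ _ t h0 h1 hx hy
    refine this.trans ?_
    have h1' : (0 : ℝ) ≤ 1 - t := by linarith
    have h3 : ‖t • x + (1 - t) • y‖ ≤ t * ‖x‖ + (1 - t) * ‖y‖ := by
      refine (norm_add_le _ _).trans ?_
      rw [norm_smul, norm_smul, Real.norm_of_nonneg h0, Real.norm_of_nonneg h1']
    have := mul_le_mul_of_nonneg_left h3 hs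
    norm_cast
    linarith
  · intro a
    simp_rw [add_le_iff']
    exact (coe_epi hu).preimage (f := fun x : Vn n => (x, a - s * ‖x‖)) (by fun_prop)
  · obtain ⟨_, m, -, hm⟩ := coe_min hu
    exact ⟨m, fun x => (hm x).trans (hge x)⟩
  · obtain ⟨x, a, h⟩ := coe_proper hu
    refine ⟨x, a + s * ‖x‖, ?_⟩
    rw [add_le_iff']
    simpa using h
  · intro a
    obtain ⟨R, hR⟩ := coe_bdd hu a
    exact ⟨R, fun x hx => hR x ((hge x).trans hx)⟩

open Classical in
/-- Indicator of the origin. -/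
def ind0 (n : ℕ) : Vn n → EReal := fun x => if x = 0 then (0 : EReal) else ⊤

theorem ind0_le {n : ℕ} (x : Vn n) (a : ℝ) : ind0 n x ≤ (a : EReal) ↔ x = 0 ∧ 0 ≤ a := by
  unfold ind0
  split_ifs with h
  · simp [h]
  · simp [h]

theorem ind0_mem (n : ℕ) : ind0 n ∈ ConvCoe n := by
  apply mk_coe
  · intro x y a b t h0 h1 hx hy
    rw [ind0_le] at *
    obtain ⟨rfl, ha⟩ := hx
    obtain ⟨rfl, hb⟩ := hy
    have h1' : (0 : ℝ) ≤ 1 - t := by linarith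
    exact ⟨by simp, by positivity⟩
  · intro a
    simp_rw [ind0_le]
    exact (isClosed_eq continuous_id continuous_const).inter isClosed_const
  · refine ⟨0, fun x => ?_⟩
    unfold ind0
    split_ifs <;> simp
  · exact ⟨0, 0, (ind0_le _ _).2 ⟨rfl, le_rfl⟩⟩
  · intro a
    refine ⟨0, fun x hx => ?_⟩
    rw [ind0_le] at hx
    simp [hx.1]

theorem epi_of_le {n : ℕ} {uk : ℕ → Vn n → EReal} {w : Vn n → EReal}
    (hw : LowerSemicontinuous w) (hle : ∀ k x, w x ≤ uk k x)
    (ht : ∀ x, Tendsto (fun k => uk k x) atTop (𝓝 (w x))) : EpiConverges uk w := by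
  intro x
  refine ⟨fun xk hxk => ?_, fun _ => x, tendsto_const_nhds, ht x⟩
  refine le_of_forall_lt fun c hc => ?_
  obtain ⟨d, hcd, hd⟩ := exists_between hc
  refine hcd.trans_le (le_liminf_of_le (by isBoundedDefault) ?_)
  filter_upwards [hxk.eventually (hw x d hd)] with k hk
  exact hk.le.trans (hle k _)

/-! ### Sweeping -/

/-- Admissible parameter sets. -/
structure Adm (T : Set ℝ) : Prop where
  closed : IsClosed T
  conv : Convex ℝ T
  nonneg : ∀ t ∈ T, 0 ≤ t
  zero : (0 : ℝ) ∈ T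

/-- Real epigraph of the sweep. -/
def SweepEpi {n : ℕ} (T : Set ℝ) (e : Vn n) (s : ℝ) (u : Vn n → EReal) : Set (Vn n × ℝ) :=
  {p | ∃ t ∈ T, u (p.1 - t • e) ≤ ((p.2 - s * t : ℝ) : EReal)}

/-- The sweep `inf_{t ∈ T} u (x - t e) + s t`. -/
def Sweep {n : ℕ} (T : Set ℝ) (e : Vn n) (s : ℝ) (u : Vn n → EReal) : Vn n → EReal :=
  fun x => sInf ((fun b : ℝ => (b : EReal)) '' {b | (x, b) ∈ SweepEpi T e s u})

section sweep
variable {n : ℕ} {T : Set ℝ} {e : Vn n} {s : ℝ} {u : Vn n → EReal}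

theorem sweepEpi_closed (hT : Adm T) (hs : 0 < s) (hu : u ∈ ConvCoe n) :
    IsClosed (SweepEpi T e s u) := by
  obtain ⟨_, m, -, hm⟩ := coe_min hu
  apply IsSeqClosed.isClosed
  intro p q hp hpq
  choose t ht htu using hp
  have h2 : Tendsto (fun k => (p k).2) atTop (𝓝 q.2) := (continuous_snd.tendsto q).comp hpq
  have h1 : Tendsto (fun k => (p k).1) atTop (𝓝 q.1) := (continuous_fst.tendsto q).comp hpq
  obtain ⟨A, hA⟩ := h2.bddAbove_range
  have htb : ∀ k, t k ∈ Set.Icc (0 : ℝ) ((A - m) / s) := by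
    intro k
    refine ⟨hT.nonneg _ (ht k), ?_⟩
    have h3 := (hm _).trans (htu k)
    norm_cast at h3
    have h4 : (p k).2 ≤ A := hA ⟨k, rfl⟩
    rw [le_div_iff₀ hs]
    linarith
  obtain ⟨τ, -, φ, hφ, hτ⟩ := isCompact_Icc.tendsto_subseq htb
  refine ⟨τ, hT.closed.mem_of_tendsto hτ (Eventually.of_forall fun k => ht _), ?_⟩
  have := (coe_epi hu).mem_of_tendsto
    (f := fun k => ((p (φ k)).1 - t (φ k) • e, (p (φ k)).2 - s * t (φ k)))
    (b := atTop) (x := (q.1 - τ • e, q.2 - s * τ)) ?_ (Eventually.of_forall fun k => htu _)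
  · exact this
  · apply Tendsto.prodMk_nhds
    · exact (h1.comp hφ.tendsto_atTop).sub (hτ.smul_const e)
    · exact (h2.comp hφ.tendsto_atTop).sub (hτ.const_mul s)

theorem sweep_le (hT : Adm T) (hs : 0 < s) (hu : u ∈ ConvCoe n) (x : Vn n) (a : ℝ) :
    Sweep T e s u x ≤ (a : EReal) ↔ ∃ t ∈ T, u (x - t • e) ≤ ((a - s * t : ℝ) : EReal) := by
  constructor
  · intro h
    have key : ∀ k : ℕ, (x, a + 1 / ((k : ℝ) + 1)) ∈ SweepEpi T e s u := by
      intro k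
      have hlt : Sweep T e s u x < ((a + 1 / ((k : ℝ) + 1) : ℝ) : EReal) := by
        refine h.trans_lt ?_
        have : 0 < 1 / ((k : ℝ) + 1) := by positivity
        exact_mod_cast (by linarith : a < a + 1 / ((k : ℝ) + 1))
      obtain ⟨_, ⟨b, ⟨t, ht, hb⟩, rfl⟩, hb'⟩ := sInf_lt_iff.1 hlt
      refine ⟨t, ht, hb.trans ?_⟩
      have hb'' : b < a + 1 / ((k : ℝ) + 1) := EReal.coe_lt_coe_iff.1 hb'
      apply EReal.coe_le_coe_iff.2
      simp only
      linarith
    have := (sweepEpi_closed (e := e) hT hs hu).mem_of_tendsto (b := atTop) (x := (x, a)) ?_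
      (Eventually.of_forall key)
    · exact this
    · apply Tendsto.prodMk_nhds tendsto_const_nhds
      simpa using tendsto_const_nhds.add (tendsto_one_div_add_atTop_nhds_zero_nat (𝕜 := ℝ))
  · rintro ⟨t, ht, h⟩
    exact sInf_le ⟨a, ⟨t, ht, h⟩, rfl⟩

theorem sweep_mem (hT : Adm T) (hs : 0 < s) (hu : u ∈ ConvCoe n) :
    Sweep T e s u ∈ ConvCoe n := by
  obtain ⟨_, m, -, hm⟩ := coe_min hu
  apply mk_coe
  · intro x y a b t h0 h1 hx hy
    rw [sweep_le hT hs hu] at *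
    obtain ⟨p, hp, hx⟩ := hx
    obtain ⟨q, hq, hy⟩ := hy
    refine ⟨t * p + (1 - t) * q, hT.conv hp hq h0 (by linarith) (by ring), ?_⟩
    convert coe_conv hu _ _ _ _ t h0 h1 hx hy using 2
    · module
    · ring
  · intro a
    have : {x | Sweep T e s u x ≤ (a : EReal)} = (fun x => (x, a)) ⁻¹' SweepEpi T e s u := by
      ext x
      exact sweep_le hT hs hu x a
    rw [this]
    exact (sweepEpi_closed hT hs hu).preimage (by fun_prop)
  · refine ⟨m, fun x => ?_⟩
    apply le_sInf
    rintro _ ⟨b, ⟨t, ht, hb⟩, rfl⟩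
    have h3 := (hm _).trans hb
    have := mul_nonneg hs.le (hT.nonneg t ht)
    norm_cast at h3 
    simp only at h3
    apply EReal.coe_le_coe_iff.2
    linarith
  · obtain ⟨x, a, h⟩ := coe_proper hu
    exact ⟨x, a, (sweep_le hT hs hu x a).2 ⟨0, hT.zero, by simpa using h⟩⟩
  · intro a
    obtain ⟨R, hR⟩ := coe_bdd hu a
    refine ⟨R + (a - m) / s * ‖e‖, fun x hx => ?_⟩
    obtain ⟨t, ht, hb⟩ := (sweep_le hT hs hu x a).1 hx
    have h0 := hT.nonneg t ht
    have hst := mul_nonneg hs.le h0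
    have h3 := (hm _).trans hb
    norm_cast at h3
    have h4 := hR _ (hb.trans (EReal.coe_le_coe_iff.2 (by linarith)))
    have h5 : t ≤ (a - m) / s := by
      rw [le_div_iff₀ hs]
      linarith
    have h6 := norm_add_le (x - t • e) (t • e)
    rw [sub_add_cancel, norm_smul, Real.norm_of_nonneg h0] at h6
    have h7 := mul_le_mul_of_nonneg_right h5 (norm_nonneg e)
    linarith

theorem adm_ray : Adm (Set.Ici 0) := ⟨isClosed_Ici, convex_Ici 0, fun _ h => h, Set.self_mem_Ici⟩

theorem adm_seg {l : ℝ} (hl : 0 ≤ l) : Adm (Set.Icc 0 l) :=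
  ⟨isClosed_Icc, convex_Icc 0 l, fun _ h => h.1, ⟨le_rfl, hl⟩⟩

variable {Z : (Vn n → EReal) → ℝ}

theorem Z_seg (hval : IsValuation (ConvCoe n) Z) (hinv : EpiTranslationInvariant (ConvCoe n) Z)
    (hs : 0 < s) (hu : u ∈ ConvCoe n) {l : ℝ} (hl : 0 ≤ l) :
    Z (Sweep (Set.Icc 0 l) e s u) = Z u := by
  have hA := sweep_mem (e := e) (adm_seg hl) hs hu
  have hR := sweep_mem (e := e) adm_ray hs hu
  have hB := trans_mem hR (l • e) (s * l)
  have hD := trans_mem hu (l • e) (s * l)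
  have h1 : Sweep (Set.Icc 0 l) e s u ⊔ (fun x => Sweep (Set.Ici 0) e s u (x - l • e) + ((s * l : ℝ) : EReal))
      = fun x => u (x - l • e) + ((s * l : ℝ) : EReal) := by
    funext x
    apply ereal_ext_real
    intro a
    rw [Pi.sup_apply, sup_le_iff, add_le_iff', add_le_iff', sweep_le (adm_seg hl) hs hu,
      sweep_le adm_ray hs hu]
    constructor
    · rintro ⟨⟨p, ⟨hp0, hp1⟩, hp⟩, q, hq0, hq⟩
      have hq0 : 0 ≤ q := hq0
      rcases hp1.eq_or_lt with rfl | hlt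
      · exact hp
      · have hpos : 0 < l + q - p := by linarith
        have := coe_conv hu _ _ _ _ (q / (l + q - p)) (by positivity)
          (by rw [div_le_one hpos]; linarith) hp hq
        convert this using 2
        · match_scalars
          · field_simp; ring
          · field_simp; ring
        · field_simp; ring
    · intro h
      exact ⟨⟨l, ⟨hl, le_rfl⟩, h⟩, 0, Set.self_mem_Ici, by simpa using h⟩
  have h2 : Sweep (Set.Icc 0 l) e s u ⊓ (fun x => Sweep (Set.Ici 0) e s u (x - l • e) + ((s * l : ℝ) : EReal))
      = Sweep (Set.Ici 0) e s u := by
    funext x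
    apply ereal_ext_real
    intro a
    rw [Pi.inf_apply, inf_le_iff, add_le_iff', sweep_le (adm_seg hl) hs hu,
      sweep_le adm_ray hs hu, sweep_le adm_ray hs hu]
    constructor
    · rintro (⟨p, ⟨hp0, hp1⟩, hp⟩ | ⟨q, hq0, hq⟩)
      · exact ⟨p, hp0, hp⟩
      · have hq0 : 0 ≤ q := hq0
        refine ⟨l + q, add_nonneg hl hq0, ?_⟩
        convert hq using 2
        · module
        · ring
    · rintro ⟨q, hq0, hq⟩
      rcases le_total q l with h | h
      · exact Or.inl ⟨q, ⟨hq0, h⟩, hq⟩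
      · refine Or.inr ⟨q - l, sub_nonneg.2 h, ?_⟩
        convert hq using 2
        · module
        · ring
  have h := hval _ _ hA hB (by rw [h1]; exact hD) (by rw [h2]; exact hR)
  rw [h1, h2, hinv _ hu, hinv _ hR] at h
  linarith

theorem Z_ray (hcont : ContinuousVal (ConvCoe n) Z)
    (hval : IsValuation (ConvCoe n) Z) (hinv : EpiTranslationInvariant (ConvCoe n) Z)
    (hs : 0 < s) (hu : u ∈ ConvCoe n) :
    Z (Sweep (Set.Ici 0) e s u) = Z u := by
  have hR := sweep_mem (e := e) adm_ray hs hu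
  have hle : ∀ (k : ℕ) x, Sweep (Set.Ici 0) e s u x ≤ Sweep (Set.Icc 0 (k : ℝ)) e s u x := by
    intro k x
    apply sInf_le_sInf
    apply Set.image_mono
    rintro b ⟨t, ht, h⟩
    exact ⟨t, ht.1, h⟩
  have := hcont (fun k : ℕ => Sweep (Set.Icc 0 (k : ℝ)) e s u) _
    (fun k => sweep_mem (adm_seg k.cast_nonneg) hs hu) hR
    (epi_of_le hR.1.2.1 hle ?_)
  · simp_rw [Z_seg hval hinv hs hu (Nat.cast_nonneg _)] at this
    exact tendsto_nhds_unique this tendsto_const_nhds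
  · intro x
    by_cases htop : Sweep (Set.Ici 0) e s u x = ⊤
    · rw [htop]
      have : ∀ k : ℕ, Sweep (Set.Icc 0 (k : ℝ)) e s u x = ⊤ := fun k =>
        top_le_iff.1 (htop ▸ hle k x)
      simp_rw [this]
      exact tendsto_const_nhds
    · set r := Sweep (Set.Ici 0) e s u x with hr
      have hc : ((r.toReal : ℝ) : EReal) = r := EReal.coe_toReal htop (hR.1.2.2.1 x)
      obtain ⟨t, ht, h⟩ := (sweep_le adm_ray hs hu x r.toReal).1 (by rw [hc])
      apply tendsto_const_nhds.congr'
      filter_upwards [eventually_ge_atTop ⌈t⌉₊] with k hk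
      apply le_antisymm (hle k x)
      rw [← hr, ← hc]
      exact (sweep_le (adm_seg k.cast_nonneg) hs hu x r.toReal).2 ⟨t, ⟨ht, Nat.ceil_le.1 hk⟩, h⟩

end sweep

/-! ### Iterated sweeping -/

/-- Iterated ray sweep. -/
def Fold {n : ℕ} (s : ℝ) (u : Vn n → EReal) : List (Vn n) → (Vn n → EReal)
  | [] => u
  | e :: l => Sweep (Set.Ici 0) e s (Fold s u l)

/-- `z` is a nonnegative combination of the list with coefficient sum `τ`. -/
def ConeRep {n : ℕ} : List (Vn n) → Vn n → ℝ → Prop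
  | [], z, τ => z = 0 ∧ τ = 0
  | e :: l, z, τ => ∃ t : ℝ, 0 ≤ t ∧ ConeRep l (z - t • e) (τ - t)

section fold
variable {n : ℕ} {s : ℝ} {u : Vn n → EReal}

theorem fold_mem (hs : 0 < s) (hu : u ∈ ConvCoe n) (l : List (Vn n)) : Fold s u l ∈ ConvCoe n := by
  induction l with
  | nil => exact hu
  | cons e l ih => exact sweep_mem adm_ray hs ih

theorem fold_le (hs : 0 < s) (hu : u ∈ ConvCoe n) (l : List (Vn n)) (x : Vn n) (a : ℝ) :
    Fold s u l x ≤ (a : EReal) ↔ ∃ z τ, ConeRep l z τ ∧ u (x - z) ≤ ((a - s * τ : ℝ) : EReal) := by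
  induction l generalizing x a with
  | nil => simp [Fold, ConeRep]
  | cons e l ih =>
    simp only [Fold, ConeRep]
    rw [sweep_le adm_ray hs (fold_mem hs hu l)]
    constructor
    · rintro ⟨t, ht, h⟩
      obtain ⟨z, τ, hr, h⟩ := (ih _ _).1 h
      refine ⟨z + t • e, τ + t, ⟨t, ht, by simpa using hr⟩, ?_⟩
      convert h using 2
      · module
      · ring
    · rintro ⟨z, τ, ⟨t, ht, hr⟩, h⟩
      refine ⟨t, ht, (ih _ _).2 ⟨_, _, hr, ?_⟩⟩
      convert h using 2
      · module
      · ring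

theorem rep_add (l : List (Vn n)) : ∀ {z w : Vn n} {τ σ : ℝ}, ConeRep l z τ → ConeRep l w σ →
    ConeRep l (z + w) (τ + σ) := by
  induction l with
  | nil =>
    rintro z w τ σ ⟨rfl, rfl⟩ ⟨rfl, rfl⟩
    simp [ConeRep]
  | cons e l ih =>
    rintro z w τ σ ⟨t, ht, h⟩ ⟨r, hr, h'⟩
    refine ⟨t + r, add_nonneg ht hr, ?_⟩
    convert ih h h' using 1
    · module
    · ring

/-- The directions `± e_i`. -/
def dirs {n : ℕ} : List (Fin n) → List (Vn n)
  | [] => []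
  | i :: L => EuclideanSpace.single i 1 :: (-EuclideanSpace.single i 1) :: dirs L

theorem rep_dirs (y : Vn n) (L : List (Fin n)) :
    ConeRep (dirs L) (L.map fun i => y i • (EuclideanSpace.single i 1 : Vn n)).sum
      (L.map fun i => |y i|).sum := by
  induction L with
  | nil => simp [dirs, ConeRep]
  | cons i L ih =>
    simp only [dirs, ConeRep, List.map_cons, List.sum_cons]
    refine ⟨max (y i) 0, le_max_right _ _, max (-y i) 0, le_max_right _ _, ?_⟩
    convert ih using 1
    · rcases le_total 0 (y i) with h | h
      · rw [max_eq_left h, max_eq_right (by linarith)]; module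
      · rw [max_eq_right h, max_eq_left (by linarith)]; module
    · rcases le_total 0 (y i) with h | h
      · rw [max_eq_left h, max_eq_right (by linarith), abs_of_nonneg h]; ring
      · rw [max_eq_right h, max_eq_left (by linarith), abs_of_nonpos h]; ring

theorem rep_all (y : Vn n) : ∃ τ, ConeRep (dirs (List.finRange n)) y τ ∧ τ ≤ n * ‖y‖ := by
  refine ⟨((List.finRange n).map fun i => |y i|).sum, ?_, ?_⟩
  · have := rep_dirs y (List.finRange n)
    convert this using 1
    rw [← List.ofFn_eq_map, List.sum_ofFn]
    ext j
    simp [Finset.sum_apply, Pi.single_apply]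
  · rw [← List.ofFn_eq_map, List.sum_ofFn]
    calc _ ≤ ∑ _i : Fin n, ‖y‖ := Finset.sum_le_sum fun i _ => PiLp.norm_apply_le y i
      _ = _ := by simp

theorem Z_fold {Z : (Vn n → EReal) → ℝ} (hcont : ContinuousVal (ConvCoe n) Z)
    (hval : IsValuation (ConvCoe n) Z) (hinv : EpiTranslationInvariant (ConvCoe n) Z)
    (hs : 0 < s) (hu : u ∈ ConvCoe n) (l : List (Vn n)) : Z (Fold s u l) = Z u := by
  induction l with
  | nil => rfl
  | cons e l ih => exact (Z_ray hcont hval hinv hs (fold_mem hs hu l)).trans ih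

theorem Z_cone {Z : (Vn n → EReal) → ℝ} (hcont : ContinuousVal (ConvCoe n) Z)
    (hval : IsValuation (ConvCoe n) Z) (hinv : EpiTranslationInvariant (ConvCoe n) Z)
    (hs : 0 < s) (hu : u ∈ ConvCoe n) (h0 : u 0 ≤ 0)
    (hge : ∀ (x : Vn n) (a : ℝ), u x ≤ (a : EReal) → s * ‖x‖ ≤ a) : Z u = Z (ind0 n) := by
  have hs' : 0 < s / (n + 1) := by positivity
  rw [← Z_fold hcont hval hinv hs' hu (dirs (List.finRange n)),
    ← Z_fold hcont hval hinv hs' (ind0_mem n) (dirs (List.finRange n))]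
  congr 1
  funext x
  apply ereal_ext_real
  intro a
  rw [fold_le hs' hu, fold_le hs' (ind0_mem n)]
  constructor
  · rintro ⟨z, τ, hr, h⟩
    obtain ⟨σ, hσ, hσ'⟩ := rep_all (x - z)
    refine ⟨_, _, rep_add _ hr hσ, ?_⟩
    rw [ind0_le]
    refine ⟨by simp, ?_⟩
    have h1 := hge _ _ h
    have h2 : s / (n + 1) * σ ≤ s * ‖x - z‖ := by
      rw [div_mul_eq_mul_div, div_le_iff₀ (by positivity)]
      have : σ ≤ (n + 1) * ‖x - z‖ := by linarith [norm_nonneg (x - z)]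
      nlinarith
    linarith
  · rintro ⟨z, τ, hr, h⟩
    rw [ind0_le] at h
    refine ⟨z, τ, hr, ?_⟩
    rw [h.1]
    exact h0.trans (by exact_mod_cast h.2)

end fold

/-- **Triviality on coercive functions** (Theorem 9.1): every continuous and
epi-translation invariant valuation on `Conv_coe(ℝⁿ)` is constant. -/
theorem constant_on_coercive (n : ℕ) (Z : (Vn n → EReal) → ℝ)
    (hcont : ContinuousVal (ConvCoe n) Z)
    (hval : IsValuation (ConvCoe n) Z)
    (hinv : EpiTranslationInvariant (ConvCoe n) Z) :
    ∃ c : ℝ, ∀ u ∈ ConvCoe n, Z u = c := by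
  refine ⟨Z (ind0 n), fun u hu => ?_⟩
  obtain ⟨x₀, c, hc, hmin⟩ := coe_min hu
  have hv := trans_mem hu (-x₀) (-c)
  rw [← hinv u hu (-x₀) (-c)]
  have hv0 : (fun x => u (x - -x₀) + ((-c : ℝ) : EReal)) 0 ≤ 0 := by
    have := (add_le_iff' (u (0 - -x₀)) (-c) 0).2 (by simp [hc])
    exact_mod_cast this
  have hvn : ∀ x, 0 ≤ (fun x => u (x - -x₀) + ((-c : ℝ) : EReal)) x := by
    intro x
    have := add_le_add (hmin (x - -x₀)) (le_refl ((-c : ℝ) : EReal))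
    rw [← EReal.coe_add] at this
    simpa using this
  generalize (fun x => u (x - -x₀) + ((-c : ℝ) : EReal)) = v at *
  have hpos : ∀ k : ℕ, 0 < 1 / ((k : ℝ) + 1) := fun k => by positivity
  have hz : ∀ k : ℕ, Z (fun x => v x + ((1 / ((k : ℝ) + 1) * ‖x‖ : ℝ) : EReal)) = Z (ind0 n) := by
    intro k
    apply Z_cone hcont hval hinv (hpos k) (addnorm_mem hv _ (hpos k).le)
    · simpa using hv0
    · intro x a h
      rw [add_le_iff'] at h
      have := (hvn x).trans h
      have : (0 : ℝ) ≤ a - 1 / ((k : ℝ) + 1) * ‖x‖ := by exact_mod_cast this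
      linarith
  have := hcont (fun k : ℕ => fun x => v x + ((1 / ((k : ℝ) + 1) * ‖x‖ : ℝ) : EReal)) v
    (fun k => addnorm_mem hv _ (hpos k).le) hv (epi_of_le hv.1.2.1 ?_ ?_)
  · simp_rw [hz] at this
    exact tendsto_nhds_unique this tendsto_const_nhds
  · intro k x
    apply le_add_of_nonneg_right
    have : 0 ≤ 1 / ((k : ℝ) + 1) * ‖x‖ := mul_nonneg (hpos k).le (norm_nonneg x)
    exact_mod_cast this
  · intro x
    have hl : Tendsto (fun k : ℕ => 1 / ((k : ℝ) + 1) * ‖x‖) atTop (𝓝 0) := by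
      simpa using (tendsto_one_div_add_atTop_nhds_zero_nat (𝕜 := ℝ)).mul_const ‖x‖
    have hl' := (continuous_coe_real_ereal.tendsto 0).comp hl
    have hb := hv.1.2.2.1 x
    generalize v x = p at *
    induction p using EReal.rec with
    | bot => exact absurd rfl hb
    | top =>
      simp_rw [EReal.top_add_coe]
      exact tendsto_const_nhds
    | coe p =>
      have := (continuous_coe_real_ereal.tendsto _).comp (hl.const_add p)
      simpa [Function.comp_def] using this
end
end
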